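/- arXiv:2211.16156 — 4 statements merged into one kernel-verified Lean document; each statement's English description precedes it below -/
import Mathlib

section
/- There exists N such that for all n ≥ N the following holds. If A is a uniformly random n-sided die in the balanced sequences model, then with probability at least 1 − n^{−5} over A, one has |f̂(α,β)|^n ≤ n^{−10} for every (α,β) ∈ [−1/2,1/2]² such that |α| ≥ 10^7·log n / n or |β| ≥ 10^9·(log n / n)^{3/2}. -/
open Finset

def dieFinset (n : ℕ) : Finset (Fin n → ℕ) :=
  (Fintype.piFinset fun _ : Fin n => Finset.Icc 1 n).filter
    fun A => ∑ i, A i = n * (n + 1) / 2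

def beats {n : ℕ} (A B : Fin n → ℕ) : Prop :=
  ((Finset.univ : Finset (Fin n × Fin n)).filter fun p => B p.2 < A p.1).card >
    ((Finset.univ : Finset (Fin n × Fin n)).filter fun p => A p.1 < B p.2).card

def ties {n : ℕ} (A B : Fin n → ℕ) : Prop :=
  ((Finset.univ : Finset (Fin n × Fin n)).filter fun p => B p.2 < A p.1).card =
    ((Finset.univ : Finset (Fin n × Fin n)).filter fun p => A p.1 < B p.2).card

instance {n : ℕ} (A B : Fin n → ℕ) : Decidable (beats A B) := by unfold beats; infer_instance
instance {n : ℕ} (A B : Fin n → ℕ) : Decidable (ties A B) := by unfold ties; infer_instance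

noncomputable def fA {n : ℕ} (A : Fin n → ℕ) (j : ℕ) : ℝ :=
  ((Finset.univ.filter fun i => A i < j).card : ℝ) +
    (1 / 2) * ((Finset.univ.filter fun i => A i = j).card : ℝ)

noncomputable def gA {n : ℕ} (A : Fin n → ℕ) (j : ℕ) : ℝ := fA A j - j + 1 / 2

noncomputable def e (x : ℝ) : ℂ := Complex.exp (2 * Real.pi * Complex.I * x)

noncomputable def fhat (n : ℕ) (A : Fin n → ℕ) (α β : ℝ) : ℂ :=
  (n : ℂ)⁻¹ * ∑ j ∈ Finset.Icc 1 n, e (α * gA A j + β * ((j : ℝ) - (n + 1) / 2))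

open scoped Classical

/-- the phase -/
noncomputable def phs (n : ℕ) (A : Fin n → ℕ) (α β : ℝ) (j : ℕ) : ℝ :=
  α * gA A j + β * ((j : ℝ) - (n + 1) / 2)

lemma cos_le_norm_sq (x : ℝ) :
    Real.cos (2 * Real.pi * x) ≤ 1 - 8 * ‖(x : UnitAddCircle)‖ ^ 2 := by
  rw [UnitAddCircle.norm_eq, sq_abs]
  have h1 : Real.cos (2 * Real.pi * x) = Real.cos (2 * Real.pi * (x - round x)) := by
    rw [← Real.cos_sub_int_mul_two_pi (2 * Real.pi * x) (round x)]
    congr 1; ring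
  have hpi := Real.pi_pos
  have h2 : |2 * Real.pi * (x - round x)| ≤ Real.pi := by
    rw [abs_mul, abs_of_pos (by positivity : (0:ℝ) < 2 * Real.pi)]
    have := abs_sub_round x
    nlinarith
  rw [h1]
  refine (Real.cos_le_one_sub_mul_cos_sq h2).trans (le_of_eq ?_)
  field_simp
  ring

lemma exists_theta (n : ℕ) (hn : 0 < n) (A : Fin n → ℕ) (α β : ℝ) :
    ∃ θ : ℝ, 8 * ∑ j ∈ Icc 1 n, ‖((phs n A α β j - θ : ℝ) : UnitAddCircle)‖ ^ 2
      ≤ n * (1 - ‖fhat n A α β‖) := by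
  set S : ℂ := ∑ j ∈ Finset.Icc 1 n, e (phs n A α β j) with hS
  have hf : fhat n A α β = (n : ℂ)⁻¹ * S := rfl
  have hn' : (0:ℝ) < n := by exact_mod_cast hn
  have hnorm : n * ‖fhat n A α β‖ = ‖S‖ := by
    rw [hf, norm_mul, norm_inv, Complex.norm_natCast]
    field_simp
  set θ : ℝ := S.arg / (2 * Real.pi) with hθ
  refine ⟨θ, ?_⟩
  have hpi := Real.pi_pos
  have h1 : (‖S‖ : ℂ) = ∑ j ∈ Finset.Icc 1 n, e (phs n A α β j - θ) := by
    have h2 := Complex.norm_mul_exp_arg_mul_I S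
    have h3 : (‖S‖ : ℂ) = S * Complex.exp (-(S.arg * Complex.I)) := by
      nth_rw 2 [← h2]
      rw [mul_assoc, ← Complex.exp_add]; simp
    rw [h3, hS, Finset.sum_mul]
    refine Finset.sum_congr rfl fun j _ => ?_
    rw [e, e, ← Complex.exp_add]
    congr 1
    have : (S.arg : ℂ) = 2 * Real.pi * θ := by
      rw [hθ]; push_cast
      have : (Real.pi : ℂ) ≠ 0 := by exact_mod_cast hpi.ne'
      field_simp
    rw [← hS, this]; push_cast; ring
  have h4 : ‖S‖ = ∑ j ∈ Finset.Icc 1 n, Real.cos (2 * Real.pi * (phs n A α β j - θ)) := by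
    have := congrArg Complex.re h1
    rw [Complex.ofReal_re, Complex.re_sum] at this
    rw [this]
    refine Finset.sum_congr rfl fun j _ => ?_
    rw [e]
    have : (2 * Real.pi * Complex.I * ((phs n A α β j - θ : ℝ) : ℂ)) =
      ((2 * Real.pi * (phs n A α β j - θ) : ℝ) : ℂ) * Complex.I := by push_cast; ring
    rw [this, Complex.exp_ofReal_mul_I_re]
  have h5 : ‖S‖ ≤ ∑ j ∈ Finset.Icc 1 n,
      (1 - 8 * ‖((phs n A α β j - θ : ℝ) : UnitAddCircle)‖ ^ 2) := by
    rw [h4]; exact Finset.sum_le_sum fun j _ => cos_le_norm_sq _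
  rw [Finset.sum_sub_distrib, ← Finset.mul_sum] at h5
  simp at h5
  rw [mul_sub, hnorm]
  simp only [AddCircle.coe_sub] at *
  linarith

/-- the second difference of `fA` -/
noncomputable def G2 {n : ℕ} (A : Fin n → ℕ) (m j : ℕ) : ℝ :=
  fA A (j + 2 * m) - 2 * fA A (j + m) + fA A j

lemma second_diff (n : ℕ) (hn : 0 < n) (A : Fin n → ℕ) (α β : ℝ) (m : ℕ) (J : Finset ℕ)
    (hJ : ∀ j ∈ J, 1 ≤ j ∧ j + 2 * m ≤ n) :
    8 * ∑ j ∈ J, ‖((α * G2 A m j : ℝ) : UnitAddCircle)‖ ^ 2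
      ≤ 18 * (n * (1 - ‖fhat n A α β‖)) := by
  obtain ⟨θ, hθ⟩ := exists_theta n hn A α β
  set d : ℕ → ℝ := fun j => ‖((phs n A α β j - θ : ℝ) : UnitAddCircle)‖ with hd
  have hsub : ∀ a : ℕ, a ≤ 2 * m → ∑ j ∈ J, d (j + a) ^ 2 ≤ ∑ j ∈ Icc 1 n, d j ^ 2 := by
    intro a ha
    have : ∑ j ∈ J, d (j + a) ^ 2 = ∑ j ∈ J.image (· + a), d j ^ 2 := by
      rw [Finset.sum_image]; intro x _ y _ h; simpa using h
    rw [this]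
    refine Finset.sum_le_sum_of_subset_of_nonneg ?_ fun _ _ _ => by positivity
    intro x hx
    obtain ⟨j, hj, rfl⟩ := Finset.mem_image.1 hx
    have := hJ j hj
    rw [Finset.mem_Icc]
    constructor <;> omega
  have hpt : ∀ j ∈ J, ‖((α * G2 A m j : ℝ) : UnitAddCircle)‖ ^ 2 ≤
      6 * (d (j + 0) ^ 2 + d (j + m) ^ 2 + d (j + 2 * m) ^ 2) := by
    intro j _
    have h1 : ((α * G2 A m j : ℝ) : UnitAddCircle) =
        ((phs n A α β (j + 2 * m) - θ : ℝ) : UnitAddCircle)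
        - ((phs n A α β (j + m) - θ : ℝ) : UnitAddCircle)
        - ((phs n A α β (j + m) - θ : ℝ) : UnitAddCircle)
        + ((phs n A α β (j + 0) - θ : ℝ) : UnitAddCircle) := by
      rw [← AddCircle.coe_sub, ← AddCircle.coe_sub, ← AddCircle.coe_add]
      congr 1
      simp only [phs, G2, gA]
      push_cast
      ring_nf
    have h2 : ‖((α * G2 A m j : ℝ) : UnitAddCircle)‖ ≤
        d (j + 2 * m) + d (j + m) + d (j + m) + d (j + 0) := by
      rw [h1]
      refine (norm_add_le _ _).trans ?_
      refine add_le_add ?_ le_rfl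
      refine (norm_sub_le _ _).trans ?_
      refine add_le_add ?_ le_rfl
      exact norm_sub_le _ _
    have h0 := norm_nonneg ((α * G2 A m j : ℝ) : UnitAddCircle)
    have h3 := pow_le_pow_left₀ h0 h2 2
    refine h3.trans ?_
    nlinarith [sq_nonneg (d (j + 2 * m) - d (j + 0)), sq_nonneg (2 * d (j + 2 * m) - d (j + m)),
      sq_nonneg (2 * d (j + 0) - d (j + m))]
  have h5 := Finset.sum_le_sum hpt
  rw [← Finset.mul_sum, Finset.sum_add_distrib, Finset.sum_add_distrib] at h5
  have e0 := hsub 0 (by omega)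
  have e1 := hsub m (by omega)
  have e2 := hsub (2 * m) le_rfl
  have : 8 * ∑ j ∈ Icc 1 n, d j ^ 2 ≤ n * (1 - ‖fhat n A α β‖) := hθ
  linarith

lemma first_diff (n : ℕ) (hn : 0 < n) (A : Fin n → ℕ) (α β : ℝ) (m : ℕ) (J : Finset ℕ)
    (hJ : ∀ j ∈ J, 1 ≤ j ∧ j + m ≤ n) :
    2 * ∑ j ∈ J, ‖((α * (gA A (j + m) - gA A j) + β * m : ℝ) : UnitAddCircle)‖ ^ 2
      ≤ n * (1 - ‖fhat n A α β‖) := by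
  obtain ⟨θ, hθ⟩ := exists_theta n hn A α β
  set d : ℕ → ℝ := fun j => ‖((phs n A α β j - θ : ℝ) : UnitAddCircle)‖ with hd
  have hsub : ∀ a : ℕ, a ≤ m → ∑ j ∈ J, d (j + a) ^ 2 ≤ ∑ j ∈ Icc 1 n, d j ^ 2 := by
    intro a ha
    have : ∑ j ∈ J, d (j + a) ^ 2 = ∑ j ∈ J.image (· + a), d j ^ 2 := by
      rw [Finset.sum_image]; intro x _ y _ h; simpa using h
    rw [this]
    refine Finset.sum_le_sum_of_subset_of_nonneg ?_ fun _ _ _ => by positivity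
    intro x hx
    obtain ⟨j, hj, rfl⟩ := Finset.mem_image.1 hx
    have := hJ j hj
    rw [Finset.mem_Icc]
    constructor <;> omega
  have hpt : ∀ j ∈ J, ‖((α * (gA A (j + m) - gA A j) + β * m : ℝ) : UnitAddCircle)‖ ^ 2 ≤
      2 * (d (j + 0) ^ 2 + d (j + m) ^ 2) := by
    intro j _
    have h1 : ((α * (gA A (j + m) - gA A j) + β * m : ℝ) : UnitAddCircle) =
        ((phs n A α β (j + m) - θ : ℝ) : UnitAddCircle)
        - ((phs n A α β (j + 0) - θ : ℝ) : UnitAddCircle) := by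
      rw [← AddCircle.coe_sub]
      congr 1
      simp only [phs]
      push_cast
      ring_nf
    have h2 : ‖((α * (gA A (j + m) - gA A j) + β * m : ℝ) : UnitAddCircle)‖ ≤
        d (j + m) + d (j + 0) := by
      rw [h1]
      exact norm_sub_le _ _
    have h0 := norm_nonneg ((α * (gA A (j + m) - gA A j) + β * m : ℝ) : UnitAddCircle)
    have h3 := pow_le_pow_left₀ h0 h2 2
    refine h3.trans ?_
    nlinarith [sq_nonneg (d (j + m) - d (j + 0))]
  have h5 := Finset.sum_le_sum hpt
  rw [← Finset.mul_sum, Finset.sum_add_distrib] at h5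
  have e0 := hsub 0 (by omega)
  have e1 := hsub m (by omega)
  have : 8 * ∑ j ∈ Icc 1 n, d j ^ 2 ≤ n * (1 - ‖fhat n A α β‖) := hθ
  linarith

lemma power_bound (n : ℕ) (hn : 0 < n) (A : Fin n → ℕ) (α β : ℝ)
    (h : 10 * Real.log n ≤ n * (1 - ‖fhat n A α β‖)) :
    ‖fhat n A α β‖ ^ n ≤ (n : ℝ) ^ (-10 : ℤ) := by
  have hn' : (0:ℝ) < n := by exact_mod_cast hn
  have h1 : ‖fhat n A α β‖ ≤ Real.exp (-(10 * Real.log n / n)) := by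
    have h2 := Real.add_one_le_exp (-(10 * Real.log n / n))
    have h3 : 10 * Real.log n / n ≤ 1 - ‖fhat n A α β‖ := by
      rw [div_le_iff₀ hn']; linarith
    linarith
  refine (pow_le_pow_left₀ (norm_nonneg _) h1 n).trans (le_of_eq ?_)
  rw [← Real.exp_nat_mul]
  have : (n:ℝ) * -(10 * Real.log n / n) = Real.log n * (-10 : ℤ) := by
    field_simp
    push_cast; ring
  rw [this, ← Real.rpow_intCast, Real.rpow_def_of_pos hn']


noncomputable def sg (b : Bool) : ℝ := if b then 1 else -1

lemma sg_sq (b : Bool) : sg b ^ 2 = 1 := by cases b <;> simp [sg]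

lemma sg_not (b : Bool) : sg (!b) = - sg b := by cases b <;> simp [sg]

/-- Independence over disjoint sets of coordinates. -/
lemma indep_two {n : ℕ} (S : Set (Fin n)) (f g : (Fin n → Bool) → ℝ)
    (hf : ∀ ε η : Fin n → Bool, (∀ i ∈ S, ε i = η i) → f ε = f η)
    (hg : ∀ ε η : Fin n → Bool, (∀ i ∉ S, ε i = η i) → g ε = g η) :
    2 ^ n * ∑ ε, f ε * g ε = (∑ ε, f ε) * ∑ ε, g ε := by
  set mix : (Fin n → Bool) → (Fin n → Bool) → (Fin n → Bool) :=
    fun ε η i => if i ∈ S then ε i else η i with hmix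
  have h1 : (∑ ε, f ε) * ∑ ε, g ε =
      ∑ p : (Fin n → Bool) × (Fin n → Bool), f p.1 * g p.2 := by
    rw [Finset.sum_mul_sum, Fintype.sum_prod_type]
  have h2 : ∑ p : (Fin n → Bool) × (Fin n → Bool), f p.1 * g p.2 =
      ∑ p : (Fin n → Bool) × (Fin n → Bool), f p.1 * g p.1 := by
    have hinv : Function.Involutive
        (fun p : (Fin n → Bool) × (Fin n → Bool) => (mix p.1 p.2, mix p.2 p.1)) := by
      rintro ⟨ε, η⟩
      simp only [hmix, Prod.mk.injEq]
      constructor <;> funext i <;> by_cases hi : i ∈ S <;> simp [hi]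
    refine Fintype.sum_equiv hinv.toPerm _ _ ?_
    rintro ⟨ε, η⟩
    show f ε * g η = f (mix ε η) * g (mix ε η)
    rw [hf ε (mix ε η) (fun i hi => by simp [hmix, hi]),
      hg η (mix ε η) (fun i hi => by simp [hmix, hi])]
  rw [h1, h2, Fintype.sum_prod_type]
  simp only [Finset.sum_const, Finset.card_univ, nsmul_eq_mul]
  rw [← Finset.mul_sum]
  simp

lemma sum_flip_zero {n : ℕ} (a : Fin n) (F : (Fin n → Bool) → ℝ)
    (hF : ∀ ε η : Fin n → Bool, (∀ i, i ≠ a → ε i = η i) → F ε = F η) :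
    ∑ ε : Fin n → Bool, sg (ε a) * F ε = 0 := by
  have hinv : Function.Involutive
      (fun ε : Fin n → Bool => Function.update ε a (!(ε a))) := by
    intro ε; simp
  have h : ∑ ε : Fin n → Bool, sg (ε a) * F ε = ∑ ε : Fin n → Bool, - (sg (ε a) * F ε) := by
    refine Fintype.sum_equiv hinv.toPerm _ _ ?_
    intro ε
    show sg (ε a) * F ε = -(sg ((Function.update ε a (!(ε a))) a)
      * F (Function.update ε a (!(ε a))))
    rw [hF (Function.update ε a (!(ε a))) ε (fun i hi => by simp [hi])]
    simp [sg_not]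
  rw [Finset.sum_neg_distrib] at h
  linarith

lemma moments {n : ℕ} (w : Fin n → ℝ) (S : Finset (Fin n)) :
    (∑ ε : Fin n → Bool, (∑ i ∈ S, sg (ε i) * w i) ^ 2 = 2 ^ n * ∑ i ∈ S, w i ^ 2) ∧
    (∑ ε : Fin n → Bool, (∑ i ∈ S, sg (ε i) * w i) ^ 4 ≤ 2 ^ n * (3 * (∑ i ∈ S, w i ^ 2) ^ 2)) := by
  induction S using Finset.induction_on with
  | empty => simp
  | insert a S ha ih =>
    obtain ⟨ih2, ih4⟩ := ih
    have hdep : ∀ ε η : Fin n → Bool, (∀ i, i ≠ a → ε i = η i) →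
        ∑ i ∈ S, sg (ε i) * w i = ∑ i ∈ S, sg (η i) * w i := by
      intro ε η h
      refine Finset.sum_congr rfl fun i hi => ?_
      rw [h i (fun h' => ha (h' ▸ hi))]
    have z1 := sum_flip_zero a (fun ε => ∑ i ∈ S, sg (ε i) * w i) hdep
    have z3 := sum_flip_zero a (fun ε => (∑ i ∈ S, sg (ε i) * w i) ^ 3)
      (fun ε η h => by simp only [hdep ε η h])
    have c1 : ∑ _ε : Fin n → Bool, (1:ℝ) = 2 ^ n := by simp
    constructor
    · have : ∀ ε : Fin n → Bool, (∑ i ∈ insert a S, sg (ε i) * w i) ^ 2 =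
          (∑ i ∈ S, sg (ε i) * w i) ^ 2 + (2 * w a) * (sg (ε a) * ∑ i ∈ S, sg (ε i) * w i)
            + w a ^ 2 * 1 := by
        intro ε
        rw [Finset.sum_insert ha]
        have := sg_sq (ε a)
        linear_combination w a ^ 2 * this
      simp_rw [this]
      rw [Finset.sum_add_distrib, Finset.sum_add_distrib, ← Finset.mul_sum, ← Finset.mul_sum,
        z1, c1, ih2, Finset.sum_insert ha]
      ring
    · have : ∀ ε : Fin n → Bool, (∑ i ∈ insert a S, sg (ε i) * w i) ^ 4 =
          (∑ i ∈ S, sg (ε i) * w i) ^ 4 + (4 * w a) * (sg (ε a) * (∑ i ∈ S, sg (ε i) * w i) ^ 3)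
            + (6 * w a ^ 2) * (∑ i ∈ S, sg (ε i) * w i) ^ 2
            + (4 * w a ^ 3) * (sg (ε a) * (∑ i ∈ S, sg (ε i) * w i))
            + w a ^ 4 * 1 := by
        intro ε
        rw [Finset.sum_insert ha]
        set X := ∑ i ∈ S, sg (ε i) * w i
        have := sg_sq (ε a)
        linear_combination (6 * w a ^ 2 * X ^ 2 + 4 * w a ^ 3 * X * sg (ε a)
          + w a ^ 4 * (sg (ε a) ^ 2 + 1)) * this
      simp_rw [this]
      rw [Finset.sum_add_distrib, Finset.sum_add_distrib, Finset.sum_add_distrib,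
        Finset.sum_add_distrib, ← Finset.mul_sum, ← Finset.mul_sum, ← Finset.mul_sum,
        ← Finset.mul_sum,
        z1, z3, c1, ih2, Finset.sum_insert ha]
      have h4 : 0 ≤ (2:ℝ) ^ n * w a ^ 4 := by positivity
      nlinarith

/-- Anticoncentration from moments, abstractly. -/
lemma prob_of_poly {n : ℕ} (w : Fin n → ℝ) (Q : ℝ → Prop) (c1 c2 c3 M : ℝ)
    (hc2 : 0 ≤ c2) (hM : 0 < M)
    (hQ : ∀ x, Q x → c1 * x ^ 2 - c2 * x ^ 4 - c3 ≤ M)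
    (hQ' : ∀ x, ¬ Q x → c1 * x ^ 2 - c2 * x ^ 4 - c3 ≤ 0)
    (hE : M / 5 ≤ c1 * (∑ i, w i ^ 2) - c2 * (3 * (∑ i, w i ^ 2) ^ 2) - c3) :
    (1 / 5 : ℝ) * 2 ^ n ≤
      ((univ.filter fun ε : Fin n → Bool => Q (∑ i, sg (ε i) * w i)).card : ℝ) := by
  obtain ⟨h2, h4⟩ := moments w univ
  have c1' : ∑ _ε : Fin n → Bool, (1:ℝ) = 2 ^ n := by simp
  have h5 : ∑ ε : Fin n → Bool, (c1 * (∑ i, sg (ε i) * w i) ^ 2 -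
      c2 * (∑ i, sg (ε i) * w i) ^ 4 - c3 * 1) ≤
      ∑ ε : Fin n → Bool, M * (if Q (∑ i, sg (ε i) * w i) then (1:ℝ) else 0) := by
    refine Finset.sum_le_sum fun ε _ => ?_
    by_cases h : Q (∑ i, sg (ε i) * w i)
    · simp only [h, if_true]; have := hQ _ h; linarith
    · simp only [h, if_false]; have := hQ' _ h; linarith
  rw [Finset.sum_sub_distrib, Finset.sum_sub_distrib, ← Finset.mul_sum, ← Finset.mul_sum,
    ← Finset.mul_sum, ← Finset.mul_sum, c1', h2, Finset.sum_boole] at h5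
  have h6 : (0:ℝ) < 2 ^ n := by positivity
  have h7 := mul_le_mul_of_nonneg_left h4 hc2
  have h8 := mul_le_mul_of_nonneg_right hE h6.le
  have h9 : M * ((1 / 5 : ℝ) * 2 ^ n) ≤
      M * ((univ.filter fun ε : Fin n → Bool => Q (∑ i, sg (ε i) * w i)).card : ℝ) := by
    nlinarith
  exact le_of_mul_le_mul_left h9 hM

lemma prob_large {n : ℕ} (w : Fin n → ℝ) (h : 0 < ∑ i, w i ^ 2) :
    (1 / 5 : ℝ) * 2 ^ n ≤
      ((univ.filter fun ε : Fin n → Bool =>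
        (∑ i, w i ^ 2) / 4 < (∑ i, sg (ε i) * w i) ^ 2 ∧
        (∑ i, sg (ε i) * w i) ^ 2 < 6 * ∑ i, w i ^ 2).card : ℝ) := by
  set s := ∑ i, w i ^ 2 with hs
  have key := prob_of_poly w (fun x => s / 4 < x ^ 2 ∧ x ^ 2 < 6 * s) s (1 / 6) (s ^ 2 / 4)
    (5 / 4 * s ^ 2) (by norm_num) (by positivity) ?_ ?_ ?_
  · convert key
  · intro x _
    nlinarith [sq_nonneg (x ^ 2 - 3 * s)]
  · intro x hx
    rw [not_and_or, not_lt, not_lt] at hx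
    rcases hx with hx | hx
    · nlinarith [sq_nonneg (x ^ 2), mul_le_mul_of_nonneg_left hx h.le]
    · nlinarith [mul_nonneg (sub_nonneg.2 hx) (sq_nonneg x)]
  · rw [← hs]; nlinarith

lemma prob_small {n : ℕ} (w : Fin n → ℝ) (h : 1 / 4 ≤ ∑ i, w i ^ 2) (h' : ∑ i, w i ^ 2 ≤ 1) :
    (1 / 5 : ℝ) * 2 ^ n ≤
      ((univ.filter fun ε : Fin n → Bool =>
        0 < (∑ i, sg (ε i) * w i) ^ 2 ∧
        (∑ i, sg (ε i) * w i) ^ 2 < 4).card : ℝ) := by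
  set s := ∑ i, w i ^ 2 with hs
  have key := prob_of_poly w (fun x => 0 < x ^ 2 ∧ x ^ 2 < 4) 4 1 0 4 (by norm_num) (by positivity)
    ?_ ?_ ?_
  · convert key
  · intro x _
    nlinarith [sq_nonneg (x ^ 2 - 2)]
  · intro x hx
    rw [not_and_or, not_lt, not_lt] at hx
    rcases hx with hx | hx
    · nlinarith [sq_nonneg (x ^ 2)]
    · nlinarith [mul_nonneg (sub_nonneg.2 hx) (sq_nonneg x)]
  · rw [← hs]; nlinarith

lemma indep_prod {n : ℕ} (T : Finset ℕ) (w : ℕ → Fin n → ℝ)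
    (hd : ∀ b ∈ T, ∀ b' ∈ T, b ≠ b' → ∀ i, w b i = 0 ∨ w b' i = 0) (F : ℕ → ℝ → ℝ) (q : ℝ)
    (hF0 : ∀ b ∈ T, ∀ x, 0 ≤ F b x)
    (hF : ∀ b ∈ T, ∑ ε : Fin n → Bool, F b (∑ i, sg (ε i) * w b i) ≤ q * 2 ^ n) (hq : 0 ≤ q) :
    ∑ ε : Fin n → Bool, ∏ b ∈ T, F b (∑ i, sg (ε i) * w b i) ≤ q ^ T.card * 2 ^ n := by
  induction T using Finset.induction_on with
  | empty => simp
  | insert a T ha ih =>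
    have ih' := ih (fun b hb b' hb' => hd b (mem_insert_of_mem hb) b' (mem_insert_of_mem hb'))
      (fun b hb => hF0 b (mem_insert_of_mem hb)) (fun b hb => hF b (mem_insert_of_mem hb))
    simp_rw [Finset.prod_insert ha]
    rw [Finset.card_insert_of_notMem ha]
    have key := indep_two {i | w a i ≠ 0} (fun ε => F a (∑ i, sg (ε i) * w a i))
      (fun ε => ∏ b ∈ T, F b (∑ i, sg (ε i) * w b i)) (by
        intro ε η h
        congr 1
        refine Finset.sum_congr rfl fun i _ => ?_
        by_cases hi : w a i = 0
        · simp [hi]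
        · rw [h i hi]) (by
        intro ε η h
        refine Finset.prod_congr rfl fun b hb => ?_
        congr 1
        refine Finset.sum_congr rfl fun i _ => ?_
        rcases hd a (mem_insert_self _ _) b (mem_insert_of_mem hb)
          (fun h' => ha (h' ▸ hb)) i with h1 | h1
        · rw [h i (by simpa using h1)]
        · simp [h1])
    have hpos : (0:ℝ) < 2 ^ n := by positivity
    have hA := hF a (mem_insert_self _ _)
    have hB0 : 0 ≤ ∑ ε : Fin n → Bool, ∏ b ∈ T, F b (∑ i, sg (ε i) * w b i) :=
      Finset.sum_nonneg fun ε _ => Finset.prod_nonneg fun b hb => hF0 b (mem_insert_of_mem hb) _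
    have := mul_le_mul hA ih' hB0 (by positivity)
    refine le_of_mul_le_mul_left ?_ hpos
    refine (le_of_eq key).trans (this.trans (le_of_eq ?_))
    ring

lemma chernoff {n : ℕ} (T : Finset ℕ) (w : ℕ → Fin n → ℝ)
    (hd : ∀ b ∈ T, ∀ b' ∈ T, b ≠ b' → ∀ i, w b i = 0 ∨ w b' i = 0) (Q : ℕ → ℝ → Prop)
    (hQ : ∀ b ∈ T, (1 / 5 : ℝ) * 2 ^ n ≤
      ((univ.filter fun ε : Fin n → Bool => Q b (∑ i, sg (ε i) * w b i)).card : ℝ))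
    (k : ℕ) (hk : 10 * k ≤ T.card) :
    ((univ.filter fun ε : Fin n → Bool =>
      (T.filter fun b => Q b (∑ i, sg (ε i) * w b i)).card < k).card : ℝ) ≤
      (7 / 10) ^ k * 2 ^ n := by
  have h1 := indep_prod T w hd (fun b x => if Q b x then (1 / 2 : ℝ) else 1) (9 / 10)
    (fun b _ x => by split_ifs <;> norm_num) (fun b hb => by
      have h := hQ b hb
      have : ∀ ε : Fin n → Bool, (if Q b (∑ i, sg (ε i) * w b i) then (1 / 2 : ℝ) else 1) =
          1 - (1 / 2) * (if Q b (∑ i, sg (ε i) * w b i) then (1 : ℝ) else 0) := by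
        intro ε; split_ifs <;> norm_num
      simp_rw [this]
      rw [Finset.sum_sub_distrib, ← Finset.mul_sum, Finset.sum_boole]
      have c1' : ∑ _ε : Fin n → Bool, (1:ℝ) = 2 ^ n := by simp
      rw [c1']
      linarith) (by norm_num)
  have h2 : ∑ ε : Fin n → Bool, (1 / 2 : ℝ) ^ k *
      (if (T.filter fun b => Q b (∑ i, sg (ε i) * w b i)).card < k then (1 : ℝ) else 0) ≤
      ∑ ε : Fin n → Bool, ∏ b ∈ T,
        (if Q b (∑ i, sg (ε i) * w b i) then (1 / 2 : ℝ) else 1) := by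
    refine Finset.sum_le_sum fun ε _ => ?_
    rw [Finset.prod_ite, Finset.prod_const, Finset.prod_const_one, mul_one]
    split_ifs with h
    · rw [mul_one]
      exact pow_le_pow_of_le_one (by norm_num) (by norm_num) h.le
    · rw [mul_zero]; positivity
  rw [← Finset.mul_sum, Finset.sum_boole] at h2
  have h3 := h2.trans h1
  have h4 : (9 / 10 : ℝ) ^ T.card ≤ (9 / 10) ^ (10 * k) :=
    pow_le_pow_of_le_one (by norm_num) (by norm_num) hk
  have h5 : (9 / 10 : ℝ) ^ (10 * k) ≤ (1 / 2) ^ k * (7 / 10) ^ k := by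
    rw [pow_mul, ← mul_pow]
    exact pow_le_pow_left₀ (by norm_num) (by norm_num) k
  have h6 : (0:ℝ) < (1 / 2) ^ k := by positivity
  have h7 : (0:ℝ) < 2 ^ n := by positivity
  refine le_of_mul_le_mul_left ?_ h6
  calc _ ≤ _ := h3
    _ ≤ ((1 / 2) ^ k * (7 / 10) ^ k) * 2 ^ n := by
      exact mul_le_mul_of_nonneg_right (h4.trans h5) h7.le
    _ = _ := by ring

/-- all sequences -/
def Om (n : ℕ) : Finset (Fin n → ℕ) := Fintype.piFinset fun _ : Fin n => Finset.Icc 1 n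

lemma card_Om (n : ℕ) : (Om n).card = n ^ n := by
  simp [Om, Fintype.card_piFinset]

lemma mem_Om {n : ℕ} {A : Fin n → ℕ} : A ∈ Om n ↔ ∀ i, A i ∈ Icc 1 n := by
  simp [Om, Fintype.mem_piFinset]

lemma core (n k : ℕ) (ρ : ℕ → ℕ) (hρ : ∀ v ∈ Icc 1 n, ρ v ∈ Icc 1 n)
    (hρρ : ∀ v ∈ Icc 1 n, ρ (ρ v) = v) (B : Finset ℕ) (W : ℕ → ℕ → ℝ)
    (hW : ∀ b ∈ B, ∀ v ∈ Icc 1 n, W b (ρ v) = - W b v)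
    (hd : ∀ b ∈ B, ∀ b' ∈ B, b ≠ b' → ∀ v, W b v = 0 ∨ W b' v = 0)
    (C : ℝ → Prop) (Q : ℝ → ℝ → Prop)
    (hQ : ∀ w : Fin n → ℝ, C (∑ i, w i ^ 2) → (1 / 5 : ℝ) * 2 ^ n ≤
      ((univ.filter fun ε : Fin n → Bool =>
        Q (∑ i, w i ^ 2) (∑ i, sg (ε i) * w i)).card : ℝ)) :
    (((Om n).filter fun A => 10 * k ≤ (B.filter fun b => C (∑ i, W b (A i) ^ 2)).card ∧
      (B.filter fun b => C (∑ i, W b (A i) ^ 2) ∧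
        Q (∑ i, W b (A i) ^ 2) (∑ i, W b (A i))).card < k).card : ℝ) ≤
      (7 / 10) ^ k * (n : ℝ) ^ n := by
  set P : (Fin n → ℕ) → Prop := fun A =>
    10 * k ≤ (B.filter fun b => C (∑ i, W b (A i) ^ 2)).card ∧
      (B.filter fun b => C (∑ i, W b (A i) ^ 2) ∧
        Q (∑ i, W b (A i) ^ 2) (∑ i, W b (A i))).card < k with hP
  set τ : (Fin n → Bool) → (Fin n → ℕ) → (Fin n → ℕ) :=
    fun ε A i => if ε i then A i else ρ (A i) with hτ
  have hτm : ∀ ε, ∀ A ∈ Om n, τ ε A ∈ Om n := by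
    intro ε A hA
    rw [mem_Om] at *
    intro i
    simp only [hτ]
    split_ifs
    · exact hA i
    · exact hρ _ (hA i)
  have hττ : ∀ ε, ∀ A ∈ Om n, τ ε (τ ε A) = A := by
    intro ε A hA
    rw [mem_Om] at hA
    funext i
    by_cases h : ε i <;> simp [hτ, h, hρρ _ (hA i)]
  have hcard : ∀ ε, ((Om n).filter P).card = ((Om n).filter fun A => P (τ ε A)).card := by
    intro ε
    refine Finset.card_nbij' (τ ε) (τ ε) ?_ ?_ ?_ ?_
    · intro A hA
      simp only [coe_filter, Set.mem_ofPred_eq] at hA ⊢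
      exact ⟨hτm ε A hA.1, by rw [hττ ε A hA.1]; exact hA.2⟩
    · intro A hA
      simp only [coe_filter, Set.mem_ofPred_eq] at hA ⊢
      exact ⟨hτm ε A hA.1, hA.2⟩
    · intro A hA
      simp only [coe_filter, Set.mem_ofPred_eq] at hA
      exact hττ ε A hA.1
    · intro A hA
      simp only [coe_filter, Set.mem_ofPred_eq] at hA
      exact hττ ε A hA.1
  have hpt : ∀ A ∈ Om n, ((univ.filter fun ε : Fin n → Bool => P (τ ε A)).card : ℝ) ≤
      (7 / 10) ^ k * 2 ^ n := by
    intro A hA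
    rw [mem_Om] at hA
    have hW1 : ∀ b ∈ B, ∀ ε : Fin n → Bool, ∀ i, W b (τ ε A i) = sg (ε i) * W b (A i) := by
      intro b hb ε i
      by_cases h : ε i
      · simp [hτ, h, sg]
      · simp [hτ, h, sg, hW b hb _ (hA i)]
    have hs : ∀ b ∈ B, ∀ ε : Fin n → Bool,
        ∑ i, W b (τ ε A i) ^ 2 = ∑ i, W b (A i) ^ 2 := by
      intro b hb ε
      refine Finset.sum_congr rfl fun i _ => ?_
      rw [hW1 b hb, mul_pow, sg_sq, one_mul]
    set T := B.filter fun b => C (∑ i, W b (A i) ^ 2) with hT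
    have hTT : ∀ ε : Fin n → Bool, (B.filter fun b => C (∑ i, W b (τ ε A i) ^ 2)) = T := by
      intro ε
      refine Finset.filter_congr fun b hb => ?_
      rw [hs b hb]
    have hTQ : ∀ ε : Fin n → Bool, (B.filter fun b => C (∑ i, W b (τ ε A i) ^ 2) ∧
        Q (∑ i, W b (τ ε A i) ^ 2) (∑ i, W b (τ ε A i))) =
        T.filter fun b => Q (∑ i, W b (A i) ^ 2) (∑ i, sg (ε i) * W b (A i)) := by
      intro ε
      rw [hT, Finset.filter_filter]
      refine Finset.filter_congr fun b hb => ?_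
      rw [hs b hb, Finset.sum_congr rfl fun i _ => hW1 b hb ε i]
    by_cases hk : 10 * k ≤ T.card
    · have := chernoff T (fun b i => W b (A i)) (fun b hb b' hb' hne i =>
        hd b (mem_filter.1 hb).1 b' (mem_filter.1 hb').1 hne _)
        (fun b x => Q (∑ i, W b (A i) ^ 2) x) (fun b hb => hQ _ (mem_filter.1 hb).2) k hk
      refine le_trans ?_ this
      refine Nat.cast_le.2 (Finset.card_le_card ?_)
      intro ε hε
      simp only [mem_filter, mem_univ, true_and, hP] at hε ⊢
      rw [hTQ] at hε
      exact hε.2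
    · have : (univ.filter fun ε : Fin n → Bool => P (τ ε A)) = ∅ := by
        refine Finset.filter_eq_empty_iff.2 fun ε _ hε => hk ?_
        have := hε.1
        rwa [hTT] at this
      rw [this]; simp
      positivity
  have hsum : (2:ℝ) ^ n * (((Om n).filter P).card : ℝ) =
      ∑ A ∈ Om n, ((univ.filter fun ε : Fin n → Bool => P (τ ε A)).card : ℝ) := by
    have h1 : (2:ℝ) ^ n * (((Om n).filter P).card : ℝ) =
        ∑ ε : Fin n → Bool, (((Om n).filter fun A => P (τ ε A)).card : ℝ) := by
      rw [← Finset.sum_congr rfl fun ε _ => congrArg (Nat.cast : ℕ → ℝ) (hcard ε)]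
      simp
    rw [h1]
    simp_rw [← Finset.sum_boole]
    rw [Finset.sum_comm]
  have h7 : (0:ℝ) < 2 ^ n := by positivity
  refine le_of_mul_le_mul_left ?_ h7
  calc (2:ℝ) ^ n * (((Om n).filter P).card : ℝ) = _ := hsum
    _ ≤ ∑ A ∈ Om n, (7 / 10 : ℝ) ^ k * 2 ^ n := Finset.sum_le_sum hpt
    _ = _ := by
      rw [Finset.sum_const, card_Om, nsmul_eq_mul]; push_cast; ring

/-- number of sequences of length `k` with given sum -/
def cntS (n : ℕ) : ℕ → ℤ → ℕ
  | 0, s => if s = 0 then 1 else 0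
  | k + 1, s => ∑ v ∈ Icc 1 n, cntS n k (s - (v : ℕ))

lemma card_sum_eq (n k : ℕ) : ∀ s : ℤ,
    ((Fintype.piFinset fun _ : Fin k => Icc 1 n).filter
      fun A => ((∑ i, A i : ℕ) : ℤ) = s).card = cntS n k s := by
  induction k with
  | zero =>
    intro s
    by_cases h : s = 0
    · subst h; simp [cntS]
    · simp [cntS, h, Ne.symm h]
  | succ k ih =>
    intro s
    rw [cntS]
    rw [Finset.card_eq_sum_card_fiberwise (f := fun A => A 0) (t := Icc 1 n)]
    · refine Finset.sum_congr rfl fun v hv => ?_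
      rw [← ih (s - v)]
      refine Finset.card_nbij' (fun A => Fin.tail A) (fun A => Fin.cons v A) ?_ ?_ ?_ ?_
      · intro A hA
        simp only [coe_filter, Set.mem_ofPred_eq, mem_filter, Fintype.mem_piFinset] at hA ⊢
        obtain ⟨⟨h1, h2⟩, h3⟩ := hA
        refine ⟨fun i => h1 i.succ, ?_⟩
        rw [Fin.sum_univ_succ, h3] at h2
        rw [← h2]; simp [Fin.tail]
      · intro A hA
        simp only [coe_filter, Set.mem_ofPred_eq, mem_filter, Fintype.mem_piFinset] at hA ⊢
        obtain ⟨h1, h2⟩ := hA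
        refine ⟨⟨fun i => ?_, ?_⟩, by simp⟩
        · refine Fin.cases ?_ ?_ i
          · simpa using hv
          · intro i; simpa using h1 i
        · rw [Fin.sum_univ_succ]; simp; push_cast at h2; linarith
      · intro A hA
        simp only [coe_filter, Set.mem_ofPred_eq, mem_filter, Fintype.mem_piFinset] at hA
        obtain ⟨_, h3⟩ := hA
        rw [← h3]; exact Fin.cons_self_tail A
      · intro A hA
        simp
    · intro A hA
      simp only [coe_filter, Set.mem_ofPred_eq, Fintype.mem_piFinset] at hA
      exact hA.1 0

lemma cntS_shift (n k : ℕ) (s : ℤ) :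
    cntS n (k + 1) (s + 1) + cntS n k (s - n) = cntS n (k + 1) s + cntS n k s := by
  have h1 : ∀ s : ℤ, cntS n (k + 1) s = ∑ v ∈ range n, cntS n k (s - (v : ℕ) - 1) := by
    intro s
    have h := Finset.sum_Ico_add' (fun v : ℕ => cntS n k (s - v)) 0 n 1
    rw [cntS, Finset.range_eq_Ico]
    refine Eq.trans ?_ (h.symm.trans ?_)
    · rfl
    · refine Finset.sum_congr rfl fun v _ => ?_
      congr 1; push_cast; ring
  have h2 : ∀ N : ℕ, ∑ v ∈ range N, cntS n k (s + 1 - (v : ℕ) - 1) + cntS n k (s - N) =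
      ∑ v ∈ range N, cntS n k (s - (v : ℕ) - 1) + cntS n k s := by
    intro N
    induction N with
    | zero => simp
    | succ N ih =>
      rw [Finset.sum_range_succ, Finset.sum_range_succ]
      have e1 : s + 1 - (N : ℤ) - 1 = s - N := by ring
      have e2 : s - ((N + 1 : ℕ) : ℤ) = s - N - 1 := by push_cast; ring
      rw [e1, e2]
      omega
  rw [h1, h1]
  exact h2 n

lemma cntS_symm (n k : ℕ) : ∀ s : ℤ, cntS n k (k * (n + 1) - s) = cntS n k s := by
  induction k with
  | zero => intro s; simp [cntS]
  | succ k ih =>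
    intro s
    rw [cntS, cntS]
    refine Finset.sum_nbij' (fun v => n + 1 - v) (fun v => n + 1 - v) ?_ ?_ ?_ ?_ ?_
    · intro v hv; simp only [mem_Icc] at *; omega
    · intro v hv; simp only [mem_Icc] at *; omega
    · intro v hv; simp only [mem_Icc] at *; omega
    · intro v hv; simp only [mem_Icc] at *; omega
    · intro v hv
      simp only [mem_Icc] at hv
      rw [← ih]
      congr 1
      have : ((n + 1 - v : ℕ) : ℤ) = n + 1 - v := by omega
      rw [this]; push_cast; ring

lemma cntS_unimodal (n k : ℕ) : ∀ s t : ℤ,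
    |2 * s - k * (n + 1)| ≤ |2 * t - k * (n + 1)| → cntS n k t ≤ cntS n k s := by
  induction k with
  | zero =>
    intro s t h
    simp only [cntS]
    by_cases ht : t = 0
    · subst ht
      simp at h
      have : s = 0 := by
        have := abs_nonneg s
        exact abs_eq_zero.1 (by omega)
      simp [this]
    · simp [ht]
  | succ k ih =>
    -- one step on the right
    have step : ∀ s : ℤ, ((k + 1 : ℕ) : ℤ) * (n + 1) ≤ 2 * s + 1 →
        cntS n (k + 1) (s + 1) ≤ cntS n (k + 1) s := by
      intro s hs
      have h1 := cntS_shift n k s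
      have h2 := ih (s - n) s (by
        push_cast at hs
        have hs' : (k : ℤ) * (n + 1) + n + 1 ≤ 2 * s + 1 := by linarith
        generalize (k : ℤ) * (n + 1) = c at *
        have : (0:ℤ) ≤ n := by positivity
        rw [abs_le]
        constructor
        · have := le_abs_self (2 * s - c); omega
        · have := le_abs_self (2 * s - c); omega)
      omega
    have right : ∀ (d : ℕ) (s : ℤ), ((k + 1 : ℕ) : ℤ) * (n + 1) ≤ 2 * s →
        cntS n (k + 1) (s + d) ≤ cntS n (k + 1) s := by
      intro d
      induction d with
      | zero => intro s _; simp
      | succ d ihd =>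
        intro s hs
        refine le_trans ?_ (ihd s hs)
        have := step (s + d) (by omega)
        rwa [show s + ((d + 1 : ℕ) : ℤ) = s + d + 1 by push_cast; ring]
    have right' : ∀ s t : ℤ, ((k + 1 : ℕ) : ℤ) * (n + 1) ≤ 2 * s → s ≤ t →
        cntS n (k + 1) t ≤ cntS n (k + 1) s := by
      intro s t hs hst
      have := right (t - s).toNat s hs
      rwa [Int.toNat_of_nonneg (by omega), add_sub_cancel] at this
    have key : ∀ s : ℤ, ∃ s' : ℤ, ((k + 1 : ℕ) : ℤ) * (n + 1) ≤ 2 * s' ∧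
        2 * s' - ((k + 1 : ℕ) : ℤ) * (n + 1) = |2 * s - ((k + 1 : ℕ) : ℤ) * (n + 1)| ∧
        cntS n (k + 1) s = cntS n (k + 1) s' := by
      intro s
      have hsym := cntS_symm n (k + 1) s
      generalize ((k + 1 : ℕ) : ℤ) * (n + 1) = c at *
      rcases le_total c (2 * s) with h | h
      · exact ⟨s, h, by rw [abs_of_nonneg (by omega)], rfl⟩
      · exact ⟨c - s, by omega, by rw [abs_of_nonpos (by omega)]; ring, hsym.symm⟩
    intro s t h
    obtain ⟨s', h1, h2, h3⟩ := key s
    obtain ⟨t', h4, h5, h6⟩ := key t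
    rw [h3, h6]
    exact right' s' t' h1 (by omega)

lemma card_dice (n : ℕ) (hn : 0 < n) : (n : ℝ) ^ n ≤ (n : ℝ) ^ 2 * (dieFinset n).card := by
  have h2 : 2 * (n * (n + 1) / 2) = n * (n + 1) := Nat.two_mul_div_two_of_even (Nat.even_mul_succ_self n)
  have h1 : (dieFinset n).card = cntS n n ((n * (n + 1) / 2 : ℕ) : ℤ) := by
    rw [← card_sum_eq]
    simp only [dieFinset]
    congr 1
    ext A
    simp only [mem_filter]
    norm_cast
  have hmax : ∀ s : ℤ, cntS n n s ≤ (dieFinset n).card := by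
    intro s
    rw [h1]
    refine cntS_unimodal n n _ _ ?_
    have : (2 * ((n * (n + 1) / 2 : ℕ) : ℤ) - n * (n + 1)) = 0 := by
      have : (2 * ((n * (n + 1) / 2 : ℕ) : ℤ)) = n * (n + 1) := by exact_mod_cast h2
      rw [this]; ring
    rw [this]; simp
  have h3 : (Om n).card = ∑ s ∈ Icc 1 (n ^ 2), ((Om n).filter fun A => ∑ i, A i = s).card := by
    refine Finset.card_eq_sum_card_fiberwise ?_
    intro A hA
    have hA' := mem_Om.1 hA
    simp only [coe_Icc, Set.mem_Icc]
    constructor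
    · have : A ⟨0, hn⟩ ≤ ∑ i, A i := Finset.single_le_sum (fun _ _ => Nat.zero_le _) (mem_univ _)
      exact (mem_Icc.1 (hA' _)).1.trans this
    · calc ∑ i, A i ≤ ∑ i : Fin n, n := Finset.sum_le_sum fun i _ => (mem_Icc.1 (hA' i)).2
        _ = n ^ 2 := by simp [sq]
  have h4 : (Om n).card ≤ n ^ 2 * (dieFinset n).card := by
    rw [h3]
    calc _ ≤ ∑ s ∈ Icc 1 (n ^ 2), (dieFinset n).card := by
          refine Finset.sum_le_sum fun s _ => ?_
          refine le_trans (le_of_eq ?_) (hmax s)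
          rw [← card_sum_eq]
          simp only [Om]
          congr 1
          ext A
          simp only [mem_filter]
          norm_cast
      _ = _ := by simp
  rw [card_Om] at h4
  exact_mod_cast h4

lemma hoeff (n : ℕ) (hn : 0 < n) (X : ℕ → ℝ) (h0 : ∑ v ∈ Icc 1 n, X v = 0)
    (h1 : ∀ v, |X v| ≤ 1) (h2 : ∑ v ∈ Icc 1 n, X v ^ 2 ≤ n / 4) (t : ℝ) (ht : 0 ≤ t)
    (htn : 2 * t ≤ n) :
    (((Om n).filter fun A => t < ∑ i, X (A i)).card : ℝ) ≤ Real.exp (-(t ^ 2 / n)) * (n : ℝ) ^ n := by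
  have hn' : (0:ℝ) < n := by exact_mod_cast hn
  set s : ℝ := 2 * t / n with hs
  have hs0 : 0 ≤ s := by positivity
  have hs1 : s ≤ 1 := by rw [hs, div_le_one hn']; exact htn
  have e1 : ∑ A ∈ Om n, ∏ i, Real.exp (s * X (A i)) = (∑ v ∈ Icc 1 n, Real.exp (s * X v)) ^ n := by
    rw [Om, Finset.sum_prod_piFinset (Icc 1 n) (fun (_ : Fin n) v => Real.exp (s * X v))]
    simp
  have e2 : ∑ v ∈ Icc 1 n, Real.exp (s * X v) ≤ n * Real.exp (s ^ 2 / 4) := by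
    have : ∀ v ∈ Icc 1 n, Real.exp (s * X v) ≤ 1 + s * X v + s ^ 2 * X v ^ 2 := by
      intro v _
      have hb : |s * X v| ≤ 1 := by
        rw [abs_mul, abs_of_nonneg hs0]
        exact mul_le_one₀ hs1 (abs_nonneg _) (h1 v)
      have := (abs_le.1 (Real.abs_exp_sub_one_sub_id_le hb)).2
      nlinarith
    refine (Finset.sum_le_sum this).trans ?_
    rw [Finset.sum_add_distrib, Finset.sum_add_distrib, ← Finset.mul_sum, ← Finset.mul_sum, h0]
    simp only [sum_const, Nat.card_Icc, nsmul_eq_mul, mul_zero, add_zero]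
    have h3 := Real.add_one_le_exp (s ^ 2 / 4)
    have h4 := mul_le_mul_of_nonneg_left h2 (sq_nonneg s)
    have h5 := mul_le_mul_of_nonneg_left h3 hn'.le
    simp only [add_tsub_cancel_right, mul_one]
    nlinarith
  have e3 : Real.exp (s * t) * (((Om n).filter fun A => t < ∑ i, X (A i)).card : ℝ) ≤
      ∑ A ∈ Om n, ∏ i, Real.exp (s * X (A i)) := by
    rw [← Finset.sum_boole, Finset.mul_sum]
    refine Finset.sum_le_sum fun A _ => ?_
    rw [← Real.exp_sum, ← Finset.mul_sum]
    split_ifs with h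
    · rw [mul_one]
      exact Real.exp_le_exp.2 (mul_le_mul_of_nonneg_left h.le hs0)
    · rw [mul_zero]; exact (Real.exp_pos _).le
  have e4 : ∑ v ∈ Icc 1 n, Real.exp (s * X v) ≥ 0 :=
    Finset.sum_nonneg fun _ _ => (Real.exp_pos _).le
  have e5 := pow_le_pow_left₀ e4 e2 n
  rw [mul_pow, ← Real.exp_nat_mul] at e5
  refine le_of_mul_le_mul_left ?_ (Real.exp_pos (s * t))
  refine e3.trans (e1.le.trans (e5.trans (le_of_eq ?_)))
  rw [← mul_assoc, ← Real.exp_add, mul_comm]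
  congr 2
  rw [hs]; field_simp; ring

/-- number of entries below `j` -/
noncomputable def cl {n : ℕ} (A : Fin n → ℕ) (j : ℕ) : ℝ :=
  ∑ i, if A i < j then (1:ℝ) else 0

/-- the regularity event -/
def reg (n : ℕ) (t : ℝ) (A : Fin n → ℕ) : Prop :=
  ∀ x ∈ range (n + 1), |cl A (x + 1) - x| ≤ t

lemma reg_prob (n : ℕ) (hn : 0 < n) (t : ℝ) (ht : 0 ≤ t) (htn : 2 * t ≤ n) :
    (((Om n).filter fun A => ¬ reg n t A).card : ℝ) ≤
      2 * (n + 1) * Real.exp (-(t ^ 2 / n)) * (n : ℝ) ^ n := by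
  have hn' : (0:ℝ) < n := by exact_mod_cast hn
  set X : ℕ → ℕ → ℝ := fun x v => (if v < x + 1 then (1:ℝ) else 0) - x / n with hX
  have hsumX : ∀ x, ∀ A : Fin n → ℕ, ∑ i, X x (A i) = cl A (x + 1) - x := by
    intro x A
    simp only [hX, cl, Finset.sum_sub_distrib]
    simp
    field_simp
  have hS : ∀ x ∈ range (n + 1), ∑ v ∈ Icc 1 n, (if v < x + 1 then (1:ℝ) else 0) = x := by
    intro x hx
    rw [mem_range] at hx
    rw [Finset.sum_boole]
    have : (Icc 1 n).filter (fun v => v < x + 1) = Icc 1 x := by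
      ext v; simp only [mem_filter, mem_Icc]; omega
    rw [this]; simp
  have hp : ∀ x ∈ range (n + 1), (0:ℝ) ≤ x / n ∧ (x:ℝ) / n ≤ 1 := by
    intro x hx
    rw [mem_range] at hx
    refine ⟨by positivity, ?_⟩
    rw [div_le_one hn']; exact_mod_cast (by omega : x ≤ n)
  have hX0 : ∀ x ∈ range (n + 1), ∑ v ∈ Icc 1 n, X x v = 0 := by
    intro x hx
    simp only [hX, Finset.sum_sub_distrib]
    rw [hS x hx]; simp
    field_simp; ring
  have hX1 : ∀ x ∈ range (n + 1), ∀ v, |X x v| ≤ 1 := by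
    intro x hx v
    obtain ⟨h1, h2⟩ := hp x hx
    simp only [hX]
    rw [abs_le]
    split_ifs <;> constructor <;> linarith
  have hX2 : ∀ x ∈ range (n + 1), ∑ v ∈ Icc 1 n, X x v ^ 2 ≤ n / 4 := by
    intro x hx
    have : ∀ v, X x v ^ 2 = (1 - 2 * (x / n)) * (if v < x + 1 then (1:ℝ) else 0) + (x / n) ^ 2 := by
      intro v; simp only [hX]; split_ifs <;> ring
    simp_rw [this]
    rw [Finset.sum_add_distrib, ← Finset.mul_sum, hS x hx]
    simp only [sum_const, Nat.card_Icc, nsmul_eq_mul, add_tsub_cancel_right]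
    have hx' : (x:ℝ) = (x / n) * n := by field_simp
    set p : ℝ := x / n
    rw [hx']
    nlinarith [mul_nonneg hn'.le (sq_nonneg (2 * p - 1))]
  have hsub : ((Om n).filter fun A => ¬ reg n t A) ⊆ (range (n + 1)).biUnion fun x =>
      ((Om n).filter fun A => t < ∑ i, X x (A i)) ∪
      ((Om n).filter fun A => t < ∑ i, (fun v => - X x v) (A i)) := by
    intro A hA
    rw [mem_filter] at hA
    obtain ⟨hA, hr⟩ := hA
    simp only [reg] at hr
    push Not at hr
    obtain ⟨x, hx, h⟩ := hr
    rw [mem_biUnion]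
    refine ⟨x, hx, ?_⟩
    rw [mem_union, mem_filter, mem_filter, Finset.sum_neg_distrib, hsumX]
    rcases lt_abs.1 h with h | h
    · exact Or.inl ⟨hA, h⟩
    · exact Or.inr ⟨hA, h⟩
  have h1 : (((Om n).filter fun A => ¬ reg n t A).card : ℝ) ≤
      ∑ x ∈ range (n + 1), (2 * (Real.exp (-(t ^ 2 / n)) * (n : ℝ) ^ n)) := by
    refine (Nat.cast_le.2 ((card_le_card hsub).trans card_biUnion_le)).trans ?_
    rw [Nat.cast_sum]
    refine Finset.sum_le_sum fun x hx => ?_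
    refine (Nat.cast_le.2 (card_union_le _ _)).trans ?_
    rw [Nat.cast_add, two_mul]
    refine add_le_add (hoeff n hn (X x) (hX0 x hx) (hX1 x hx) (hX2 x hx) t ht htn)
      (hoeff n hn (fun v => - X x v) ?_ ?_ ?_ t ht htn)
    · rw [Finset.sum_neg_distrib, hX0 x hx, neg_zero]
    · intro v; rw [abs_neg]; exact hX1 x hx v
    · simp only [neg_sq]; exact hX2 x hx
  refine h1.trans (le_of_eq ?_)
  rw [sum_const, card_range, nsmul_eq_mul]; push_cast; ring

/-- kernel of `fA` -/
noncomputable def hk (a j : ℕ) : ℝ := if a < j then 1 else if a = j then 1 / 2 else 0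

lemma fA_eq {n : ℕ} (A : Fin n → ℕ) (j : ℕ) : fA A j = ∑ i, hk (A i) j := by
  rw [fA, ← Finset.sum_boole, ← Finset.sum_boole, Finset.mul_sum, ← Finset.sum_add_distrib]
  refine Finset.sum_congr rfl fun i _ => ?_
  simp only [hk]
  rcases lt_trichotomy (A i) j with h | h | h
  · simp [h, h.ne]
  · simp [h]
  · simp [h.not_gt, h.ne']

lemma fA_cl {n : ℕ} (A : Fin n → ℕ) (j : ℕ) : fA A j = (cl A j + cl A (j + 1)) / 2 := by
  rw [fA_eq, cl, cl, ← Finset.sum_add_distrib, Finset.sum_div]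
  refine Finset.sum_congr rfl fun i _ => ?_
  simp only [hk]
  rcases lt_trichotomy (A i) j with h | h | h
  · simp [h, h.trans (Nat.lt_succ_self j)]
  · simp [h]
  · have : ¬ A i < j + 1 := by omega
    simp [h.not_gt, h.ne', this]

lemma gA_le {n : ℕ} {t : ℝ} {A : Fin n → ℕ} (h : reg n t A) (j : ℕ) (hj : j ∈ Icc 1 n) :
    |gA A j| ≤ t := by
  rw [mem_Icc] at hj
  obtain ⟨x, rfl⟩ : ∃ x, j = x + 1 := ⟨j - 1, by omega⟩
  have h1 := h x (by rw [mem_range]; omega)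
  have h2 := h (x + 1) (by rw [mem_range]; omega)
  rw [gA, fA_cl]
  push_cast at *
  rw [abs_le] at *
  constructor <;> linarith [h1.1, h1.2, h2.1, h2.2]

/-- weights of the second difference -/
noncomputable def W2 (m j a : ℕ) : ℝ := hk a (j + 2 * m) - 2 * hk a (j + m) + hk a j

/-- variance proxy -/
noncomputable def sig {n : ℕ} (A : Fin n → ℕ) (m j : ℕ) : ℝ := ∑ i, W2 m j (A i) ^ 2

lemma G2_eq {n : ℕ} (A : Fin n → ℕ) (m j : ℕ) : G2 A m j = ∑ i, W2 m j (A i) := by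
  simp only [G2, fA_eq, W2, Finset.sum_add_distrib, Finset.sum_sub_distrib, Finset.mul_sum]

lemma hk_lt {a j : ℕ} (h : a < j) : hk a j = 1 := by simp [hk, h]
lemma hk_eq (a : ℕ) : hk a a = 1 / 2 := by simp [hk]
lemma hk_gt {a j : ℕ} (h : j < a) : hk a j = 0 := by simp [hk, h.not_gt, h.ne']

lemma W2_out {m j a : ℕ} (h : a < j ∨ j + 2 * m < a) : W2 m j a = 0 := by
  rcases h with h | h
  · rw [W2, hk_lt (by omega), hk_lt (by omega), hk_lt h]; norm_num
  · rw [W2, hk_gt h, hk_gt (by omega), hk_gt (by omega)]; norm_num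

lemma W2_left {m j a : ℕ} (h1 : j < a) (h2 : a < j + m) : W2 m j a = -1 := by
  rw [W2, hk_lt (by omega), hk_lt h2, hk_gt h1]; norm_num

lemma W2_right {m j a : ℕ} (h1 : j + m < a) (h2 : a < j + 2 * m) : W2 m j a = 1 := by
  rw [W2, hk_lt h2, hk_gt h1, hk_gt (by omega)]; norm_num

lemma W2_first {m j : ℕ} (hm : 1 ≤ m) : W2 m j j = -1 / 2 := by
  rw [W2, hk_lt (by omega), hk_lt (by omega), hk_eq]; norm_num

lemma W2_last {m j : ℕ} (hm : 1 ≤ m) : W2 m j (j + 2 * m) = 1 / 2 := by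
  rw [W2, hk_eq, hk_gt (by omega), hk_gt (by omega)]; norm_num

lemma W2_mid {m j : ℕ} (hm : 1 ≤ m) : W2 m j (j + m) = 0 := by
  rw [W2, hk_lt (by omega), hk_eq, hk_gt (by omega)]; norm_num

lemma W2_anti {m j a : ℕ} (hm : 1 ≤ m) (h1 : j ≤ a) (h2 : a ≤ j + 2 * m) :
    W2 m j (2 * j + 2 * m - a) = - W2 m j a := by
  rcases lt_trichotomy a (j + m) with h | h | h
  · rcases h1.eq_or_lt with h' | h'
    · subst h'
      rw [show 2 * j + 2 * m - j = j + 2 * m by omega, W2_first hm, W2_last hm]; norm_num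
    · rw [W2_left h' h, W2_right (by omega) (by omega)]; norm_num
  · subst h
    rw [show 2 * j + 2 * m - (j + m) = j + m by omega, W2_mid hm]; norm_num
  · rcases h2.eq_or_lt with h' | h'
    · subst h'
      rw [show 2 * j + 2 * m - (j + 2 * m) = j by omega, W2_first hm, W2_last hm]; norm_num
    · rw [W2_right h h', W2_left (by omega) (by omega)]

/-- start of the `b`-th block -/
def blk (r m b : ℕ) : ℕ := r + 1 + (2 * m + 1) * b

/-- block reflection -/
def rfn (r m K v : ℕ) : ℕ :=
  if r + 1 ≤ v ∧ v < r + 1 + (2 * m + 1) * K then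
    2 * blk r m ((v - r - 1) / (2 * m + 1)) + 2 * m - v else v

lemma blk_sep {r m b b' : ℕ} (h : b < b') : blk r m b + 2 * m < blk r m b' := by
  simp only [blk]
  have : (2 * m + 1) * (b + 1) ≤ (2 * m + 1) * b' := Nat.mul_le_mul_left _ h
  have e : (2 * m + 1) * (b + 1) = (2 * m + 1) * b + (2 * m + 1) := by ring
  omega

lemma blk_unique {r m b b' v : ℕ} (h1 : blk r m b ≤ v) (h2 : v ≤ blk r m b + 2 * m)
    (h3 : blk r m b' ≤ v) (h4 : v ≤ blk r m b' + 2 * m) : b = b' := by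
  rcases lt_trichotomy b b' with h | h | h
  · have := blk_sep (r := r) (m := m) h; omega
  · exact h
  · have := blk_sep (r := r) (m := m) h; omega

lemma rfn_in {r m K b v : ℕ} (hb : b < K) (h1 : blk r m b ≤ v) (h2 : v ≤ blk r m b + 2 * m) :
    rfn r m K v = 2 * blk r m b + 2 * m - v := by
  have hd : (v - r - 1) / (2 * m + 1) = b := by
    have e : (2 * m + 1) * (b + 1) = (2 * m + 1) * b + (2 * m + 1) := by ring
    simp only [blk] at h1 h2
    rw [Nat.div_eq_iff (by omega)]
    have e2 : b * (2 * m + 1) = (2 * m + 1) * b := by ring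
    constructor <;> omega
  have hs : v < r + 1 + (2 * m + 1) * K := by
    have := blk_sep (r := r) (m := m) hb
    simp only [blk] at *
    omega
  have : r + 1 ≤ v := by simp only [blk] at h1; omega
  rw [rfn, if_pos ⟨this, hs⟩, hd]

lemma rfn_cases (r m K v : ℕ) :
    (∃ b < K, blk r m b ≤ v ∧ v ≤ blk r m b + 2 * m ∧ rfn r m K v = 2 * blk r m b + 2 * m - v) ∨
    ((∀ b < K, v < blk r m b ∨ blk r m b + 2 * m < v) ∧ rfn r m K v = v) := by
  by_cases h : ∃ b < K, blk r m b ≤ v ∧ v ≤ blk r m b + 2 * m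
  · obtain ⟨b, hb, h1, h2⟩ := h
    exact Or.inl ⟨b, hb, h1, h2, rfn_in hb h1 h2⟩
  · right
    push Not at h
    refine ⟨fun b hb => ?_, ?_⟩
    · by_contra hc
      push Not at hc
      have := h b hb hc.1
      omega
    · rw [rfn, if_neg]
      rintro ⟨h1, h2⟩
      set b := (v - r - 1) / (2 * m + 1) with hbd
      have hdm := Nat.div_add_mod (v - r - 1) (2 * m + 1)
      have hml := Nat.mod_lt (v - r - 1) (show 0 < 2 * m + 1 by omega)
      rw [← hbd] at hdm
      have hbK : b < K := by
        rw [hbd, Nat.div_lt_iff_lt_mul (by omega)]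
        have e2 : K * (2 * m + 1) = (2 * m + 1) * K := by ring
        omega
      have := h b hbK
      simp only [blk] at this
      omega

lemma block_core (n k r m K : ℕ) (hm : 1 ≤ m) (hK : r + (2 * m + 1) * K ≤ n)
    (C : ℝ → Prop) (Q : ℝ → ℝ → Prop)
    (hQ : ∀ w : Fin n → ℝ, C (∑ i, w i ^ 2) → (1 / 5 : ℝ) * 2 ^ n ≤
      ((univ.filter fun ε : Fin n → Bool =>
        Q (∑ i, w i ^ 2) (∑ i, sg (ε i) * w i)).card : ℝ)) :
    (((Om n).filter fun A => 10 * k ≤ ((range K).filter fun b => C (sig A m (blk r m b))).card ∧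
      ((range K).filter fun b => C (sig A m (blk r m b)) ∧
        Q (sig A m (blk r m b)) (G2 A m (blk r m b))).card < k).card : ℝ) ≤
      (7 / 10) ^ k * (n : ℝ) ^ n := by
  have hbn : ∀ b < K, 1 ≤ blk r m b ∧ blk r m b + 2 * m ≤ n := by
    intro b hb
    have := blk_sep (r := r) (m := m) hb
    simp only [blk] at *
    constructor <;> omega
  have key := core n k (rfn r m K) ?_ ?_ (range K) (fun b => W2 m (blk r m b)) ?_ ?_ C Q hQ
  · simp only [G2_eq, sig]
    exact key
  · intro v hv
    rw [mem_Icc] at *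
    rcases rfn_cases r m K v with ⟨b, hb, h1, h2, h3⟩ | ⟨_, h3⟩
    · have := hbn b hb
      rw [h3]; omega
    · rw [h3]; exact hv
  · intro v hv
    rcases rfn_cases r m K v with ⟨b, hb, h1, h2, h3⟩ | ⟨_, h3⟩
    · rw [h3, rfn_in hb] <;> omega
    · rw [h3, h3]
  · intro b hb v hv
    rw [mem_range] at hb
    rcases rfn_cases r m K v with ⟨b', hb', h1, h2, h3⟩ | ⟨h4, h3⟩
    · by_cases hbb : b' = b
      · subst hbb
        show W2 m _ _ = - W2 m _ _
        rw [h3, W2_anti hm h1 h2]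
      · show W2 m _ _ = - W2 m _ _
        have o1 : v < blk r m b ∨ blk r m b + 2 * m < v := by
          by_contra hc
          push Not at hc
          exact hbb (blk_unique h1 h2 hc.1 hc.2)
        have o2 : rfn r m K v < blk r m b ∨ blk r m b + 2 * m < rfn r m K v := by
          by_contra hc
          push Not at hc
          rw [h3] at hc
          exact hbb (blk_unique (v := 2 * blk r m b' + 2 * m - v) (by omega) (by omega) hc.1 hc.2)
        rw [W2_out o1, W2_out o2]; simp
    · show W2 m _ _ = - W2 m _ _
      rw [h3, W2_out (h4 b hb)]; simp
  · intro b hb b' hb' hne v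
    by_contra hc
    push Not at hc
    have i1 : blk r m b ≤ v ∧ v ≤ blk r m b + 2 * m := by
      by_contra h
      exact hc.1 (W2_out (by omega))
    have i2 : blk r m b' ≤ v ∧ v ≤ blk r m b' + 2 * m := by
      by_contra h
      exact hc.2 (W2_out (by omega))
    exact hne (blk_unique i1.1 i1.2 i2.1 i2.2)

lemma W2_one (j a : ℕ) : W2 1 j a ^ 2 = if a = j ∨ a = j + 2 then (1 / 4 : ℝ) else 0 := by
  by_cases h : a = j ∨ a = j + 2
  · rw [if_pos h]
    rcases h with h | h
    · subst h; rw [W2_first le_rfl]; norm_num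
    · subst h
      have := W2_last (m := 1) (j := j) le_rfl
      rw [mul_one] at this
      rw [this]; norm_num
  · rw [if_neg h]
    push Not at h
    by_cases h' : a = j + 1
    · subst h'; rw [W2_mid le_rfl]; norm_num
    · rw [W2_out (by omega)]; norm_num

/-- number of entries on the two extremes -/
def Nx {n : ℕ} (A : Fin n → ℕ) (j : ℕ) : Finset (Fin n) :=
  univ.filter fun i => A i = j ∨ A i = j + 2

lemma sig_one {n : ℕ} (A : Fin n → ℕ) (j : ℕ) : sig A 1 j = ((Nx A j).card : ℝ) / 4 := by
  rw [sig, Nx, ← Finset.sum_boole, Finset.sum_div]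
  refine Finset.sum_congr rfl fun i _ => ?_
  rw [W2_one]; split_ifs <;> norm_num

lemma blk_disj {b b' x : ℕ} (h : x = blk 0 1 b ∨ x = blk 0 1 b + 2)
    (h' : x = blk 0 1 b' ∨ x = blk 0 1 b' + 2) : b = b' := by
  simp only [blk] at *
  omega

lemma occ_prob (n K t : ℕ) (hK : 3 * K ≤ n) :
    ((Om n).filter fun A => ((range K).filter fun b => 0 < (Nx A (blk 0 1 b)).card).card ≤ t).card
      ≤ 2 ^ K * (n - 2 * K + 2 * t) ^ n := by
  set V : Finset ℕ → Finset ℕ := fun S =>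
    Icc 1 n \ (range K \ S).biUnion fun b => {blk 0 1 b, blk 0 1 b + 2} with hV
  have hVc : ∀ S ∈ (range K).powerset.filter (fun S => S.card ≤ t),
      (V S).card ≤ n - 2 * K + 2 * t := by
    intro S hS
    rw [mem_filter, mem_powerset] at hS
    obtain ⟨hS, hSt⟩ := hS
    have hU : ((range K \ S).biUnion fun b => ({blk 0 1 b, blk 0 1 b + 2} : Finset ℕ)).card =
        2 * (K - S.card) := by
      rw [card_biUnion]
      · have : ∀ b ∈ range K \ S, ({blk 0 1 b, blk 0 1 b + 2} : Finset ℕ).card = 2 := by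
          intro b _; rw [card_pair]; omega
        rw [sum_congr rfl this, sum_const, card_sdiff_of_subset hS]
        simp [mul_comm]
      · intro b _ b' _ hne
        show Disjoint _ _
        rw [disjoint_left]
        intro x hx hx'
        simp only [mem_insert, mem_singleton] at hx hx'
        exact hne (blk_disj hx hx')
    simp only [hV]
    rw [card_sdiff_of_subset, hU]
    · have : S.card ≤ K := by simpa using card_le_card hS
      simp; omega
    · intro x hx
      rw [mem_biUnion] at hx
      obtain ⟨b, hb, hx⟩ := hx
      have : b < K := by simpa using (mem_sdiff.1 hb).1
      simp only [mem_insert, mem_singleton, blk] at hx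
      rw [mem_Icc]; omega
  have hsub : ((Om n).filter fun A =>
      ((range K).filter fun b => 0 < (Nx A (blk 0 1 b)).card).card ≤ t) ⊆
      ((range K).powerset.filter (fun S => S.card ≤ t)).biUnion
        fun S => Fintype.piFinset fun _ : Fin n => V S := by
    intro A hA
    rw [mem_filter] at hA
    obtain ⟨hA, ho⟩ := hA
    rw [mem_biUnion]
    refine ⟨(range K).filter fun b => 0 < (Nx A (blk 0 1 b)).card, ?_, ?_⟩
    · rw [mem_filter, mem_powerset]; exact ⟨filter_subset _ _, ho⟩
    · rw [Fintype.mem_piFinset]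
      intro i
      simp only [hV, mem_sdiff, mem_biUnion, not_exists]
      refine ⟨mem_Om.1 hA i, ?_⟩
      rintro b ⟨⟨h1, h2⟩, h3⟩
      refine h2 (mem_filter.2 ⟨h1, card_pos.2 ⟨i, ?_⟩⟩)
      simpa [Nx] using h3
  refine (card_le_card hsub).trans (card_biUnion_le.trans ?_)
  calc _ ≤ ∑ S ∈ (range K).powerset.filter (fun S => S.card ≤ t), (n - 2 * K + 2 * t) ^ n := by
        refine sum_le_sum fun S hS => ?_
        rw [Fintype.card_piFinset]
        simp only [prod_const, card_univ, Fintype.card_fin]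
        exact Nat.pow_le_pow_left (hVc S hS) n
    _ ≤ _ := by
        rw [sum_const, smul_eq_mul]
        refine Nat.mul_le_mul_right _ ?_
        refine (card_filter_le _ _).trans ?_
        simp

/-- good event, scale one -/
noncomputable def good1 (n : ℕ) (A : Fin n → ℕ) : Finset ℕ :=
  (range (n / 3)).filter fun b =>
    (1 / 4 ≤ sig A 1 (blk 0 1 b) ∧ sig A 1 (blk 0 1 b) ≤ 1) ∧
    (0 < G2 A 1 (blk 0 1 b) ^ 2 ∧ G2 A 1 (blk 0 1 b) ^ 2 < 4)

lemma many_moderate (n : ℕ) (A : Fin n → ℕ)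
    (h : 21 * n / 100 < ((range (n / 3)).filter fun b => 0 < (Nx A (blk 0 1 b)).card).card) :
    10 * (n / 1000) ≤ ((range (n / 3)).filter fun b =>
      1 / 4 ≤ sig A 1 (blk 0 1 b) ∧ sig A 1 (blk 0 1 b) ≤ 1).card := by
  set O := (range (n / 3)).filter fun b => 0 < (Nx A (blk 0 1 b)).card with hO
  set Bg := (range (n / 3)).filter fun b => 5 ≤ (Nx A (blk 0 1 b)).card with hB
  set T := (range (n / 3)).filter fun b =>
      1 / 4 ≤ sig A 1 (blk 0 1 b) ∧ sig A 1 (blk 0 1 b) ≤ 1 with hT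
  have h1 : O ⊆ T ∪ Bg := by
    intro b hb
    rw [hO, mem_filter] at hb
    rw [mem_union, hT, hB, mem_filter, mem_filter]
    by_cases h5 : 5 ≤ (Nx A (blk 0 1 b)).card
    · exact Or.inr ⟨hb.1, h5⟩
    · refine Or.inl ⟨hb.1, ?_⟩
      rw [sig_one]
      have a1 : (1:ℝ) ≤ ((Nx A (blk 0 1 b)).card : ℝ) := by exact_mod_cast hb.2
      have a2 : ((Nx A (blk 0 1 b)).card : ℝ) ≤ 4 := by exact_mod_cast (by omega)
      constructor <;> linarith
  have h2 : 5 * Bg.card ≤ n := by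
    have : ∑ b ∈ Bg, 5 ≤ ∑ b ∈ Bg, (Nx A (blk 0 1 b)).card :=
      sum_le_sum fun b hb => (mem_filter.1 hb).2
    rw [← card_biUnion] at this
    · have h3 := this.trans (card_le_univ _)
      simp at h3
      omega
    · intro b _ b' _ hne
      show Disjoint _ _
      rw [disjoint_left]
      intro x hx hx'
      simp only [Nx, mem_filter, mem_univ, true_and] at hx hx'
      exact hne (blk_disj hx hx')
  have h3 := (card_le_card h1).trans (card_union_le _ _)
  omega

lemma scale1_prob (n : ℕ) (hn : 1000 ≤ n) :
    (((Om n).filter fun A => (good1 n A).card < n / 1000).card : ℝ) ≤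
      ((96 / 100) ^ n + (7 / 10) ^ (n / 1000)) * (n : ℝ) ^ n := by
  have hb := block_core n (n / 1000) 0 1 (n / 3) le_rfl (by omega)
    (fun s => 1 / 4 ≤ s ∧ s ≤ 1) (fun _ x => 0 < x ^ 2 ∧ x ^ 2 < 4)
    (fun w hw => by
      have := prob_small w hw.1 hw.2
      convert this)
  have ho := occ_prob n (n / 3) (21 * n / 100) (by omega)
  have ho' : (((Om n).filter fun A => ((range (n / 3)).filter
      fun b => 0 < (Nx A (blk 0 1 b)).card).card ≤ 21 * n / 100).card : ℝ) ≤
      (96 / 100) ^ n * (n : ℝ) ^ n := by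
    refine (Nat.cast_le.2 ho).trans ?_
    push_cast
    have e1 : (2:ℝ) ^ (n / 3) ≤ (126 / 100) ^ n := by
      calc (2:ℝ) ^ (n / 3) ≤ ((126 / 100) ^ 3) ^ (n / 3) :=
            pow_le_pow_left₀ (by norm_num) (by norm_num) _
        _ = (126 / 100) ^ (3 * (n / 3)) := by rw [pow_mul]
        _ ≤ _ := pow_le_pow_right₀ (by norm_num) (by omega)
    have e2 : (((n - 2 * (n / 3) : ℕ) : ℝ) + 2 * ((21 * n / 100 : ℕ) : ℝ)) ≤ 76 / 100 * n := by
      have : 100 * ((n - 2 * (n / 3)) + 2 * (21 * n / 100)) ≤ 76 * n := by omega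
      have : (100:ℝ) * (((n - 2 * (n / 3) : ℕ) : ℝ) + 2 * ((21 * n / 100 : ℕ) : ℝ)) ≤ 76 * n := by
        exact_mod_cast this
      linarith
    calc _ ≤ (126 / 100 : ℝ) ^ n * (76 / 100 * n) ^ n := by
          refine mul_le_mul e1 (pow_le_pow_left₀ (by positivity) e2 n) (by positivity)
            (by positivity)
      _ = (126 / 100 * (76 / 100)) ^ n * (n : ℝ) ^ n := by
          rw [mul_pow, mul_pow]; ring
      _ ≤ _ := by
          refine mul_le_mul_of_nonneg_right ?_ (by positivity)
          exact pow_le_pow_left₀ (by norm_num) (by norm_num) n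
  rw [add_mul]
  refine le_trans ?_ (add_le_add ho' hb)
  rw [← Nat.cast_add]
  refine Nat.cast_le.2 (le_trans (card_le_card ?_) (card_union_le _ _))
  intro A hA
  rw [mem_filter] at hA
  rw [mem_union, mem_filter, mem_filter]
  by_cases h : ((range (n / 3)).filter
      fun b => 0 < (Nx A (blk 0 1 b)).card).card ≤ 21 * n / 100
  · exact Or.inl ⟨hA.1, h⟩
  · refine Or.inr ⟨hA.1, ?_, ?_⟩
    · have := many_moderate n A (by omega)
      convert this
    · have := hA.2
      rw [good1] at this
      convert this

lemma scale1_det (n : ℕ) (hn : 100000 ≤ n) (A : Fin n → ℕ) (hA : n / 1000 ≤ (good1 n A).card)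
    (α β : ℝ) (hα : |α| ≤ 1 / 2) (hα2 : 10 ^ 5 * Real.log n / n ≤ α ^ 2) :
    10 * Real.log n ≤ n * (1 - ‖fhat n A α β‖) := by
  have hn' : (0:ℝ) < n := by exact_mod_cast (by omega : 0 < n)
  have hpt : ∀ b ∈ good1 n A, α ^ 2 / 4 ≤
      ‖((α * G2 A 1 (blk 0 1 b) : ℝ) : UnitAddCircle)‖ ^ 2 := by
    intro b hb
    rw [good1, mem_filter] at hb
    obtain ⟨_, _, h1, h2⟩ := hb
    set g := G2 A 1 (blk 0 1 b) with hg
    obtain ⟨z, hz⟩ : ∃ z : ℤ, 2 * g = z := by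
      rw [hg, G2]
      simp only [fA]
      set a1 := (univ.filter fun i => A i < blk 0 1 b + 2 * 1).card
      set a2 := (univ.filter fun i => A i = blk 0 1 b + 2 * 1).card
      set a3 := (univ.filter fun i => A i < blk 0 1 b + 1).card
      set a4 := (univ.filter fun i => A i = blk 0 1 b + 1).card
      set a5 := (univ.filter fun i => A i < blk 0 1 b).card
      set a6 := (univ.filter fun i => A i = blk 0 1 b).card
      refine ⟨2 * a1 + a2 - 4 * a3 - 2 * a4 + 2 * a5 + a6, ?_⟩
      push_cast; ring
    have hgz : g = z / 2 := by linarith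
    have hz2 : z ^ 2 < 16 := by
      have : (z:ℝ) ^ 2 < 16 := by rw [← hz]; nlinarith
      exact_mod_cast this
    have hz0 : z ≠ 0 := by
      rintro rfl
      rw [hgz] at h1; norm_num at h1
    have hzl : |z| ≤ 3 := by
      rw [abs_le]; constructor <;> nlinarith
    have hz1 : 1 ≤ |z| := Int.one_le_abs hz0
    have hzlr : |(z:ℝ)| ≤ 3 := by exact_mod_cast hzl
    have hz1r : 1 ≤ |(z:ℝ)| := by exact_mod_cast hz1
    have hx : |α * g| = |α| * |(z:ℝ)| / 2 := by
      rw [hgz, abs_mul, abs_div]; norm_num; ring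
    have ha := abs_nonneg α
    have hlow : |α| / 2 ≤ ‖((α * g : ℝ) : UnitAddCircle)‖ := by
      by_cases hc : |α * g| ≤ 1 / 2
      · rw [(AddCircle.norm_coe_eq_abs_iff (1:ℝ) one_ne_zero).2 (by simpa using hc), hx]
        nlinarith
      · push Not at hc
        have hub : |α * g| ≤ 3 / 4 := by rw [hx]; nlinarith
        have : (1:ℝ) / 4 ≤ ‖((α * g : ℝ) : UnitAddCircle)‖ := by
          rw [UnitAddCircle.norm_eq]
          set x := α * g
          set y := round x
          by_cases hy : y = 0
          · rw [hy]; simp; linarith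
          · have hy1 : (1:ℝ) ≤ |(y:ℝ)| := by exact_mod_cast Int.one_le_abs hy
            have := abs_sub_abs_le_abs_sub (y:ℝ) x
            rw [abs_sub_comm] at this
            linarith
        linarith
    have := pow_le_pow_left₀ (by positivity) hlow 2
    rw [div_pow, sq_abs] at this
    linarith
  have hs := second_diff n (by omega) A α β 1 ((good1 n A).image (blk 0 1)) (by
    intro j hj
    obtain ⟨b, hb, rfl⟩ := mem_image.1 hj
    rw [good1, mem_filter, mem_range] at hb
    simp only [blk]; omega)
  rw [sum_image (by intro b _ b' _ h; simp only [blk] at h; omega)] at hs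
  have h3 := Finset.sum_le_sum hpt
  rw [sum_const, nsmul_eq_mul] at h3
  have h4 : (n:ℝ) / 2000 ≤ (good1 n A).card := by
    have : n ≤ 2000 * (good1 n A).card := by omega
    have : (n:ℝ) ≤ 2000 * ((good1 n A).card : ℝ) := by exact_mod_cast this
    linarith
  have h4' : (n:ℝ) - 1000 ≤ 1000 * (good1 n A).card := by
    have : n ≤ 1000 * (good1 n A).card + 1000 := by omega
    have : (n:ℝ) ≤ 1000 * ((good1 n A).card : ℝ) + 1000 := by exact_mod_cast this
    linarith
  have hnr : (100000:ℝ) ≤ n := by exact_mod_cast hn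
  have h5 : 10 ^ 5 * Real.log n ≤ n * α ^ 2 := by
    rw [div_le_iff₀ hn'] at hα2; linarith
  have h6 : (99 / 100000 : ℝ) * n ≤ (good1 n A).card := by linarith
  have h7 : (99 / 100000 : ℝ) * n * (α ^ 2 / 4) ≤ (good1 n A).card * (α ^ 2 / 4) :=
    mul_le_mul_of_nonneg_right h6 (by positivity)
  have h8 := h7.trans h3
  have hlog : 0 ≤ Real.log n := Real.log_natCast_nonneg n
  nlinarith

lemma reg_sig {n : ℕ} {t : ℝ} {A : Fin n → ℕ} (h : reg n t A) (m j : ℕ) (hm : 1 ≤ m)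
    (ht : 2 + 4 * t ≤ m) (hj : 1 ≤ j) (hj2 : j + 2 * m ≤ n) :
    (m:ℝ) ≤ sig A m j ∧ sig A m j ≤ 3 * m := by
  obtain ⟨i, rfl⟩ : ∃ i, j = i + 1 := ⟨j - 1, by omega⟩
  have hb : ∀ x : ℕ, x ≤ n → |cl A (x + 1) - x| ≤ t := fun x hx =>
    h x (mem_range.2 (by omega))
  have b1 := abs_le.1 (hb (i + 2 * m) (by omega))
  have b2 := abs_le.1 (hb (i + 1) (by omega))
  have b3 := abs_le.1 (hb (i + 1 + m) (by omega))
  have b4 := abs_le.1 (hb (i + m) (by omega))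
  have b5 := abs_le.1 (hb (i + 2 * m + 1) (by omega))
  have b6 := abs_le.1 (hb i (by omega))
  push_cast at b1 b2 b3 b4 b5 b6
  have hlow : cl A (i + 2 * m + 1) - cl A (i + 1 + 1) - (cl A (i + 1 + m + 1) - cl A (i + m + 1))
      ≤ sig A m (i + 1) := by
    simp only [cl, sig, ← Finset.sum_sub_distrib]
    refine Finset.sum_le_sum fun x _ => ?_
    generalize A x = a
    by_cases h1 : a < i + 1 + 1
    · rw [if_pos (by omega), if_pos h1, if_pos (by omega), if_pos (by omega)]
      nlinarith [sq_nonneg (W2 m (i + 1) a)]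
    by_cases h2 : a < i + m + 1
    · rw [if_pos (by omega), if_neg h1, if_pos (by omega), if_pos (by omega),
        W2_left (by omega) (by omega)]; norm_num
    by_cases h3 : a < i + 1 + m + 1
    · rw [if_neg h1, if_pos h3, if_neg h2]
      have := sq_nonneg (W2 m (i + 1) a)
      split_ifs <;> linarith
    by_cases h4 : a < i + 2 * m + 1
    · rw [if_pos h4, if_neg h1, if_neg h3, if_neg h2, W2_right (by omega) (by omega)]
      norm_num
    · rw [if_neg h4, if_neg h1, if_neg h3, if_neg h2]
      nlinarith [sq_nonneg (W2 m (i + 1) a)]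
  have hup : sig A m (i + 1) ≤ cl A (i + 2 * m + 1 + 1) - cl A (i + 1) := by
    simp only [cl, sig, ← Finset.sum_sub_distrib]
    refine Finset.sum_le_sum fun x _ => ?_
    generalize A x = a
    by_cases h1 : a < i + 1
    · rw [W2_out (by omega), if_pos (by omega), if_pos h1]; norm_num
    by_cases h2 : a < i + 2 * m + 1 + 1
    · rw [if_pos h2, if_neg h1]
      have hw : W2 m (i + 1) a ^ 2 ≤ 1 := by
        rcases lt_trichotomy a (i + 1 + m) with h | h | h
        · rcases (by omega : i + 1 ≤ a).eq_or_lt with h' | h'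
          · rw [← h', W2_first hm]; norm_num
          · rw [W2_left h' h]; norm_num
        · rw [h, W2_mid hm]; norm_num
        · rcases (by omega : a ≤ i + 1 + 2 * m).eq_or_lt with h' | h'
          · rw [h', W2_last hm]; norm_num
          · rw [W2_right h h']; norm_num
      linarith
    · rw [W2_out (by omega), if_neg h2, if_neg h1]; norm_num
  constructor <;> linarith

/-- good blocks at scale `m`, offset `r` -/
noncomputable def goodm {n : ℕ} (m K r : ℕ) (A : Fin n → ℕ) : Finset ℕ :=
  (range K).filter fun b => ((m:ℝ) ≤ sig A m (blk r m b) ∧ sig A m (blk r m b) ≤ 3 * m) ∧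
    (sig A m (blk r m b) / 4 < G2 A m (blk r m b) ^ 2 ∧
      G2 A m (blk r m b) ^ 2 < 6 * sig A m (blk r m b))

lemma scalem_prob1 (n m K k r : ℕ) (t : ℝ) (hm : 1 ≤ m) (ht : 2 + 4 * t ≤ m)
    (hK : r + (2 * m + 1) * K ≤ n) (hk : 10 * k ≤ K) :
    (((Om n).filter fun A => reg n t A ∧ (goodm m K r A).card < k).card : ℝ) ≤
      (7 / 10) ^ k * (n : ℝ) ^ n := by
  have key := block_core n k r m K hm hK (fun s => (m:ℝ) ≤ s ∧ s ≤ 3 * m)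
    (fun s x => s / 4 < x ^ 2 ∧ x ^ 2 < 6 * s) (by
      intro w hw
      have hm' : (1:ℝ) ≤ m := by exact_mod_cast hm
      have := prob_large w (by linarith [hw.1])
      convert this)
  refine le_trans (Nat.cast_le.2 (card_le_card ?_)) key
  intro A hA
  rw [mem_filter] at hA ⊢
  obtain ⟨hO, hr, hc⟩ := hA
  refine ⟨hO, ?_, ?_⟩
  · have hfull : ((range K).filter fun b => (m:ℝ) ≤ sig A m (blk r m b) ∧
        sig A m (blk r m b) ≤ 3 * m) = range K := by
      rw [filter_eq_self]
      intro b hb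
      rw [mem_range] at hb
      have := blk_sep (r := r) (m := m) hb
      refine reg_sig hr m _ hm ht ?_ ?_
      · simp only [blk]; omega
      · simp only [blk] at *; omega
    have : 10 * k ≤ ((range K).filter fun b => (m:ℝ) ≤ sig A m (blk r m b) ∧
        sig A m (blk r m b) ≤ 3 * m).card := by rw [hfull, card_range]; exact hk
    convert this
  · rw [goodm] at hc
    convert hc

/-- some offset has few good blocks -/
def badm {n : ℕ} (m K k : ℕ) (A : Fin n → ℕ) : Prop :=
  ∃ r ∈ range (2 * m + 1), (goodm m K r A).card < k

lemma scalem_prob (n m K k : ℕ) (t : ℝ) (hm : 1 ≤ m) (ht : 2 + 4 * t ≤ m)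
    (hK : 2 * m + (2 * m + 1) * K ≤ n) (hk : 10 * k ≤ K) :
    (((Om n).filter fun A => reg n t A ∧ badm m K k A).card : ℝ) ≤
      (2 * m + 1) * ((7 / 10) ^ k * (n : ℝ) ^ n) := by
  have h1 : ((Om n).filter fun A => reg n t A ∧ badm m K k A).card ≤ ∑ r ∈ range (2 * m + 1),
      ((Om n).filter fun A => reg n t A ∧ (goodm m K r A).card < k).card := by
    refine le_trans (card_le_card ?_) card_biUnion_le
    intro A hA
    obtain ⟨hO, hr, r, hr1, hc⟩ := mem_filter.1 hA
    exact mem_biUnion.2 ⟨r, hr1, mem_filter.2 ⟨hO, hr, hc⟩⟩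
  refine le_trans (Nat.cast_le.2 h1) ?_
  rw [Nat.cast_sum]
  refine le_trans (Finset.sum_le_sum (g := fun _ => (7 / 10) ^ k * (n : ℝ) ^ n) ?_) ?_
  · intro r hr
    rw [mem_range] at hr
    exact scalem_prob1 n m K k r t hm ht (by omega) hk
  · rw [sum_const, card_range, nsmul_eq_mul]; push_cast; rfl

lemma scalem_det (n m K k : ℕ) (hn : 0 < n) (A : Fin n → ℕ)
    (hK : 2 * m + (2 * m + 1) * K ≤ n)
    (hA : ∀ r ∈ range (2 * m + 1), k ≤ (goodm m K r A).card)
    (α β : ℝ) (hα : α ^ 2 * (18 * m) ≤ 1 / 4) :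
    8 * ((2 * m + 1) * (k * (α ^ 2 * (m / 4)))) ≤ 18 * (n * (1 - ‖fhat n A α β‖)) := by
  set T := (range (2 * m + 1)).sigma (fun r => goodm m K r A) with hT
  have hs := second_diff n hn A α β m (T.image fun p => blk p.1 m p.2) (by
    intro j hj
    obtain ⟨⟨r, b⟩, hb, rfl⟩ := mem_image.1 hj
    rw [hT, mem_sigma, goodm, mem_filter, mem_range, mem_range] at hb
    have := blk_sep (r := r) (m := m) hb.2.1
    simp only [blk] at *
    constructor <;> omega)
  rw [sum_image (by
    rintro ⟨r, b⟩ h1 ⟨r', b'⟩ h2 h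
    have h1' : r < 2 * m + 1 := mem_range.1 (mem_sigma.1 h1).1
    have h2' : r' < 2 * m + 1 := mem_range.1 (mem_sigma.1 h2).1
    have h' : r + (2 * m + 1) * b = r' + (2 * m + 1) * b' := by
      simp only [blk] at h; omega
    have e1 := congrArg (· % (2 * m + 1)) h'
    simp only [Nat.add_mul_mod_self_left, Nat.mod_eq_of_lt h1', Nat.mod_eq_of_lt h2'] at e1
    subst e1
    have : b = b' := Nat.eq_of_mul_eq_mul_left (by omega : 0 < 2 * m + 1) (by omega)
    subst this
    rfl), hT, sum_sigma] at hs
  have hlow : ∀ r ∈ range (2 * m + 1), (k:ℝ) * (α ^ 2 * (m / 4)) ≤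
      ∑ b ∈ goodm m K r A, ‖((α * G2 A m (blk r m b) : ℝ) : UnitAddCircle)‖ ^ 2 := by
    intro r hr
    have h1 : ∀ b ∈ goodm m K r A, α ^ 2 * ((m:ℝ) / 4) ≤
        ‖((α * G2 A m (blk r m b) : ℝ) : UnitAddCircle)‖ ^ 2 := by
      intro b hb
      rw [goodm, mem_filter] at hb
      obtain ⟨_, ⟨h1, h2⟩, h3, h4⟩ := hb
      set g := G2 A m (blk r m b)
      set s := sig A m (blk r m b)
      have ha : 0 ≤ α ^ 2 := sq_nonneg α
      have h5 : |α * g| ≤ 1 / 2 := by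
        apply abs_le_of_sq_le_sq _ (by norm_num)
        have : α ^ 2 * g ^ 2 ≤ α ^ 2 * (18 * m) :=
          mul_le_mul_of_nonneg_left (by linarith) ha
        rw [mul_pow]; linarith
      rw [(AddCircle.norm_coe_eq_abs_iff (1:ℝ) one_ne_zero).2 (by simpa using h5), sq_abs, mul_pow]
      exact mul_le_mul_of_nonneg_left (by linarith) ha
    have h2 := Finset.sum_le_sum h1
    rw [sum_const, nsmul_eq_mul] at h2
    refine le_trans ?_ h2
    exact mul_le_mul_of_nonneg_right (Nat.cast_le.2 (hA r hr)) (by positivity)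
  have h3 := Finset.sum_le_sum hlow
  rw [sum_const, card_range, nsmul_eq_mul] at h3
  push_cast at h3
  refine le_trans ?_ hs
  linarith

lemma circ_norm_le (x : ℝ) : ‖(x : UnitAddCircle)‖ ≤ |x| := by
  rw [UnitAddCircle.norm_eq]
  simpa using round_le x 0

lemma beta_core (n m : ℕ) (hn : 0 < n) (hmn : 2 * m ≤ n) (t : ℝ) (A : Fin n → ℕ)
    (hreg : reg n t A) (α β c : ℝ) (hβ : |β| * m ≤ 1 / 2) (hc : 0 ≤ c)
    (h : c + |α| * (2 * t) ≤ |β| * m) :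
    n * c ^ 2 ≤ n * (1 - ‖fhat n A α β‖) := by
  have hs := first_diff n hn A α β m (Icc 1 (n - m)) (by
    intro j hj; rw [mem_Icc] at hj; omega)
  refine le_trans ?_ hs
  have hpt : ∀ j ∈ Icc 1 (n - m), c ^ 2 ≤
      ‖((α * (gA A (j + m) - gA A j) + β * m : ℝ) : UnitAddCircle)‖ ^ 2 := by
    intro j hj
    rw [mem_Icc] at hj
    have g1 := gA_le hreg (j + m) (mem_Icc.2 (by omega))
    have g2 := gA_le hreg j (mem_Icc.2 (by omega))
    have hx : |α * (gA A (j + m) - gA A j)| ≤ |α| * (2 * t) := by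
      rw [abs_mul]
      refine mul_le_mul_of_nonneg_left ?_ (abs_nonneg _)
      have := abs_sub (gA A (j + m)) (gA A j)
      linarith
    set x := α * (gA A (j + m) - gA A j)
    have e1 : |β * m| = |β| * m := by rw [abs_mul, Nat.abs_cast]
    have e2 : ‖((β * m : ℝ) : UnitAddCircle)‖ = |β| * m := by
      rw [(AddCircle.norm_coe_eq_abs_iff (1:ℝ) one_ne_zero).2 (by rw [e1]; simpa using hβ), e1]
    have e3 : ((β * m : ℝ) : UnitAddCircle) = ((x + β * m : ℝ) : UnitAddCircle) - (x : UnitAddCircle) := by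
      rw [← AddCircle.coe_sub]; congr 1; ring
    have e4 := norm_sub_le ((x + β * m : ℝ) : UnitAddCircle) (x : UnitAddCircle)
    rw [← e3, e2] at e4
    have e5 := circ_norm_le x
    exact pow_le_pow_left₀ hc (by linarith) 2
  have h2 := Finset.sum_le_sum hpt
  rw [sum_const, Nat.card_Icc, nsmul_eq_mul] at h2
  have h3 : (n:ℝ) ≤ 2 * ((n - m + 1 - 1 : ℕ) : ℝ) := by
    have : n ≤ 2 * (n - m + 1 - 1) := by omega
    exact_mod_cast this
  have := mul_le_mul_of_nonneg_right h3 (sq_nonneg c)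
  linarith

lemma beta_det (n : ℕ) (L : ℝ) (hL : 100 ≤ L) (hn : 10 ^ 20 * L ^ 3 ≤ n)
    (A : Fin n → ℕ) (hreg : reg n (√(10 * n * L)) A) (α β : ℝ) (hb : |β| ≤ 1 / 2)
    (hα : |α| ≤ 10 ^ 7 * L / n) (hβ : 10 ^ 9 * (L / n) ^ ((3 : ℝ) / 2) ≤ |β|) :
    10 * L ≤ n * (1 - ‖fhat n A α β‖) := by
  have hL0 : 0 < L := by linarith
  have hL3 : (100:ℝ) ^ 3 ≤ L ^ 3 := pow_le_pow_left₀ (by norm_num) hL 3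
  have hn0 : (0:ℝ) < n := by nlinarith
  have hnN : 0 < n := by exact_mod_cast hn0
  set s := √(L / n) with hs
  have hq0 : 0 < L / n := by positivity
  have hs0 : 0 < s := Real.sqrt_pos.2 hq0
  have hs2 : s ^ 2 = L / n := Real.sq_sqrt hq0.le
  have hns : n * s ^ 2 = L := by rw [hs2]; field_simp
  have hp : (L / n) ^ ((3 : ℝ) / 2) = s ^ 3 := by
    rw [hs, Real.sqrt_eq_rpow, ← Real.rpow_natCast, ← Real.rpow_mul hq0.le]; norm_num
  rw [hp] at hβ
  have ht : √(10 * n * L) ≤ 16 / 5 * (n * s) := by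
    rw [Real.sqrt_le_left (by positivity)]
    have : (16 / 5 * (n * s)) ^ 2 = 256 / 25 * n * (n * s ^ 2) := by ring
    rw [this, hns]
    nlinarith [mul_pos hn0 hL0]
  set t := √(10 * n * L)
  have ht0 : 0 ≤ t := Real.sqrt_nonneg _
  set y := n * s ^ 3 with hy
  have hy0 : 0 < y := by positivity
  have hη : |α| * (2 * t) ≤ 64 * 10 ^ 6 * y := by
    calc |α| * (2 * t) ≤ (10 ^ 7 * L / n) * (2 * (16 / 5 * (n * s))) := by gcongr
      _ = 64 * 10 ^ 6 * (n * (L / n) * s) := by ring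
      _ = _ := by rw [← hs2, hy]; ring
  have hyn : n * y ^ 2 = L ^ 3 := by
    rw [hy, ← hns]; ring
  have hys : y ≤ 1 / 10 ^ 10 := by
    apply le_of_sq_le_sq _ (by norm_num)
    have : n * y ^ 2 * 10 ^ 20 ≤ n * 1 := by rw [hyn]; linarith
    have := le_of_mul_le_mul_left (by linarith : n * (y ^ 2 * 10 ^ 20) ≤ n * 1) hn0
    norm_num at *; linarith
  have hn1 : (100:ℝ) ≤ n := by nlinarith
  by_cases hc : |β| * ((n / 2 : ℕ) : ℝ) ≤ 1 / 2
  · have key := beta_core n (n / 2) hnN (by omega) t A hreg α β (10 ^ 8 * y) hc (by positivity) (by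
      have h1 : (n:ℝ) / 3 ≤ ((n / 2 : ℕ) : ℝ) := by
        have hn1' : 100 ≤ n := by exact_mod_cast hn1
        have : n ≤ 3 * (n / 2) := by omega
        have : (n:ℝ) ≤ 3 * ((n / 2 : ℕ) : ℝ) := by exact_mod_cast this
        linarith
      have h2 : (10 ^ 9 * s ^ 3) * (n / 3) ≤ |β| * ((n / 2 : ℕ) : ℝ) := by gcongr
      have h3 : (10 ^ 9 * s ^ 3) * (n / 3) = 10 ^ 9 / 3 * y := by rw [hy]; ring
      linarith)
    refine le_trans ?_ key
    have : n * (10 ^ 8 * y) ^ 2 = 10 ^ 16 * L ^ 3 := by rw [← hyn]; ring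
    rw [this]
    nlinarith [pow_pos hL0 2, mul_le_mul hL hL (by norm_num) hL0.le]
  · push Not at hc
    have hβ0 : 0 < |β| := lt_of_lt_of_le (by positivity) hβ
    set m := ⌊1 / (2 * |β|)⌋₊ with hm
    have hx1 : 1 ≤ 1 / (2 * |β|) := by
      rw [le_div_iff₀ (by positivity)]; linarith
    have hm1 : 1 ≤ m := Nat.le_floor (by simpa using hx1)
    have hmu : (m:ℝ) ≤ 1 / (2 * |β|) := Nat.floor_le (by positivity)
    have hml : 1 / (2 * |β|) < m + 1 := Nat.lt_floor_add_one _
    have hmu' : |β| * m ≤ 1 / 2 := by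
      rw [le_div_iff₀ (by positivity)] at hmu; linarith
    have hml' : 1 / 2 < |β| * (m + 1) := by
      rw [div_lt_iff₀ (by positivity)] at hml; linarith
    have hm1' : (1:ℝ) ≤ m := by exact_mod_cast hm1
    have hq : 1 / 4 ≤ |β| * m := by nlinarith
    have hmn : m ≤ n / 2 := by
      have : (m:ℝ) < ((n / 2 : ℕ) : ℝ) := by
        by_contra hcon
        push Not at hcon
        have := mul_le_mul_of_nonneg_left hcon hβ0.le
        linarith
      exact (by exact_mod_cast this.le)
    have key := beta_core n m hnN (by omega) t A hreg α β (1 / 8) hmu' (by norm_num) (by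
      norm_num at hys; linarith)
    refine le_trans ?_ key
    nlinarith [pow_pos hL0 2, mul_le_mul hL hL (by norm_num) hL0.le]

lemma params (n : ℕ) (L : ℝ) (hL : 100 ≤ L) (hn : 10 ^ 20 * L ^ 3 ≤ n) :
    ∃ m K k : ℕ, 1 ≤ m ∧ 2 + 4 * √(10 * n * L) ≤ m ∧ 2 * m + (2 * m + 1) * K ≤ n ∧
      10 * k ≤ K ∧ (m:ℝ) ≤ n / (10 ^ 7 * L) ∧ n / (2 * 10 ^ 7 * L) ≤ (m:ℝ) ∧
      (n:ℝ) / 20 ≤ (2 * m + 1) * k ∧ 40 * L ≤ k := by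
  have hL0 : 0 < L := by linarith
  have hL2 : 0 < L ^ 2 := by positivity
  have hL2' : (100:ℝ) ^ 2 ≤ L ^ 2 := pow_le_pow_left₀ (by norm_num) hL 2
  have hL3 : (100:ℝ) * L ^ 2 ≤ L ^ 3 := by nlinarith
  have hn0 : (0:ℝ) < n := by nlinarith
  have hnL : 10 ^ 20 * (100 ^ 2 * L) ≤ n := by nlinarith
  set x : ℝ := n / (10 ^ 7 * L) with hx
  have hxL : x * L = n / 10 ^ 7 := by rw [hx]; field_simp
  have hx0 : 0 < x := by positivity
  have hxbig : 10 ^ 13 * 100 ^ 2 ≤ x := by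
    rw [hx, le_div_iff₀ (by positivity)]; linarith
  set m := ⌊x⌋₊ with hm
  have hmu : (m:ℝ) ≤ x := Nat.floor_le hx0.le
  have hml : x < m + 1 := Nat.lt_floor_add_one x
  have hm1 : 1 ≤ m := Nat.le_floor (by norm_num; linarith)
  have hmx : x / 2 ≤ m := by linarith
  have ht : √(10 * n * L) ≤ x / 12 := by
    rw [Real.sqrt_le_left (by positivity)]
    have h1 : (x / 12) ^ 2 * L ^ 2 = n ^ 2 / (144 * 10 ^ 14) := by
      have : (x / 12) ^ 2 * L ^ 2 = (x * L) ^ 2 / 144 := by ring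
      rw [this, hxL]; ring
    have h2 : 10 * n * L * L ^ 2 ≤ (x / 12) ^ 2 * L ^ 2 := by
      rw [h1, le_div_iff₀ (by norm_num)]
      nlinarith [mul_le_mul_of_nonneg_left hn hn0.le, pow_pos hL0 3]
    exact le_of_mul_le_mul_right h2 hL2
  have hxn : x ≤ n / 10 ^ 9 := by
    have : x * 100 ≤ x * L := mul_le_mul_of_nonneg_left hL hx0.le
    rw [hxL] at this
    linarith
  have hmn : 100 * m ≤ n := by
    have : (100:ℝ) * m ≤ n := by linarith
    exact_mod_cast this
  set K := (n - 2 * m) / (2 * m + 1) with hK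
  have hd := Nat.div_add_mod (n - 2 * m) (2 * m + 1)
  have hl := Nat.mod_lt (n - 2 * m) (show 0 < 2 * m + 1 by omega)
  rw [← hK] at hd
  have hd10 := Nat.div_add_mod K 10
  have hl10 := Nat.mod_lt K (show 0 < 10 by omega)
  set k := K / 10 with hk
  have hk1 : (n:ℝ) / 20 ≤ (2 * m + 1) * k := by
    have h1 : (K:ℝ) ≤ 10 * k + 9 := by
      have : K ≤ 10 * k + 9 := by omega
      exact_mod_cast this
    have h2 : (n:ℝ) ≤ (2 * m + 1) * K + 4 * m := by
      have : n ≤ (2 * m + 1) * K + 4 * m := by omega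
      exact_mod_cast this
    have h3 : ((2:ℝ) * m + 1) * K ≤ (2 * m + 1) * (10 * k + 9) :=
      mul_le_mul_of_nonneg_left h1 (by positivity)
    have h4 : (100:ℝ) * m ≤ n := by exact_mod_cast hmn
    have h5 : (1:ℝ) ≤ m := by exact_mod_cast hm1
    linarith
  refine ⟨m, K, k, hm1, ?_, ?_, ?_, hmu, ?_, hk1, ?_⟩
  · linarith
  · omega
  · omega
  · refine le_trans (le_of_eq ?_) hmx
    rw [hx]; field_simp
  · by_contra hc
    push Not at hc
    have h5 : (1:ℝ) ≤ m := by exact_mod_cast hm1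
    have h6 : ((2:ℝ) * m + 1) * k ≤ (3 * x) * (40 * L) :=
      mul_le_mul (by linarith) hc.le (by positivity) (by positivity)
    have h7 : (3 * x) * (40 * L) = 120 * (n / 10 ^ 7) := by rw [← hxL]; ring
    linarith

lemma pow_le_E (n : ℕ) (hn : 0 < n) (q : ℝ) (hq0 : 0 ≤ q) (k : ℕ)
    (hk : 10 * Real.log n ≤ (1 - q) * k) : q ^ k ≤ ((n:ℝ) ^ 10)⁻¹ := by
  have hn' : (0:ℝ) < n := by exact_mod_cast hn
  have h1 : q ≤ Real.exp (-(1 - q)) := by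
    have := Real.add_one_le_exp (-(1 - q)); linarith
  calc q ^ k ≤ Real.exp (-(1 - q)) ^ k := pow_le_pow_left₀ hq0 h1 k
    _ = Real.exp (-((1 - q) * k)) := by rw [← Real.exp_nat_mul]; congr 1; ring
    _ ≤ Real.exp (-(10 * Real.log n)) := Real.exp_le_exp.2 (by linarith)
    _ = _ := by
      rw [Real.exp_neg, show (10:ℝ) * Real.log n = ((10:ℕ):ℝ) * Real.log n by norm_num,
        Real.exp_nat_mul, Real.exp_log hn']

set_option maxHeartbeats 1000000 in
lemma main_n (n : ℕ) (hL : 100 ≤ Real.log n) (hn : 10 ^ 20 * Real.log n ^ 3 ≤ n) :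
      1 - (n : ℝ) ^ (-5 : ℤ) ≤
        (((dieFinset n).filter fun A => ∀ α β : ℝ, |α| ≤ 1 / 2 → |β| ≤ 1 / 2 →
            (10 ^ 7 * Real.log n / n ≤ |α| ∨
              10 ^ 9 * (Real.log n / n) ^ ((3 : ℝ) / 2) ≤ |β|) →
            ‖fhat n A α β‖ ^ n ≤ (n : ℝ) ^ (-10 : ℤ)).card : ℝ) /
          (dieFinset n).card := by
  set L := Real.log n with hLdef
  obtain ⟨m, K, k, hm1, htm, hK, hkK, hmu, hml, hmk, hkL⟩ := params n L hL hn
  have hL0 : 0 < L := by linarith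
  have hL2' : (100:ℝ) ^ 2 ≤ L ^ 2 := pow_le_pow_left₀ (by norm_num) hL 2
  have hnL : 10 ^ 20 * (100 ^ 2 * L) ≤ n := by nlinarith
  have hn0 : (0:ℝ) < n := by linarith
  have hnN : 0 < n := by exact_mod_cast hn0
  have hnbig : 10 ^ 20 ≤ n := by
    have : (10:ℝ) ^ 20 ≤ n := by linarith
    exact_mod_cast this
  set t := √(10 * n * L) with ht
  have ht0 : 0 ≤ t := Real.sqrt_nonneg _
  have ht2 : t ^ 2 = 10 * n * L := Real.sq_sqrt (by positivity)
  have hmn : 2 * m + 1 ≤ n := by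
    have hk0 : 0 < k := by
      have : (0:ℝ) < k := by linarith
      exact_mod_cast this
    have : (2 * m + 1) * 1 ≤ (2 * m + 1) * K := Nat.mul_le_mul_left _ (by omega)
    omega
  have hmn' : (2:ℝ) * m + 1 ≤ n := by exact_mod_cast hmn
  set E : ℝ := ((n:ℝ) ^ 10)⁻¹ with hE
  have hE0 : 0 < E := by positivity
  -- deterministic part
  have hdet : ∀ A : Fin n → ℕ, reg n t A → n / 1000 ≤ (good1 n A).card → ¬ badm m K k A →
      ∀ α β : ℝ, |α| ≤ 1 / 2 → |β| ≤ 1 / 2 →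
            (10 ^ 7 * L / n ≤ |α| ∨ 10 ^ 9 * (L / n) ^ ((3 : ℝ) / 2) ≤ |β|) →
            ‖fhat n A α β‖ ^ n ≤ (n : ℝ) ^ (-10 : ℤ) := by
    intro A hr h1 hm α β hα hβ h
    apply power_bound n hnN
    by_cases c1 : 10 ^ 5 * L / n ≤ α ^ 2
    · exact scale1_det n (by omega) A h1 α β hα c1
    push Not at c1
    by_cases c2 : 10 ^ 7 * L / n ≤ |α|
    · have hb : ∀ r ∈ range (2 * m + 1), k ≤ (goodm m K r A).card := by
        intro r hr'
        by_contra hc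
        exact hm ⟨r, hr', not_le.1 hc⟩
      have key := scalem_det n m K k hnN A hK hb α β (by
        calc α ^ 2 * (18 * m) ≤ (10 ^ 5 * L / n) * (18 * (n / (10 ^ 7 * L))) := by
              gcongr
          _ = 18 / 100 := by field_simp; norm_num
          _ ≤ _ := by norm_num)
      have h2 : (10 ^ 7 * L / n) ^ 2 ≤ α ^ 2 := by
        rw [← sq_abs α]; exact pow_le_pow_left₀ (by positivity) c2 2
      have h3 : (n:ℝ) / 20 * ((10 ^ 7 * L / n) ^ 2 * ((n / (2 * 10 ^ 7 * L)) / 4)) ≤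
          ((2 * m + 1) * k) * (α ^ 2 * (m / 4)) := by gcongr
      have h4 : (n:ℝ) / 20 * ((10 ^ 7 * L / n) ^ 2 * ((n / (2 * 10 ^ 7 * L)) / 4)) =
          10 ^ 7 / 160 * L := by field_simp; norm_num
      linarith
    · push Not at c2
      exact beta_det n L hL hn A hr α β hβ c2.le (h.resolve_left (not_le.2 c2))
  -- probability
  have p1 : (((Om n).filter fun A => ¬ reg n t A).card : ℝ) ≤ 3 * n * E * (n:ℝ) ^ n := by
    have h2t : 2 * t ≤ n := by
      linarith
    refine (reg_prob n hnN t ht0 h2t).trans ?_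
    have : Real.exp (-(t ^ 2 / n)) = E := by
      rw [ht2, hE, show 10 * n * L / n = ((10:ℕ):ℝ) * L by field_simp; norm_num, Real.exp_neg,
        Real.exp_nat_mul, hLdef, Real.exp_log hn0]
    rw [this]
    have : (2:ℝ) * (n + 1) ≤ 3 * n := by linarith
    gcongr
  have p2 : (((Om n).filter fun A => (good1 n A).card < n / 1000).card : ℝ) ≤
      2 * E * (n:ℝ) ^ n := by
    refine (scale1_prob n (by omega)).trans ?_
    have e1 : ((96:ℝ) / 100) ^ n ≤ E := pow_le_E n hnN _ (by norm_num) n (by linarith)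
    have e2 : ((7:ℝ) / 10) ^ (n / 1000) ≤ E := by
      refine pow_le_E n hnN _ (by norm_num) _ ?_
      have : (n:ℝ) ≤ 2000 * ((n / 1000 : ℕ) : ℝ) := by
        have : n ≤ 2000 * (n / 1000) := by omega
        exact_mod_cast this
      linarith
    refine mul_le_mul_of_nonneg_right (by linarith) (by positivity)
  have p3 : (((Om n).filter fun A => reg n t A ∧ badm m K k A).card : ℝ) ≤
      n * E * (n:ℝ) ^ n := by
    refine (scalem_prob n m K k t hm1 htm hK hkK).trans ?_
    have e2 : ((7:ℝ) / 10) ^ k ≤ E := pow_le_E n hnN _ (by norm_num) _ (by linarith)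
    rw [← mul_assoc]
    gcongr
  have hD := card_dice n hnN
  set D : ℝ := ((dieFinset n).card : ℝ) with hDdef
  have hDpos : 0 < D := by
    have : (0:ℝ) < (n:ℝ) ^ n := by positivity
    by_contra hc
    push Not at hc
    have : (n:ℝ) ^ 2 * D ≤ 0 := mul_nonpos_of_nonneg_of_nonpos (by positivity) hc
    linarith
  set P : (Fin n → ℕ) → Prop := fun A => ∀ α β : ℝ, |α| ≤ 1 / 2 → |β| ≤ 1 / 2 →
            (10 ^ 7 * L / n ≤ |α| ∨ 10 ^ 9 * (L / n) ^ ((3 : ℝ) / 2) ≤ |β|) →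
            ‖fhat n A α β‖ ^ n ≤ (n : ℝ) ^ (-10 : ℤ) with hP
  have hsplit : ((dieFinset n).filter P).card + ((dieFinset n).filter fun A => ¬ P A).card =
      (dieFinset n).card := card_filter_add_card_filter_not _
  have hbad : ((dieFinset n).filter fun A => ¬ P A).card ≤
      ((Om n).filter fun A => ¬ reg n t A).card +
      ((Om n).filter fun A => (good1 n A).card < n / 1000).card +
      ((Om n).filter fun A => reg n t A ∧ badm m K k A).card := by
    refine le_trans (card_le_card ?_) ((card_union_le _ _).trans
      (Nat.add_le_add_right (card_union_le _ _) _))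
    intro A hA
    obtain ⟨hd, hPA⟩ := mem_filter.1 hA
    have hO : A ∈ Om n := (mem_filter.1 hd).1
    rw [mem_union, mem_union, mem_filter, mem_filter, mem_filter]
    by_contra hc
    push Not at hc
    obtain ⟨⟨h1, h2⟩, h3⟩ := hc
    exact hPA (hdet A (h1 hO) (h2 hO) (h3 hO (h1 hO)))
  have hbad' : (((dieFinset n).filter fun A => ¬ P A).card : ℝ) ≤ 6 * n * E * (n:ℝ) ^ n := by
    have : (((dieFinset n).filter fun A => ¬ P A).card : ℝ) ≤ _ := Nat.cast_le.2 hbad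
    push_cast at this
    have hx : 2 * E * (n:ℝ) ^ n ≤ 2 * n * E * (n:ℝ) ^ n := by
      have : (1:ℝ) ≤ n := by exact_mod_cast hnN
      have h0 : 0 < E * (n:ℝ) ^ n := by positivity
      nlinarith
    linarith
  have hfin : 6 * n * E * (n:ℝ) ^ n ≤ (n:ℝ) ^ (-5:ℤ) * D := by
    have h1 : 6 * n * E * (n:ℝ) ^ n ≤ 6 * n * E * (n ^ 2 * D) := by gcongr
    refine h1.trans ?_
    have h2 : 6 * n * E * (n ^ 2 * D) = (6 * n ^ 3 * E) * D := by ring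
    rw [h2]
    refine mul_le_mul_of_nonneg_right ?_ hDpos.le
    rw [hE, zpow_neg, show ((n:ℝ) ^ (5:ℤ)) = (n:ℝ) ^ 5 by norm_cast]
    rw [← div_eq_mul_inv, div_le_iff₀ (by positivity)]
    have h3 : ((n:ℝ) ^ 5)⁻¹ * n ^ 10 = n ^ 3 * n ^ 2 := by field_simp
    rw [h3]
    have : (6:ℝ) ≤ n ^ 2 := by
      have h6 : (6:ℝ) ≤ n := by exact_mod_cast (by omega : 6 ≤ n)
      have := mul_le_mul h6 h6 (by norm_num) hn0.le
      rw [sq]; linarith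
    have h4 := mul_le_mul_of_nonneg_left this (pow_pos hn0 3).le
    linarith
  have hsplit' : (((dieFinset n).filter P).card : ℝ) +
      (((dieFinset n).filter fun A => ¬ P A).card : ℝ) = D := by
    rw [hDdef, ← hsplit]; push_cast; rfl
  rw [le_div_iff₀ hDpos]
  have hgoal : (1 - (n:ℝ) ^ (-5:ℤ)) * D ≤ (((dieFinset n).filter P).card : ℝ) := by linarith
  convert hgoal

lemma ev_large : ∃ N : ℕ, ∀ n : ℕ, N ≤ n →
    100 ≤ Real.log n ∧ 10 ^ 20 * Real.log n ^ 3 ≤ n := by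
  have h1 : ∀ᶠ x : ℝ in Filter.atTop, 100 ≤ Real.log x :=
    Real.tendsto_log_atTop.eventually_ge_atTop 100
  have h2 : ∀ᶠ x : ℝ in Filter.atTop, ‖Real.log x ^ 3‖ ≤ (1 / 10 ^ 20) * ‖x‖ :=
    (Real.isLittleO_pow_log_id_atTop (n := 3)).bound (by norm_num)
  have h3 := (h1.and (h2.and (Filter.eventually_ge_atTop 0)))
  obtain ⟨N, hN⟩ := Filter.eventually_atTop.1 (tendsto_natCast_atTop_atTop.eventually h3)
  refine ⟨N, fun n hn => ?_⟩
  obtain ⟨a, b, c⟩ := hN n hn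
  refine ⟨a, ?_⟩
  rw [Real.norm_of_nonneg c, Real.norm_eq_abs] at b
  have := le_abs_self (Real.log n ^ 3)
  linarith

/-- for all large enough n, with probability at least 1 − n^{−5} over a
uniformly random n-sided die A, we have |f̂(α,β)|^n ≤ n^{−10} for every
(α,β) ∈ [−1/2,1/2]² with |α| ≥ 10^7·log n/n or |β| ≥ 10^9·(log n/n)^{3/2}. -/
theorem charFun_power_small_outside_box :
    ∃ N : ℕ, ∀ n : ℕ, N ≤ n →
      1 - (n : ℝ) ^ (-5 : ℤ) ≤
        (((dieFinset n).filter fun A => ∀ α β : ℝ, |α| ≤ 1 / 2 → |β| ≤ 1 / 2 →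
            (10 ^ 7 * Real.log n / n ≤ |α| ∨
              10 ^ 9 * (Real.log n / n) ^ ((3 : ℝ) / 2) ≤ |β|) →
            ‖fhat n A α β‖ ^ n ≤ (n : ℝ) ^ (-10 : ℤ)).card : ℝ) /
          (dieFinset n).card := by
  obtain ⟨N, hN⟩ := ev_large
  exact ⟨N, fun n hn => main_n n (hN n hn).1 (hN n hn).2⟩
end

section
/- Let n ≥ 2 be an integer, let x be a real number and y a complex number with x² ≤ 1/(4n) and |y| ≤ 1/(8n). Then |1 − (1 − x + y)^n / exp(−nx)| ≤ 40n(|y| + x²) and |1 − exp(−nx) / (1 − x + y)^n| ≤ 40n(|y| + x²). -/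
theorem norm_pow_sub_one_le_aux (w : ℂ) (d : ℝ) (hd : 0 ≤ d) (h : ‖w - 1‖ ≤ d) (k : ℕ) :
    ‖w ^ k - 1‖ ≤ (1 + d) ^ k - 1 := by
  induction k with
  | zero => simp
  | succ k ih =>
    have hw : ‖w‖ ≤ 1 + d := by
      have := norm_sub_norm_le w 1
      rw [norm_one] at this
      linarith
    have e : w ^ (k + 1) - 1 = w * (w ^ k - 1) + (w - 1) := by ring
    rw [e]
    refine (norm_add_le _ _).trans ?_
    rw [norm_mul]
    have := mul_le_mul hw ih (norm_nonneg _) (by linarith)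
    rw [pow_succ]
    linarith

/-- for an integer n ≥ 2, a real x and a complex y with x² ≤ 1/(4n) and
|y| ≤ 1/(8n), we have |1 − (1−x+y)^n/exp(−nx)| ≤ 40n(|y|+x²) and
|1 − exp(−nx)/(1−x+y)^n| ≤ 40n(|y|+x²). -/
theorem power_vs_exponential_estimate_complex (n : ℕ) (hn : 2 ≤ n) (x : ℝ) (y : ℂ)
    (hx : x ^ 2 ≤ 1 / (4 * n)) (hy : ‖y‖ ≤ 1 / (8 * n)) :
    ‖1 - (1 - (x : ℂ) + y) ^ n / Complex.exp (-(n : ℂ) * x)‖ ≤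
        40 * n * (‖y‖ + x ^ 2) ∧
      ‖1 - Complex.exp (-(n : ℂ) * x) / (1 - (x : ℂ) + y) ^ n‖ ≤
        40 * n * (‖y‖ + x ^ 2) := by
  have hn' : (2 : ℝ) ≤ n := by exact_mod_cast hn
  have hn0 : (0 : ℝ) < n := by linarith
  have hx' : n * x ^ 2 ≤ 1 / 4 := by
    rw [le_div_iff₀ (by positivity)] at hx
    linarith
  have hy' : n * ‖y‖ ≤ 1 / 8 := by
    rw [le_div_iff₀ (by positivity)] at hy
    linarith
  have hx8 : x ^ 2 ≤ 1 / 8 := by nlinarith [sq_nonneg x]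
  have hx38 : x ≤ 3 / 8 := by nlinarith
  have hx38' : -(3 / 8) ≤ x := by nlinarith
  have hpos := Real.exp_pos x
  have h1 : (1 - x) * Real.exp x ≤ 1 := by
    have h := Real.add_one_le_exp (-x)
    have h2 : Real.exp (-x) * Real.exp x = 1 := by rw [← Real.exp_add]; simp
    nlinarith
  have h2 : 1 - x ^ 2 ≤ (1 - x) * Real.exp x := by
    have h := Real.add_one_le_exp x
    nlinarith
  have h3 : Real.exp x ≤ 8 / 5 := by nlinarith
  obtain ⟨w, hw⟩ : ∃ w : ℂ, w = (1 - (x : ℂ) + y) * Complex.exp x := ⟨_, rfl⟩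
  obtain ⟨d, hd⟩ : ∃ d : ℝ, d = x ^ 2 + 8 / 5 * ‖y‖ := ⟨_, rfl⟩
  have hd0 : 0 ≤ d := by rw [hd]; positivity
  have hwd : ‖w - 1‖ ≤ d := by
    have e : w - 1 = (((1 - x) * Real.exp x - 1 : ℝ) : ℂ) + y * ((Real.exp x : ℝ) : ℂ) := by
      rw [hw]; push_cast; ring
    rw [e, hd]
    refine (norm_add_le _ _).trans (add_le_add ?_ ?_)
    · rw [Complex.norm_real, Real.norm_eq_abs, abs_le]
      constructor <;> nlinarith [sq_nonneg x]
    · rw [norm_mul, Complex.norm_real, Real.norm_eq_abs, abs_of_pos hpos]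
      nlinarith [norm_nonneg y]
  have hnd : n * d ≤ 9 / 20 := by rw [hd]; nlinarith
  have hnd0 : 0 ≤ n * d := by positivity
  have hpow := norm_pow_sub_one_le_aux w d hd0 hwd n
  have hexp : (1 + d) ^ n ≤ Real.exp (n * d) := by
    rw [Real.exp_nat_mul]
    exact pow_le_pow_left₀ (by linarith) (by linarith [Real.add_one_le_exp d]) n
  have hexp2 := (abs_le.1 (Real.abs_exp_sub_one_le (x := n * d)
    (by rw [abs_of_nonneg hnd0]; linarith))).2
  rw [abs_of_nonneg hnd0] at hexp2
  have hA : ‖w ^ n - 1‖ ≤ 2 * (n * d) := by linarith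
  have hB : 1 / 10 ≤ ‖w ^ n‖ := by
    have h := norm_sub_norm_le (1 : ℂ) (w ^ n)
    rw [norm_sub_rev, norm_one] at h
    linarith
  have hwn : w ^ n ≠ 0 := by
    intro h; rw [h, norm_zero] at hB; linarith
  have hndb : n * d ≤ 8 / 5 * (n * (‖y‖ + x ^ 2)) := by
    rw [hd]; nlinarith [mul_nonneg hn0.le (sq_nonneg x)]
  have hE : Complex.exp (-(n : ℂ) * x) = (Complex.exp x ^ n)⁻¹ := by
    rw [← Complex.exp_nat_mul, ← Complex.exp_neg]; congr 1; ring
  have e1 : (1 - (x : ℂ) + y) ^ n / Complex.exp (-(n : ℂ) * x) = w ^ n := by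
    rw [hE, div_inv_eq_mul, hw, mul_pow]
  have e2 : Complex.exp (-(n : ℂ) * x) / (1 - (x : ℂ) + y) ^ n = (w ^ n)⁻¹ := by
    rw [← e1, inv_div]
  rw [e1, e2]
  constructor
  · rw [norm_sub_rev]
    linarith
  · have e3 : 1 - (w ^ n)⁻¹ = (w ^ n - 1) / w ^ n := by field_simp
    rw [e3, norm_div, div_le_iff₀ (by linarith)]
    have : 0 ≤ n * (‖y‖ + x ^ 2) := by positivity
    nlinarith
end

section
/- There exists N such that for all n ≥ N the following holds. Let A be an n-sided die in the balanced sequences model satisfying (i) max_{1 ≤ j ≤ n} |g_A(j)| ≤ 2√(n·log n), and (ii) |f̂(α,β)|^n ≤ n^{−10} for every (α,β) ∈ [−1/2,1/2]² with |α| ≥ 10^7·log n/n or |β| ≥ 10^9·(log n/n)^{3/2}. Define h : ℝ² → ℂ by h(α,β) = f̂(α,β)^n for (α,β) ∈ [−1/2,1/2]² and h(α,β) = 0 otherwise, and define g(α,β) = exp(−2π²n(α²·E U² + 2αβ·E(UV) + β²·E V²)). Then ∫_{ℝ²} |h(α,β) − g(α,β)| dα dβ ≤ 10^{50}·(log n)^7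 / n³. -/
open Finset

open MeasureTheory

/-- E U², where (U,V) = (g_A(j), j − (n+1)/2) with j uniform on {1,…,n}. -/
noncomputable def EU2 (n : ℕ) (A : Fin n → ℕ) : ℝ :=
  (1 / n : ℝ) * ∑ j ∈ Finset.Icc 1 n, gA A j ^ 2

/-- E (UV), where (U,V) = (g_A(j), j − (n+1)/2) with j uniform on {1,…,n}. -/
noncomputable def EUV (n : ℕ) (A : Fin n → ℕ) : ℝ :=
  (1 / n : ℝ) * ∑ j ∈ Finset.Icc 1 n, gA A j * ((j : ℝ) - (n + 1) / 2)

/-- E V², where (U,V) = (g_A(j), j − (n+1)/2) with j uniform on {1,…,n}. -/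
noncomputable def EV2 (n : ℕ) (A : Fin n → ℕ) : ℝ :=
  (1 / n : ℝ) * ∑ j ∈ Finset.Icc 1 n, ((j : ℝ) - (n + 1) / 2) ^ 2


lemma aux_pow_sub (x y : ℂ) (hx : ‖x‖ ≤ 1) (hy : ‖y‖ ≤ 1) (n : ℕ) :
    ‖x ^ n - y ^ n‖ ≤ n * ‖x - y‖ := by
  induction n with
  | zero => simp
  | succ k ih =>
    have h : x ^ (k + 1) - y ^ (k + 1) = x * (x ^ k - y ^ k) + (x - y) * y ^ k := by ring
    rw [h]
    have h1 : ‖x * (x ^ k - y ^ k)‖ ≤ k * ‖x - y‖ := by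
      rw [norm_mul]
      calc ‖x‖ * ‖x ^ k - y ^ k‖ ≤ 1 * ‖x ^ k - y ^ k‖ := by gcongr
        _ ≤ _ := by rw [one_mul]; exact ih
    have h2 : ‖(x - y) * y ^ k‖ ≤ ‖x - y‖ := by
      rw [norm_mul, norm_pow]
      calc ‖x - y‖ * ‖y‖ ^ k ≤ ‖x - y‖ * 1 := by
            gcongr
            exact pow_le_one₀ (norm_nonneg _) hy
        _ = _ := mul_one _
    calc _ ≤ _ := norm_add_le _ _
      _ ≤ k * ‖x - y‖ + ‖x - y‖ := add_le_add h1 h2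
      _ = _ := by push_cast; ring

/-- averaged exponential -/
noncomputable def avgE (n : ℕ) (x : ℕ → ℝ) : ℂ :=
  (n : ℂ)⁻¹ * ∑ j ∈ Finset.Icc 1 n, Complex.exp ((x j : ℂ) * Complex.I)

lemma avgE_norm_le (n : ℕ) (hn : 0 < n) (x : ℕ → ℝ) : ‖avgE n x‖ ≤ 1 := by
  have hn' : (0 : ℝ) < n := by exact_mod_cast hn
  unfold avgE
  rw [norm_mul, norm_inv, Complex.norm_natCast]
  have : ‖∑ j ∈ Finset.Icc 1 n, Complex.exp ((x j : ℂ) * Complex.I)‖ ≤ n := by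
    refine (norm_sum_le _ _).trans ?_
    simp [Complex.norm_exp_ofReal_mul_I]
  rw [inv_mul_le_iff₀ hn']
  linarith

lemma avgE_lower (n : ℕ) (hn : 0 < n) (x : ℕ → ℝ) :
    1 - (1 / 2 * ∑ j ∈ Finset.Icc 1 n, x j ^ 2) / n ≤ ‖avgE n x‖ := by
  have hn' : (0 : ℝ) < n := by exact_mod_cast hn
  refine le_trans ?_ (Complex.re_le_norm _)
  have h : (avgE n x).re = (n : ℝ)⁻¹ * ∑ j ∈ Finset.Icc 1 n, Real.cos (x j) := by
    unfold avgE
    rw [← Complex.ofReal_natCast, ← Complex.ofReal_inv, Complex.re_ofReal_mul, Complex.re_sum]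
    simp [Complex.exp_ofReal_mul_I_re]
  rw [h]
  have h2 : ∑ j ∈ Finset.Icc 1 n, (1 - x j ^ 2 / 2) ≤ ∑ j ∈ Finset.Icc 1 n, Real.cos (x j) :=
    Finset.sum_le_sum fun j _ => Real.one_sub_sq_div_two_le_cos
  rw [Finset.sum_sub_distrib, ← Finset.sum_div] at h2
  simp at h2
  calc _ = (n : ℝ)⁻¹ * (n - (∑ j ∈ Finset.Icc 1 n, x j ^ 2) / 2) := by field_simp
    _ ≤ _ := by gcongr; linarith

lemma exp_taylor (x : ℝ) (hx : |x| ≤ 1) :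
    ‖Complex.exp ((x : ℂ) * Complex.I) - (1 + x * Complex.I - x ^ 2 / 2)‖ ≤ |x| ^ 3 / 2 := by
  have hx' : ‖(x : ℂ) * Complex.I‖ ≤ 1 := by simpa using hx
  have h := Complex.exp_bound hx' (n := 3) (by norm_num)
  have e1 : ∑ m ∈ Finset.range 3, ((x : ℂ) * Complex.I) ^ m / (m.factorial : ℂ)
      = 1 + x * Complex.I - x ^ 2 / 2 := by
    simp [Finset.sum_range_succ, Nat.factorial, mul_pow]
    ring
  rw [e1] at h
  refine h.trans ?_
  have : ‖(x : ℂ) * Complex.I‖ = |x| := by simp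
  rw [this]
  have h3 : 0 ≤ |x| ^ 3 := by positivity
  norm_num [Nat.factorial]
  nlinarith

lemma avgE_approx (n : ℕ) (hn : 0 < n) (x : ℕ → ℝ) (D : ℝ) (hD : D ≤ 1)
    (hx : ∀ j ∈ Finset.Icc 1 n, |x j| ≤ D) (hs : ∑ j ∈ Finset.Icc 1 n, x j = 0) :
    ‖avgE n x ^ n - ((Real.exp (-(1 / 2 * ∑ j ∈ Finset.Icc 1 n, x j ^ 2)) : ℝ) : ℂ)‖
      ≤ n * D ^ 3 := by
  have hn' : (0 : ℝ) < n := by exact_mod_cast hn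
  have hnC : (n : ℂ) ≠ 0 := by exact_mod_cast hn.ne'
  have hD0 : 0 ≤ D := (abs_nonneg _).trans (hx 1 (by simp; omega))
  set S := ∑ j ∈ Finset.Icc 1 n, x j ^ 2 with hS
  have hS0 : 0 ≤ S := Finset.sum_nonneg fun j _ => sq_nonneg _
  have hS1 : S ≤ n * D ^ 2 := by
    calc S ≤ ∑ j ∈ Finset.Icc 1 n, D ^ 2 :=
          Finset.sum_le_sum fun j hj => by
            rw [← sq_abs]; exact pow_le_pow_left₀ (abs_nonneg _) (hx j hj) 2
      _ = _ := by simp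
  set y := S / (2 * n) with hy
  have hy0 : 0 ≤ y := by positivity
  have hy1 : y ≤ D ^ 2 / 2 := by
    rw [hy, div_le_div_iff₀ (by positivity) (by norm_num)]
    linarith
  have hD2 : D ^ 2 ≤ 1 := pow_le_one₀ hD0 hD
  have e1 : ((Real.exp (-(1 / 2 * S)) : ℝ) : ℂ) = ((Real.exp (-y) : ℝ) : ℂ) ^ n := by
    rw [← Complex.ofReal_pow, ← Real.exp_nat_mul]
    congr 2
    rw [hy]; field_simp
  rw [e1]
  refine (aux_pow_sub _ _ (avgE_norm_le n hn x) ?_ n).trans ?_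
  · rw [Complex.norm_real, Real.norm_of_nonneg (Real.exp_nonneg _)]
    exact Real.exp_le_one_iff.mpr (by linarith)
  gcongr
  have h1 : ‖avgE n x - ((1 - y : ℝ) : ℂ)‖ ≤ D ^ 3 / 2 := by
    have e2 : avgE n x - ((1 - y : ℝ) : ℂ) = (n : ℂ)⁻¹ * ∑ j ∈ Finset.Icc 1 n,
        (Complex.exp ((x j : ℂ) * Complex.I) - (1 + x j * Complex.I - x j ^ 2 / 2)) := by
      have hsC : ∑ j ∈ Finset.Icc 1 n, (x j : ℂ) = 0 := by exact_mod_cast hs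
      have hSC : ∑ j ∈ Finset.Icc 1 n, (x j : ℂ) ^ 2 = S := by rw [hS]; push_cast; rfl
      rw [Finset.sum_sub_distrib, Finset.sum_sub_distrib, Finset.sum_add_distrib,
        ← Finset.sum_mul, hsC, ← Finset.sum_div, hSC, hy]
      unfold avgE
      generalize ∑ j ∈ Finset.Icc 1 n, Complex.exp ((x j : ℂ) * Complex.I) = T
      simp
      field_simp
    rw [e2, norm_mul, norm_inv, Complex.norm_natCast, inv_mul_le_iff₀ hn']
    refine (norm_sum_le _ _).trans ?_
    calc _ ≤ ∑ j ∈ Finset.Icc 1 n, D ^ 3 / 2 := by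
          refine Finset.sum_le_sum fun j hj => (exp_taylor _ ((hx j hj).trans hD)).trans ?_
          have := pow_le_pow_left₀ (abs_nonneg _) (hx j hj) 3
          linarith
      _ = _ := by simp
  have h2 : ‖((1 - y : ℝ) : ℂ) - ((Real.exp (-y) : ℝ) : ℂ)‖ ≤ D ^ 3 / 2 := by
    rw [← Complex.ofReal_sub, Complex.norm_real, Real.norm_eq_abs, abs_sub_comm]
    have := Real.abs_exp_sub_one_sub_id_le (x := -y) (by rw [abs_neg, abs_of_nonneg hy0]; linarith)
    have e3 : Real.exp (-y) - (1 - y) = Real.exp (-y) - 1 - -y := by ring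
    rw [e3]
    refine this.trans ?_
    have hy2 : y ^ 2 ≤ (D ^ 2 / 2) ^ 2 := pow_le_pow_left₀ hy0 hy1 2
    have hD3 : 0 ≤ D ^ 3 := by positivity
    nlinarith
  calc _ ≤ _ := norm_sub_le_norm_sub_add_norm_sub _ ((1 - y : ℝ) : ℂ) _
    _ ≤ D ^ 3 / 2 + D ^ 3 / 2 := add_le_add h1 h2
    _ = _ := by ring

lemma sum_V (n : ℕ) : ∑ j ∈ Finset.Icc 1 n, ((j : ℝ) - (n + 1) / 2) = 0 := by
  have h : ∀ m : ℕ, ∑ j ∈ Finset.Icc 1 m, (j : ℝ) = m * (m + 1) / 2 := by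
    intro m
    induction m with
    | zero => simp
    | succ k ih => rw [Finset.sum_Icc_succ_top (by omega), ih]; push_cast; ring
  rw [Finset.sum_sub_distrib, h]
  simp
  ring

lemma sum_gA (n : ℕ) (A : Fin n → ℕ) (hA : A ∈ dieFinset n) :
    ∑ j ∈ Finset.Icc 1 n, gA A j = 0 := by
  simp only [dieFinset, Finset.mem_filter, Fintype.mem_piFinset, Finset.mem_Icc] at hA
  obtain ⟨hr, hs⟩ := hA
  have hsR : ∑ i, (A i : ℝ) = n * (n + 1) / 2 := by
    have h2 : 2 * (n * (n + 1) / 2) = n * (n + 1) :=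
      Nat.mul_div_cancel' (Nat.even_mul_succ_self n).two_dvd
    rw [← hs] at h2
    have : (2 : ℝ) * ∑ i, (A i : ℝ) = n * (n + 1) := by exact_mod_cast h2
    linarith
  have hV := sum_V n
  have hf : ∑ j ∈ Finset.Icc 1 n, fA A j = ∑ i, ((n : ℝ) - A i + 1 / 2) := by
    have e1 : ∀ j, fA A j = ∑ i, ((if A i < j then (1 : ℝ) else 0)
        + 1 / 2 * (if A i = j then (1 : ℝ) else 0)) := by
      intro j
      rw [Finset.sum_add_distrib, ← Finset.mul_sum]
      simp [fA]
    simp only [e1]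
    rw [Finset.sum_comm]
    refine Finset.sum_congr rfl fun i _ => ?_
    rw [Finset.sum_add_distrib, ← Finset.mul_sum]
    have c1 : ∑ j ∈ Finset.Icc 1 n, (if A i < j then (1 : ℝ) else 0) = n - A i := by
      rw [Finset.sum_boole]
      have : (Finset.Icc 1 n).filter (fun j => A i < j) = Finset.Ioc (A i) n := by
        ext j; simp; have := hr i; omega
      rw [this, Nat.card_Ioc, Nat.cast_sub (hr i).2]
    have c2 : ∑ j ∈ Finset.Icc 1 n, (if A i = j then (1 : ℝ) else 0) = 1 := by
      rw [Finset.sum_ite_eq]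
      simp [hr i]
    rw [c1, c2]; ring
  have hg : ∀ j : ℕ, gA A j = fA A j - ((j : ℝ) - (n + 1) / 2) - n / 2 := by
    intro j; unfold gA; ring
  simp only [hg]
  rw [Finset.sum_sub_distrib, Finset.sum_sub_distrib, hV, hf, Finset.sum_add_distrib,
    Finset.sum_sub_distrib, hsR]
  simp
  ring

/-- phases -/
noncomputable def xA {n : ℕ} (A : Fin n → ℕ) (α β : ℝ) (j : ℕ) : ℝ :=
  2 * Real.pi * (α * gA A j + β * ((j : ℝ) - (n + 1) / 2))

/-- the quadratic form -/
noncomputable def qA {n : ℕ} (A : Fin n → ℕ) (α β : ℝ) : ℝ :=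
  1 / 2 * ∑ j ∈ Finset.Icc 1 n, xA A α β j ^ 2

lemma fhat_eq {n : ℕ} (A : Fin n → ℕ) (α β : ℝ) : fhat n A α β = avgE n (xA A α β) := by
  unfold fhat avgE e xA
  congr 1
  refine Finset.sum_congr rfl fun j _ => ?_
  congr 1
  push_cast
  ring

lemma qA_eq {n : ℕ} (hn : 0 < n) (A : Fin n → ℕ) (α β : ℝ) :
    2 * Real.pi ^ 2 * n * (α ^ 2 * EU2 n A + 2 * α * β * EUV n A + β ^ 2 * EV2 n A)
      = qA A α β := by
  have hn' : (n : ℝ) ≠ 0 := by exact_mod_cast hn.ne'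
  have h : ∑ j ∈ Finset.Icc 1 n, xA A α β j ^ 2 = 4 * Real.pi ^ 2 *
      (α ^ 2 * (∑ j ∈ Finset.Icc 1 n, gA A j ^ 2)
        + 2 * α * β * (∑ j ∈ Finset.Icc 1 n, gA A j * ((j : ℝ) - (n + 1) / 2))
        + β ^ 2 * ∑ j ∈ Finset.Icc 1 n, ((j : ℝ) - (n + 1) / 2) ^ 2) := by
    rw [Finset.mul_sum, Finset.mul_sum, Finset.mul_sum, ← Finset.sum_add_distrib,
      ← Finset.sum_add_distrib, Finset.mul_sum]
    refine Finset.sum_congr rfl fun j _ => ?_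
    unfold xA; ring
  unfold qA EU2 EUV EV2
  rw [h]
  field_simp
  ring

lemma qA_smul {n : ℕ} (A : Fin n → ℕ) (t α β : ℝ) :
    qA A (t * α) (t * β) = t ^ 2 * qA A α β := by
  unfold qA
  rw [mul_left_comm, Finset.mul_sum (a := t ^ 2)]
  congr 1
  refine Finset.sum_congr rfl fun j _ => ?_
  unfold xA; ring

lemma qA_boundary {n : ℕ} (hn : 0 < n) (A : Fin n → ℕ) (α β L : ℝ) (hL : L = Real.log n)
    (hL0 : 0 ≤ L) (hLn : 100 * L ≤ n)
    (h : ‖fhat n A α β‖ ^ n ≤ (n : ℝ) ^ (-10 : ℤ)) : 9 * L ≤ qA A α β := by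
  have hn' : (0 : ℝ) < n := by exact_mod_cast hn
  rw [fhat_eq] at h
  have h1 := avgE_lower n hn (xA A α β)
  change 1 - qA A α β / n ≤ _ at h1
  have h2 : ‖avgE n (xA A α β)‖ ≤ Real.exp (-(10 * L / n)) := by
    refine le_of_pow_le_pow_left₀ hn.ne' (Real.exp_nonneg _) (h.trans (le_of_eq ?_))
    rw [← Real.exp_nat_mul, ← Real.rpow_intCast, Real.rpow_def_of_pos hn', hL]
    congr 1
    push_cast
    field_simp
  have h3 : Real.exp (-(10 * L / n)) ≤ 1 / (1 + 10 * L / n) := by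
    rw [Real.exp_neg, ← one_div]
    apply one_div_le_one_div_of_le (by positivity)
    linarith [Real.add_one_le_exp (10 * L / n)]
  have h4 : 1 / (1 + 10 * L / n) ≤ 1 - 9 * L / n := by
    rw [div_le_iff₀ (by positivity)]
    set u := L / n with hu
    have hu0 : 0 ≤ u := by positivity
    have hu1 : u ≤ 1 / 100 := by rw [hu, div_le_iff₀ hn']; linarith
    have e1 : 9 * L / n = 9 * u := by rw [hu]; ring
    have e2 : 10 * L / n = 10 * u := by rw [hu]; ring
    rw [e1, e2]
    nlinarith
  have h5 : 9 * L / n ≤ qA A α β / n := by linarith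
  exact (div_le_div_iff_of_pos_right hn').mp h5

/-- Gaussian tail bound outside the box. -/
lemma qA_outside {n : ℕ} (A : Fin n → ℕ) (a b L : ℝ) (ha : 0 < a) (hb : 0 < b) (hL0 : 0 ≤ L)
    (hq : ∀ α β : ℝ, |α| ≤ a → |β| ≤ b → (a ≤ |α| ∨ b ≤ |β|) → 9 * L ≤ qA A α β)
    (α β : ℝ) (h : a ≤ |α| ∨ b ≤ |β|) :
    4 * L + 2 * L * ((α / a) ^ 2 + (β / b) ^ 2) ≤ qA A α β := by
  set t := max (|α| / a) (|β| / b) with ht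
  have ta : |α| / a ≤ t := le_max_left _ _
  have tb : |β| / b ≤ t := le_max_right _ _
  have ht1 : 1 ≤ t := by
    rcases h with h | h
    · exact le_trans ((one_le_div ha).mpr h) ta
    · exact le_trans ((one_le_div hb).mpr h) tb
  have ht0 : 0 < t := by linarith
  have hk : 9 * L ≤ qA A (α / t) (β / t) := by
    apply hq
    · rw [abs_div, abs_of_pos ht0, div_le_iff₀ ht0]
      rw [div_le_iff₀ ha] at ta; linarith
    · rw [abs_div, abs_of_pos ht0, div_le_iff₀ ht0]
      rw [div_le_iff₀ hb] at tb; linarith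
    · rw [abs_div, abs_div, abs_of_pos ht0, le_div_iff₀ ht0, le_div_iff₀ ht0]
      rcases max_choice (|α| / a) (|β| / b) with h | h
      · left; rw [ht, h]; field_simp; exact le_refl _
      · right; rw [ht, h]; field_simp; exact le_refl _
  have hs := qA_smul A t (α / t) (β / t)
  rw [mul_div_cancel₀ _ ht0.ne', mul_div_cancel₀ _ ht0.ne'] at hs
  rw [hs]
  have s1 : (α / a) ^ 2 ≤ t ^ 2 := by
    rw [← sq_abs, abs_div, abs_of_pos ha]; gcongr
  have s2 : (β / b) ^ 2 ≤ t ^ 2 := by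
    rw [← sq_abs, abs_div, abs_of_pos hb]; gcongr
  have s3 : 1 ≤ t ^ 2 := one_le_pow₀ ht1
  calc _ ≤ 4 * L * t ^ 2 + 2 * L * (t ^ 2 + t ^ 2) := by
        have := mul_le_mul_of_nonneg_left s3 hL0
        have := mul_le_mul_of_nonneg_left s1 hL0
        have := mul_le_mul_of_nonneg_left s2 hL0
        nlinarith
    _ ≤ t ^ 2 * (9 * L) := by nlinarith [mul_nonneg hL0 (sq_nonneg t)]
    _ ≤ _ := by gcongr

/-- the dominating function and its integral -/
lemma dominating (a b c d M m K : ℝ) (ha : 0 < a) (hb : 0 < b) (hc : 0 < c) (hd : 0 < d) :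
    Integrable (fun p : ℝ × ℝ =>
      M * ((Set.Icc (-a) a ×ˢ Set.Icc (-b) b).indicator (fun _ => (1 : ℝ)) p)
      + m * ((Set.Icc (-(1 / 2) : ℝ) (1 / 2) ×ˢ Set.Icc (-(1 / 2) : ℝ) (1 / 2)).indicator
          (fun _ => (1 : ℝ)) p)
      + K * (Real.exp (-c * p.1 ^ 2) * Real.exp (-d * p.2 ^ 2))) ∧
    (∫ p : ℝ × ℝ,
      (M * ((Set.Icc (-a) a ×ˢ Set.Icc (-b) b).indicator (fun _ => (1 : ℝ)) p)
      + m * ((Set.Icc (-(1 / 2) : ℝ) (1 / 2) ×ˢ Set.Icc (-(1 / 2) : ℝ) (1 / 2)).indicator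
          (fun _ => (1 : ℝ)) p)
      + K * (Real.exp (-c * p.1 ^ 2) * Real.exp (-d * p.2 ^ 2))))
      = M * (2 * a * (2 * b)) + m + K * (Real.sqrt (Real.pi / c) * Real.sqrt (Real.pi / d)) := by
  have key : ∀ u v : ℝ, 0 < u → 0 < v →
      Integrable ((Set.Icc (-u) u ×ˢ Set.Icc (-v) v).indicator (fun _ : ℝ × ℝ => (1 : ℝ))) ∧
      ∫ p : ℝ × ℝ, (Set.Icc (-u) u ×ˢ Set.Icc (-v) v).indicator (fun _ => (1 : ℝ)) p
        = 2 * u * (2 * v) := by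
    intro u v hu hv
    have hm : MeasurableSet (Set.Icc (-u) u ×ˢ Set.Icc (-v) v) :=
      measurableSet_Icc.prod measurableSet_Icc
    have hv' : (volume : Measure (ℝ × ℝ)) (Set.Icc (-u) u ×ˢ Set.Icc (-v) v)
        = ENNReal.ofReal (2 * u) * ENNReal.ofReal (2 * v) := by
      rw [Measure.volume_eq_prod, Measure.prod_prod, Real.volume_Icc, Real.volume_Icc]
      congr 2 <;> ring
    constructor
    · rw [integrable_indicator_iff hm]
      apply integrableOn_const
      · rw [hv']; exact ENNReal.mul_ne_top ENNReal.ofReal_ne_top ENNReal.ofReal_ne_top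
      · simp
    · rw [integral_indicator hm, setIntegral_const, measureReal_def, hv', ENNReal.toReal_mul,
        ENNReal.toReal_ofReal (by positivity), ENNReal.toReal_ofReal (by positivity)]
      simp
  obtain ⟨i1, v1⟩ := key a b ha hb
  obtain ⟨i2, v2⟩ := key (1 / 2) (1 / 2) (by norm_num) (by norm_num)
  have i3 : Integrable (fun p : ℝ × ℝ => Real.exp (-c * p.1 ^ 2) * Real.exp (-d * p.2 ^ 2)) :=
    (integrable_exp_neg_mul_sq hc).mul_prod (integrable_exp_neg_mul_sq hd)
  have v3 : ∫ p : ℝ × ℝ, Real.exp (-c * p.1 ^ 2) * Real.exp (-d * p.2 ^ 2)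
      = Real.sqrt (Real.pi / c) * Real.sqrt (Real.pi / d) := by
    rw [← integral_gaussian c, ← integral_gaussian d]
    exact integral_prod_mul (fun x : ℝ => Real.exp (-c * x ^ 2))
      (fun x : ℝ => Real.exp (-d * x ^ 2))
  have j1 := i1.const_mul M
  have j2 := i2.const_mul m
  have j3 := i3.const_mul K
  refine ⟨(j1.add j2).add j3, ?_⟩
  have j12 := j1.add j2
  simp only [Pi.add_def] at j12
  rw [integral_add j12 j3, integral_add j1 j2, integral_const_mul, integral_const_mul,
    integral_const_mul, v1, v2, v3]
  ring

lemma eventually_large : ∃ N : ℕ, ∀ n : ℕ, N ≤ n →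
    1 ≤ Real.log n ∧ Real.log n ^ 3 ≤ (1 / 10 ^ 20) * n := by
  have h1 : ∀ᶠ x : ℝ in Filter.atTop, 1 ≤ Real.log x :=
    Real.tendsto_log_atTop.eventually_ge_atTop 1
  have h2 : ∀ᶠ x : ℝ in Filter.atTop, ‖Real.log x ^ 3‖ ≤ (1 / 10 ^ 20) * ‖x‖ :=
    (Real.isLittleO_pow_log_id_atTop (n := 3)).bound (by norm_num)
  have h3 := tendsto_natCast_atTop_atTop (R := ℝ) |>.eventually (h1.and h2)
  obtain ⟨N, hN⟩ := Filter.eventually_atTop.mp h3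
  refine ⟨N, fun n hn => ?_⟩
  obtain ⟨p, q⟩ := hN n hn
  refine ⟨p, ?_⟩
  simpa using (le_abs_self _).trans q

/-- for all large n and any n-sided die A satisfying the max-norm bound
on g_A and the outside-box bound on |f̂|^n, the truncated n-th power h of the
characteristic function is within 10^50·(log n)^7/n³ of the Gaussian
g(α,β) = exp(−2π²n(α²EU² + 2αβE(UV) + β²EV²)) in L¹(ℝ²). -/
theorem gaussian_L1_approximation :
    ∃ N : ℕ, ∀ n : ℕ, N ≤ n → ∀ A ∈ dieFinset n,
      (∀ j ∈ Finset.Icc 1 n, |gA A j| ≤ 2 * Real.sqrt (n * Real.log n)) →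
      (∀ α β : ℝ, |α| ≤ 1 / 2 → |β| ≤ 1 / 2 →
        (10 ^ 7 * Real.log n / n ≤ |α| ∨
          10 ^ 9 * (Real.log n / n) ^ ((3 : ℝ) / 2) ≤ |β|) →
        ‖fhat n A α β‖ ^ n ≤ (n : ℝ) ^ (-10 : ℤ)) →
      (∫ p : ℝ × ℝ, ‖
          ((if |p.1| ≤ 1 / 2 ∧ |p.2| ≤ 1 / 2 then fhat n A p.1 p.2 ^ n else 0) -
            ((Real.exp (-(2 * Real.pi ^ 2 * n *
              (p.1 ^ 2 * EU2 n A + 2 * p.1 * p.2 * EUV n A + p.2 ^ 2 * EV2 n A))) : ℝ) : ℂ) : ℂ)‖)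
        ≤ 10 ^ 50 * Real.log n ^ 7 / n ^ 3 := by
  obtain ⟨N, hN⟩ := eventually_large
  refine ⟨max N 1, fun n hn A hA hU hout => ?_⟩
  have hn1 : 0 < n := by have := le_max_right N 1; omega
  have hn' : (0 : ℝ) < n := by exact_mod_cast hn1
  have hn1' : (1 : ℝ) ≤ n := by exact_mod_cast hn1
  obtain ⟨hL1, hL3⟩ := hN n (le_trans (le_max_left _ _) hn)
  set L := Real.log n with hL
  have hL0 : 0 < L := by linarith
  have hLn : L ≤ (1 / 10 ^ 20) * n := le_trans (le_self_pow₀ hL1 (by norm_num)) hL3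
  -- the basic scale
  set r := Real.sqrt (L / n) with hr
  have hr0 : 0 < r := Real.sqrt_pos.mpr (by positivity)
  have hr2 : r ^ 2 = L / n := Real.sq_sqrt (by positivity)
  have hLr : L = n * r ^ 2 := by rw [hr2]; field_simp
  have hsq : Real.sqrt (n * L) = n * r := by
    rw [Real.sqrt_eq_iff_mul_self_eq (by positivity) (by positivity), hLr]; ring
  have hr3 : (L / n) ^ ((3 : ℝ) / 2) = r ^ 3 := by
    rw [← hr2, ← Real.rpow_natCast r 2, ← Real.rpow_mul hr0.le, ← Real.rpow_natCast r 3]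
    norm_num
  have hw : n * r ^ 3 ≤ 1 / 10 ^ 10 := by
    have : (n * r ^ 3) ^ 2 ≤ (1 / 10 ^ 10) ^ 2 := by
      have e1 : (n * r ^ 3) ^ 2 = L ^ 3 / n := by rw [hLr]; field_simp
      rw [e1, div_le_iff₀ hn']
      linarith
    exact le_of_pow_le_pow_left₀ (by norm_num) (by norm_num) this
  set a := 10 ^ 7 * r ^ 2 with ha
  set b := 10 ^ 9 * r ^ 3 with hb
  have ha0 : 0 < a := by positivity
  have hb0 : 0 < b := by positivity
  have ea : 10 ^ 7 * L / n = a := by rw [ha, hr2]; ring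
  have ha2 : a ≤ 1 / 2 := by
    have : L / n ≤ 1 / 10 ^ 20 := by rw [div_le_iff₀ hn']; exact hLn
    rw [ha, hr2]; linarith
  have hb2 : b ≤ 1 / 2 := by
    have : r ^ 3 ≤ n * r ^ 3 := le_mul_of_one_le_left (by positivity) hn1'
    rw [hb]; linarith
  rw [hr3, ← hb, ea] at hout
  rw [hsq] at hU
  have hq := qA_outside A a b L ha0 hb0 hL0.le (fun α β h1 h2 h3 =>
    qA_boundary hn1 A α β L hL hL0.le (by linarith)
      (hout α β (h1.trans ha2) (h2.trans hb2) h3))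
  -- approximation in the box
  have hpi := Real.pi_lt_d2
  have hpi0 := Real.pi_pos
  set D := 33 * 10 ^ 8 * (n * r ^ 3) with hD
  have hD0 : 0 ≤ D := by positivity
  have hD1 : D ≤ 1 := by rw [hD]; linarith
  have hin : ∀ α β : ℝ, |α| ≤ a → |β| ≤ b →
      ‖fhat n A α β ^ n - ((Real.exp (-(qA A α β)) : ℝ) : ℂ)‖ ≤ n * D ^ 3 := by
    intro α β h1 h2
    rw [fhat_eq]
    apply avgE_approx n hn1 _ D hD1
    · intro j hj
      have hv : |(j : ℝ) - (n + 1) / 2| ≤ n / 2 := by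
        rw [Finset.mem_Icc] at hj
        have j1 : (1 : ℝ) ≤ j := by exact_mod_cast hj.1
        have j2 : (j : ℝ) ≤ n := by exact_mod_cast hj.2
        rw [abs_le]; constructor <;> linarith
      unfold xA
      rw [abs_mul, abs_of_pos (by positivity : 0 < 2 * Real.pi)]
      have h3 : |α * gA A j + β * ((j : ℝ) - (n + 1) / 2)| ≤ a * (2 * (n * r)) + b * (n / 2) := by
        refine (abs_add_le _ _).trans (add_le_add ?_ ?_)
        · rw [abs_mul]; exact mul_le_mul h1 (hU j hj) (abs_nonneg _) ha0.le
        · rw [abs_mul]; exact mul_le_mul h2 hv (abs_nonneg _) hb0.le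
      have h4 : a * (2 * (n * r)) + b * (n / 2) = 52 * 10 ^ 7 * (n * r ^ 3) := by
        rw [ha, hb]; ring
      rw [h4] at h3
      have hw0 : 0 < n * r ^ 3 := by positivity
      calc _ ≤ 2 * 3.15 * (52 * 10 ^ 7 * (n * r ^ 3)) := by gcongr
        _ ≤ D := by rw [hD]; linarith
    · unfold xA
      rw [← Finset.mul_sum, Finset.sum_add_distrib, ← Finset.mul_sum, ← Finset.mul_sum,
        sum_gA n A hA, sum_V]
      simp
  -- domination
  obtain ⟨hFi, hFv⟩ := dominating a b (2 * L / a ^ 2) (2 * L / b ^ 2) (n * D ^ 3)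
    ((n : ℝ) ^ (-10 : ℤ)) (Real.exp (-(4 * L))) ha0 hb0 (by positivity) (by positivity)
  refine (integral_mono_of_nonneg (Filter.Eventually.of_forall fun p => norm_nonneg _) hFi
    (Filter.Eventually.of_forall fun p => ?_)).trans ?_
  · obtain ⟨α, β⟩ := p
    simp only
    rw [qA_eq hn1]
    have hM0 : 0 ≤ n * D ^ 3 := by positivity
    have hm0 : 0 ≤ (n : ℝ) ^ (-10 : ℤ) := by positivity
    have hK0 : 0 ≤ Real.exp (-(4 * L)) *
        (Real.exp (-(2 * L / a ^ 2) * α ^ 2) * Real.exp (-(2 * L / b ^ 2) * β ^ 2)) := by positivity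
    by_cases hbox : |α| ≤ a ∧ |β| ≤ b
    · have hcube : |α| ≤ 1 / 2 ∧ |β| ≤ 1 / 2 := ⟨hbox.1.trans ha2, hbox.2.trans hb2⟩
      rw [if_pos hcube]
      rw [Set.indicator_of_mem (by
        simp only [Set.mem_prod, Set.mem_Icc, ← abs_le]; exact hbox)]
      have := hin α β hbox.1 hbox.2
      have h0 : 0 ≤ (n : ℝ) ^ (-10 : ℤ) *
        ((Set.Icc (-(1 / 2) : ℝ) (1 / 2) ×ˢ Set.Icc (-(1 / 2) : ℝ) (1 / 2)).indicator
          (fun _ => (1 : ℝ)) (α, β)) :=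
        mul_nonneg hm0 (Set.indicator_nonneg (fun _ _ => zero_le_one) _)
      linarith
    · have hor : a ≤ |α| ∨ b ≤ |β| := by
        by_contra hcon
        push Not at hcon
        exact hbox ⟨hcon.1.le, hcon.2.le⟩
      have hg : ‖((Real.exp (-(qA A α β)) : ℝ) : ℂ)‖ ≤ Real.exp (-(4 * L)) *
          (Real.exp (-(2 * L / a ^ 2) * α ^ 2) * Real.exp (-(2 * L / b ^ 2) * β ^ 2)) := by
        rw [Complex.norm_real, Real.norm_of_nonneg (Real.exp_nonneg _), ← Real.exp_add,
          ← Real.exp_add, Real.exp_le_exp]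
        have := hq α β hor
        have e1 : 2 * L * ((α / a) ^ 2 + (β / b) ^ 2)
          = 2 * L / a ^ 2 * α ^ 2 + 2 * L / b ^ 2 * β ^ 2 := by field_simp
        linarith
      have h0 : 0 ≤ n * D ^ 3 *
          ((Set.Icc (-a) a ×ˢ Set.Icc (-b) b).indicator (fun _ => (1 : ℝ)) (α, β)) :=
        mul_nonneg hM0 (Set.indicator_nonneg (fun _ _ => zero_le_one) _)
      refine (norm_sub_le _ _).trans ?_
      by_cases hcube : |α| ≤ 1 / 2 ∧ |β| ≤ 1 / 2
      · rw [if_pos hcube, norm_pow]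
        have := hout α β hcube.1 hcube.2 hor
        rw [Set.indicator_of_mem (s := Set.Icc (-(1 / 2) : ℝ) (1 / 2) ×ˢ _) (by
          simp only [Set.mem_prod, Set.mem_Icc, ← abs_le]; exact hcube)]
        linarith
      · rw [if_neg hcube, norm_zero]
        rw [Set.indicator_of_notMem (s := Set.Icc (-(1 / 2) : ℝ) (1 / 2) ×ˢ _) (by
          simp only [Set.mem_prod, Set.mem_Icc, ← abs_le]; exact hcube)]
        linarith
  · rw [hFv]
    have sq1 : ∀ u : ℝ, 0 < u → Real.sqrt (Real.pi / (2 * L / u ^ 2)) ≤ 2 * u := by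
      intro u hu
      rw [Real.sqrt_le_left (by positivity), div_div_eq_mul_div, div_le_iff₀ (by positivity)]
      have : 0 < u ^ 2 := by positivity
      nlinarith
    have hL7 : (1 : ℝ) ≤ L ^ 7 := one_le_pow₀ hL1
    have t1 : n * D ^ 3 * (2 * a * (2 * b)) ≤ 10 ^ 49 * (L ^ 7 / n ^ 3) := by
      have e1 : L ^ 7 / n ^ 3 = n ^ 4 * r ^ 14 := by rw [hLr]; field_simp
      have e2 : n * D ^ 3 * (2 * a * (2 * b))
          = (33 * 10 ^ 8) ^ 3 * 4 * 10 ^ 16 * (n ^ 4 * r ^ 14) := by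
        rw [hD, ha, hb]; ring
      rw [e1, e2]
      gcongr
      norm_num
    have t2 : (n : ℝ) ^ (-10 : ℤ) ≤ L ^ 7 / n ^ 3 := by
      rw [zpow_neg, ← one_div]
      apply div_le_div₀ (by positivity) hL7 (by positivity)
      exact_mod_cast pow_le_pow_right₀ hn1' (by norm_num : 3 ≤ 10)
    have t3 : Real.exp (-(4 * L)) *
        (Real.sqrt (Real.pi / (2 * L / a ^ 2)) * Real.sqrt (Real.pi / (2 * L / b ^ 2)))
        ≤ L ^ 7 / n ^ 3 := by
      have e3 : Real.exp (-(4 * L)) = 1 / n ^ 4 := by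
        rw [Real.exp_neg, ← one_div]
        congr 1
        have : Real.exp (4 * L) = Real.exp L ^ 4 := by
          rw [← Real.exp_nat_mul]; norm_num
        rw [this, hL, Real.exp_log hn']
      have e4 : Real.sqrt (Real.pi / (2 * L / a ^ 2)) * Real.sqrt (Real.pi / (2 * L / b ^ 2))
          ≤ (2 * a) * (2 * b) :=
        mul_le_mul (sq1 a ha0) (sq1 b hb0) (Real.sqrt_nonneg _) (by positivity)
      have e5 : (2 * a) * (2 * b) ≤ 1 := by nlinarith
      rw [e3]
      calc 1 / (n : ℝ) ^ 4 * _ ≤ 1 / (n : ℝ) ^ 4 * 1 := by gcongr; exact e4.trans e5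
        _ ≤ _ := by
          rw [mul_one]
          apply div_le_div₀ (by positivity) hL7 (by positivity)
          exact pow_le_pow_right₀ hn1' (by norm_num)
    have hpos : 0 ≤ L ^ 7 / (n : ℝ) ^ 3 := by positivity
    have e6 : 10 ^ 50 * L ^ 7 / (n : ℝ) ^ 3 = 10 ^ 50 * (L ^ 7 / (n : ℝ) ^ 3) := by ring
    rw [e6]
    linarith
end

section
/- There exists N such that for all n ≥ N the following holds. Let A be an n-sided die in the balanced sequences model satisfying (i) max_{1 ≤ j ≤ n} |g_A(j)| ≤ 2√(n·log n), and (ii) |f̂(α,β)|^n ≤ n^{−10} for every (α,β) ∈ [−1/2,1/2]² with |α| ≥ 10^7·log n/n or |β| ≥ 10^9·(log n/n)^{3/2}. Then the probability that A ties with a uniformly random n-sided die B is at most 10^{18}·(log n)^{5/2} / n. -/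
open Finset

/-- All sequences of length `k` with entries in `{1,…,n}`. -/
def allSeq (n k : ℕ) : Finset (Fin k → ℕ) := Fintype.piFinset fun _ : Fin k => Finset.Icc 1 n

lemma allSeq_card (n k : ℕ) : (allSeq n k).card = n ^ k := by
  simp [allSeq]

lemma allSeq_sum_succ (n k : ℕ) (F : ℤ → ℝ) :
    ∑ b ∈ allSeq n (k+1), F (∑ i, (b i : ℤ)) =
      ∑ j ∈ Finset.Icc 1 n, ∑ b ∈ allSeq n k, F (∑ i, (b i : ℤ) + j) := by
  rw [← Finset.sum_product']
  refine Finset.sum_bij' (fun b _ => (b 0, Fin.tail b)) (fun p _ => Fin.cons p.1 p.2) ?_ ?_ ?_ ?_ ?_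
  · intro b hb
    simp only [allSeq, Fintype.mem_piFinset, Finset.mem_product] at hb ⊢
    exact ⟨hb 0, fun i => hb i.succ⟩
  · intro p hp
    simp only [allSeq, Fintype.mem_piFinset, Finset.mem_product] at hp ⊢
    intro i
    refine Fin.cases ?_ ?_ i
    · simpa using hp.1
    · intro i; simpa using hp.2 i
  · intro b hb; simp
  · intro p hp; simp
  · intro b hb
    rw [Fin.sum_univ_succ, add_comm]; rfl

/-- Number of sequences with given sum. -/
noncomputable def cnt (n k : ℕ) (s : ℤ) : ℝ :=
  ∑ b ∈ allSeq n k, if (∑ i, (b i : ℤ)) = s then 1 else 0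

lemma cnt_succ (n k : ℕ) (s : ℤ) :
    cnt n (k+1) s = ∑ j ∈ Finset.Icc 1 n, cnt n k (s - j) := by
  unfold cnt
  rw [allSeq_sum_succ n k (fun x => if x = s then 1 else 0)]
  refine Finset.sum_congr rfl fun j _ => Finset.sum_congr rfl fun b _ => ?_
  congr 1
  exact propext ⟨fun h => by omega, fun h => by omega⟩

lemma cnt_zero (n : ℕ) (s : ℤ) : cnt n 0 s = if 0 = s then 1 else 0 := by
  simp [cnt, allSeq]

lemma cnt_symm (n k : ℕ) : ∀ s : ℤ, cnt n k (k * (n + 1) - s) = cnt n k s := by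
  induction k with
  | zero =>
    intro s
    simp only [cnt_zero]
    congr 1
    exact propext ⟨fun h => by push_cast at h; omega, fun h => by push_cast; omega⟩
  | succ k ih =>
    intro s
    rw [cnt_succ, cnt_succ]
    refine Finset.sum_bij' (fun j _ => n + 1 - j) (fun j _ => n + 1 - j) ?_ ?_ ?_ ?_ ?_
    · intro j hj; simp only [Finset.mem_Icc] at hj ⊢; omega
    · intro j hj; simp only [Finset.mem_Icc] at hj ⊢; omega
    · intro j hj; simp only [Finset.mem_Icc] at hj; omega
    · intro j hj; simp only [Finset.mem_Icc] at hj; omega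
    · intro j hj
      simp only [Finset.mem_Icc] at hj
      rw [← ih]
      congr 1
      rw [Nat.cast_sub (by omega)]
      push_cast; ring

lemma cnt_step (n k : ℕ) (s : ℤ) :
    cnt n (k+1) (s+1) - cnt n (k+1) s = cnt n k s - cnt n k (s - n) := by
  rw [cnt_succ, cnt_succ, ← Finset.sum_sub_distrib]
  have : ∀ m : ℕ, ∑ j ∈ Finset.Icc 1 m, (cnt n k (s + 1 - j) - cnt n k (s - j)) =
      cnt n k s - cnt n k (s - m) := by
    intro m
    induction m with
    | zero => simp
    | succ m ih =>
      rw [Finset.sum_Icc_succ_top (by omega), ih]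
      have : s + 1 - ((m + 1 : ℕ) : ℤ) = s - m := by push_cast; ring
      rw [this]; ring
  exact this n

lemma cnt_mono_of_step (n k : ℕ)
    (h : ∀ x : ℤ, (k : ℤ) * (n + 1) ≤ 2 * x → cnt n k (x + 1) ≤ cnt n k x) :
    ∀ x y : ℤ, |2 * x - k * (n + 1)| ≤ |2 * y - k * (n + 1)| → cnt n k y ≤ cnt n k x := by
  have h1 : ∀ (d : ℕ) (x : ℤ), (k : ℤ) * (n + 1) ≤ 2 * x → cnt n k (x + d) ≤ cnt n k x := by
    intro d
    induction d with
    | zero => intro x _; simp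
    | succ d ih =>
      intro x hx
      refine le_trans ?_ (ih x hx)
      have := h (x + d) (by omega)
      rwa [add_assoc] at this
  have h2 : ∀ x y : ℤ, (k : ℤ) * (n + 1) ≤ 2 * x → x ≤ y → cnt n k y ≤ cnt n k x := by
    intro x y hx hxy
    obtain ⟨d, hd⟩ := Int.le.dest hxy
    rw [← hd]; exact h1 d x hx
  intro x y hxy
  generalize hc : (k : ℤ) * (n + 1) = c at *
  have hs : ∀ s, cnt n k (c - s) = cnt n k s := by
    intro s; rw [← hc]; exact cnt_symm n k s
  rcases le_total c (2 * x) with hx | hx <;> rcases le_total c (2 * y) with hy | hy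
  · rw [abs_of_nonneg (by omega), abs_of_nonneg (by omega)] at hxy
    exact h2 _ _ hx (by omega)
  · rw [abs_of_nonneg (by omega), abs_of_nonpos (by omega)] at hxy
    rw [← hs y]
    exact h2 _ _ hx (by omega)
  · rw [abs_of_nonpos (by omega), abs_of_nonneg (by omega)] at hxy
    rw [← hs x]
    exact h2 _ _ (by omega) (by omega)
  · rw [abs_of_nonpos (by omega), abs_of_nonpos (by omega)] at hxy
    rw [← hs x, ← hs y]
    exact h2 _ _ (by omega) (by omega)

lemma cnt_unimodal (n k : ℕ) :
    ∀ x y : ℤ, |2 * x - k * (n + 1)| ≤ |2 * y - k * (n + 1)| → cnt n k y ≤ cnt n k x := by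
  induction k with
  | zero =>
    apply cnt_mono_of_step
    intro x hx
    simp only [cnt_zero]
    have : ¬ (0 = x + 1) := by push_cast at hx; omega
    rw [if_neg this]
    split_ifs <;> norm_num
  | succ k ih =>
    apply cnt_mono_of_step
    intro x hx
    have h1 := cnt_step n k x
    have h2 : cnt n k x ≤ cnt n k (x - n) := by
      apply ih
      push_cast at hx
      have hx' : (k : ℤ) * (n + 1) + (n + 1) ≤ 2 * x := by linarith
      generalize (k : ℤ) * (n + 1) = c at *
      rw [abs_of_nonneg (a := 2 * x - c) (by omega), abs_le]
      constructor <;> omega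
    linarith

lemma sum_Icc_moment (n : ℕ) (y : ℝ) :
    ∑ j ∈ Finset.Icc 1 n, ((j : ℝ) - (n + 1) / 2 + y) ^ 2 = n * (((n : ℝ) ^ 2 - 1) / 12 + y ^ 2) := by
  have : ∀ (m : ℕ) (z : ℝ), ∑ j ∈ Finset.Icc 1 m, ((j : ℝ) + z) ^ 2 =
      m * (m + 1) * (2 * m + 1) / 6 + z * (m * (m + 1)) + m * z ^ 2 := by
    intro m z
    induction m with
    | zero => simp
    | succ m ih =>
      rw [Finset.sum_Icc_succ_top (by omega), ih]; push_cast; ring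
  have h := this n (y - (n + 1) / 2)
  calc _ = ∑ j ∈ Finset.Icc 1 n, ((j : ℝ) + (y - (n + 1) / 2)) ^ 2 := by
        refine Finset.sum_congr rfl fun j _ => by ring
    _ = _ := by rw [h]; ring

lemma second_moment (n k : ℕ) : ∀ y : ℝ,
    ∑ b ∈ allSeq n k, (((∑ i, (b i : ℤ) : ℤ) : ℝ) - k * ((n + 1) / 2) + y) ^ 2 =
      (n : ℝ) ^ k * (k * (((n : ℝ) ^ 2 - 1) / 12) + y ^ 2) := by
  induction k with
  | zero => intro y; simp [allSeq]
  | succ k ih =>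
    intro y
    rw [allSeq_sum_succ n k (fun x => ((x : ℝ) - (k + 1 : ℕ) * ((n + 1) / 2) + y) ^ 2)]
    calc _ = ∑ j ∈ Finset.Icc 1 n, (n : ℝ) ^ k * (k * (((n : ℝ) ^ 2 - 1) / 12) +
              ((j : ℝ) - (n + 1) / 2 + y) ^ 2) := by
          refine Finset.sum_congr rfl fun j _ => ?_
          rw [← ih]
          refine Finset.sum_congr rfl fun b _ => ?_
          push_cast; ring
      _ = _ := by
          rw [← Finset.mul_sum, Finset.sum_add_distrib, sum_Icc_moment]
          simp; ring

lemma dieFinset_card_eq (n : ℕ) (c : ℤ) (hc : 2 * c = n * (n + 1)) :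
    ((dieFinset n).card : ℝ) = cnt n n c := by
  unfold cnt
  rw [Finset.sum_boole]
  congr 1
  unfold dieFinset allSeq
  congr 1
  refine Finset.filter_congr fun b _ => ?_
  rw [← Nat.cast_sum]
  zify
  have : ((n : ℤ) * (n + 1) / 2) = c := by omega
  rw [this]

lemma dieFinset_card_lower (n : ℕ) (hn : 4 ≤ n) :
    (n : ℝ) ^ n ≤ 4 * (n * Real.sqrt n) * (dieFinset n).card := by
  obtain ⟨c, hc⟩ : ∃ c : ℤ, 2 * c = n * (n + 1) := by
    obtain ⟨c, hc⟩ := (Int.even_mul_succ_self n)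
    exact ⟨c, by omega⟩
  rw [dieFinset_card_eq n c hc]
  set q : ℝ := n * Real.sqrt n with hq
  have hn4 : (4 : ℝ) ≤ n := by exact_mod_cast hn
  have hs2 : 2 ≤ Real.sqrt n := by
    apply Real.le_sqrt_of_sq_le; linarith
  have hq8 : 8 ≤ q := by rw [hq]; nlinarith
  have hqq : q ^ 2 = (n : ℝ) ^ 3 := by
    rw [hq, mul_pow, Real.sq_sqrt (by positivity)]; ring
  set R : ℕ := ⌊q⌋₊ with hR
  have hRle : (R : ℝ) ≤ q := Nat.floor_le (by linarith)
  have hRge : q / 2 ≤ R := by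
    have := Nat.lt_floor_add_one q
    rw [← hR] at this; linarith
  have hcr : (c : ℝ) = n * ((n + 1) / 2) := by
    have : (2 : ℝ) * c = n * (n + 1) := by exact_mod_cast hc
    linarith
  have hRpos : (0 : ℝ) < R := by linarith
  have key : ∀ b ∈ allSeq n n, (1 : ℝ) ≤
      (∑ s ∈ Finset.Icc (c - R) (c + R), if (∑ i, (b i : ℤ)) = s then 1 else 0) +
        (((∑ i, (b i : ℤ) : ℤ) : ℝ) - n * ((n + 1) / 2) + 0) ^ 2 / (R : ℝ) ^ 2 := by
    intro b _
    rw [← hcr]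
    generalize (∑ i, (b i : ℤ)) = x
    rw [Finset.sum_ite_eq]
    split_ifs with hx
    · have : 0 ≤ ((x : ℝ) - c + 0) ^ 2 / (R : ℝ) ^ 2 := by positivity
      linarith
    · rw [zero_add, add_zero, le_div_iff₀ (by positivity), one_mul]
      rw [sq_le_sq, abs_of_pos hRpos]
      have : (R : ℤ) ≤ |x - c| := by
        simp only [Finset.mem_Icc, not_and_or, not_le] at hx
        rw [le_abs]; omega
      exact_mod_cast this
  have h1 := Finset.sum_le_sum key
  rw [Finset.sum_add_distrib, ← Finset.sum_div, second_moment, Finset.sum_comm] at h1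
  simp only [Finset.sum_const, allSeq_card, nsmul_eq_mul, mul_one] at h1
  have h2 : ∑ s ∈ Finset.Icc (c - R) (c + R), ∑ b ∈ allSeq n n,
      (if (∑ i, (b i : ℤ)) = s then (1 : ℝ) else 0) ≤ (2 * R + 1) * cnt n n c := by
    calc _ ≤ ∑ s ∈ Finset.Icc (c - R) (c + (R : ℤ)), cnt n n c := by
          refine Finset.sum_le_sum fun s _ => ?_
          apply cnt_unimodal n n c s
          rw [hc]; simp
      _ = _ := by
          rw [Finset.sum_const, nsmul_eq_mul]
          congr 1
          simp only [Int.card_Icc]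
          have : (c + R + 1 - (c - R)).toNat = 2 * R + 1 := by omega
          rw [this]; push_cast; ring
  have h3 : (n : ℝ) ^ n * (n * (((n : ℝ) ^ 2 - 1) / 12) + 0 ^ 2) / (R : ℝ) ^ 2 ≤
      (n : ℝ) ^ n * (1 / 3) := by
    rw [mul_div_assoc]
    refine mul_le_mul_of_nonneg_left ?_ (by positivity)
    rw [div_le_iff₀ (by positivity)]
    nlinarith
  have h4 : 0 ≤ cnt n n c := by
    unfold cnt; exact Finset.sum_nonneg fun b _ => by split_ifs <;> norm_num
  push_cast at h1
  have h5 : (2 * (R : ℝ) + 1) * cnt n n c ≤ (8 / 3 * q) * cnt n n c :=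
    mul_le_mul_of_nonneg_right (by linarith) h4
  linarith

/-- The (one-sided) triangle kernel transform. -/
noncomputable def Phi (s : ℝ) : ℝ := ∫ x in (0:ℝ)..(1/2), (1 - 2 * x) * Real.cos (2 * Real.pi * (x * s))

lemma Phi_zero : Phi 0 = 1 / 4 := by
  unfold Phi
  have : ∀ x ∈ Set.uIcc (0:ℝ) (1/2), HasDerivAt (fun x : ℝ => x - x ^ 2) ((1 - 2 * x) * Real.cos (2 * Real.pi * (x * 0))) x := by
    intro x _
    have h := (hasDerivAt_id' x).fun_sub (hasDerivAt_pow 2 x)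
    refine h.congr_deriv ?_
    simp
  rw [intervalIntegral.integral_eq_sub_of_hasDerivAt this (by apply Continuous.intervalIntegrable; fun_prop)]
  norm_num

lemma Phi_nonneg (s : ℝ) : 0 ≤ Phi s := by
  by_cases hs : s = 0
  · rw [hs, Phi_zero]; norm_num
  unfold Phi
  set c : ℝ := 2 * Real.pi * s with hc
  have hc0 : c ≠ 0 := by rw [hc]; have := Real.pi_ne_zero; positivity
  have : ∀ x ∈ Set.uIcc (0:ℝ) (1/2), HasDerivAt
      (fun x : ℝ => (1 - 2 * x) * (Real.sin (c * x) / c) - 2 * (Real.cos (c * x) / c ^ 2))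
      ((1 - 2 * x) * Real.cos (2 * Real.pi * (x * s))) x := by
    intro x _
    have hl : HasDerivAt (fun x : ℝ => c * x) c x := by simpa using (hasDerivAt_id x).const_mul c
    have h1 : HasDerivAt (fun x : ℝ => 1 - 2 * x) (-2) x := by
      simpa using ((hasDerivAt_id x).const_mul 2).const_sub 1
    have h2 := (h1.fun_mul (hl.sin.div_const c)).fun_sub ((hl.cos.div_const (c ^ 2)).const_mul 2)
    refine h2.congr_deriv ?_
    have : 2 * Real.pi * (x * s) = c * x := by rw [hc]; ring
    rw [this]; field_simp; ring
  rw [intervalIntegral.integral_eq_sub_of_hasDerivAt this (by apply Continuous.intervalIntegrable; fun_prop)]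
  have h := Real.cos_le_one (c * (1 / 2))
  have h2 : 0 ≤ (1 - Real.cos (c * (1 / 2))) / c ^ 2 := div_nonneg (by linarith) (by positivity)
  rw [sub_div] at h2
  simp only [mul_zero, Real.sin_zero, Real.cos_zero]
  have h3 : (1 - 2 * (1 / 2 : ℝ)) = 0 := by norm_num
  rw [h3, zero_mul, zero_div, mul_zero]
  linarith

lemma integral_split_bound (f : ℝ → ℝ) (hf : Continuous f) (a C D : ℝ) (ha : 0 ≤ a) (ha' : a ≤ 1 / 2)
    (hC : ∀ x, 0 ≤ x → x ≤ 1 / 2 → |f x| ≤ C) (hD : ∀ x, a ≤ x → x ≤ 1 / 2 → |f x| ≤ D) :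
    |∫ x in (0:ℝ)..(1/2), f x| ≤ C * a + D / 2 := by
  rw [← intervalIntegral.integral_add_adjacent_intervals (b := a)
    (hf.intervalIntegrable _ _) (hf.intervalIntegrable _ _)]
  have h1 : ‖∫ x in (0:ℝ)..a, f x‖ ≤ C * |a - 0| := by
    apply intervalIntegral.norm_integral_le_of_norm_le_const
    intro x hx
    rw [Set.uIoc_of_le ha] at hx
    exact hC x hx.1.le (hx.2.trans ha')
  have h2 : ‖∫ x in a..(1/2), f x‖ ≤ D * |1 / 2 - a| := by
    apply intervalIntegral.norm_integral_le_of_norm_le_const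
    intro x hx
    rw [Set.uIoc_of_le ha'] at hx
    exact hD x hx.1.le hx.2
  have hD0 : 0 ≤ D := (abs_nonneg _).trans (hD (1/2) ha' le_rfl)
  rw [sub_zero, abs_of_nonneg ha] at h1
  rw [abs_of_nonneg (by linarith)] at h2
  rw [Real.norm_eq_abs] at h1 h2
  refine (abs_add_le _ _).trans ?_
  nlinarith

lemma double_bound {ι : Type*} (S : Finset ι) (p q : ι → ℝ → ℝ) (hp : ∀ i, Continuous (p i))
    (hq : ∀ i, Continuous (q i)) (a b M ε : ℝ) (ha : 0 ≤ a) (ha' : a ≤ 1 / 2)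
    (hb : 0 ≤ b) (hb' : b ≤ 1 / 2)
    (h1 : ∀ x y, 0 ≤ x → x ≤ 1 / 2 → 0 ≤ y → y ≤ 1 / 2 → |∑ i ∈ S, p i x * q i y| ≤ M)
    (h2 : ∀ x y, 0 ≤ x → x ≤ 1 / 2 → 0 ≤ y → y ≤ 1 / 2 → (a ≤ x ∨ b ≤ y) →
      |∑ i ∈ S, p i x * q i y| ≤ ε) :
    ∑ i ∈ S, (∫ x in (0:ℝ)..(1/2), p i x) * (∫ y in (0:ℝ)..(1/2), q i y) ≤ M * (a * b) + ε := by
  have hε : 0 ≤ ε := (abs_nonneg _).trans (h2 (1/2) (1/2) (by norm_num) le_rfl (by norm_num) le_rfl (Or.inl ha'))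
  have e1 : ∑ i ∈ S, (∫ x in (0:ℝ)..(1/2), p i x) * (∫ y in (0:ℝ)..(1/2), q i y) =
      ∫ x in (0:ℝ)..(1/2), ∑ i ∈ S, p i x * (∫ y in (0:ℝ)..(1/2), q i y) := by
    rw [intervalIntegral.integral_finsetSum]
    · simp
    · intro i _
      exact ((hp i).mul continuous_const).intervalIntegrable _ _
  have e2 : ∀ x, ∑ i ∈ S, p i x * (∫ y in (0:ℝ)..(1/2), q i y) =
      ∫ y in (0:ℝ)..(1/2), ∑ i ∈ S, p i x * q i y := by
    intro x
    rw [intervalIntegral.integral_finsetSum]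
    · simp
    · intro i _
      exact (continuous_const.mul (hq i)).intervalIntegrable _ _
  have hcq : ∀ x, Continuous fun y => ∑ i ∈ S, p i x * q i y := fun x =>
    continuous_finsetSum _ fun i _ => continuous_const.mul (hq i)
  rw [e1]
  refine (le_abs_self _).trans ?_
  refine (integral_split_bound _ ?_ a (M * b + ε / 2) (ε / 2) ha ha' ?_ ?_).trans ?_
  · exact continuous_finsetSum _ fun i _ => (hp i).mul continuous_const
  · intro x hx hx'
    rw [e2]
    exact integral_split_bound _ (hcq x) b M ε hb hb' (fun y hy hy' => h1 x y hx hx' hy hy')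
      (fun y hy hy' => h2 x y hx hx' (hb.trans hy) hy' (Or.inr hy))
  · intro x hx hx'
    rw [e2]
    refine (integral_split_bound _ (hcq x) 0 ε ε le_rfl (by norm_num)
      (fun y hy hy' => h2 x y (ha.trans hx) hx' hy hy' (Or.inl hx))
      (fun y hy hy' => h2 x y (ha.trans hx) hx' hy hy' (Or.inl hx))).trans (by linarith)
  · nlinarith

lemma e_add (x y : ℝ) : e (x + y) = e x * e y := by
  unfold e; rw [← Complex.exp_add]; push_cast; ring_nf

lemma e_eq (x : ℝ) : e x = Complex.exp (((2 * Real.pi * x : ℝ) : ℂ) * Complex.I) := by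
  unfold e; push_cast; ring_nf

lemma norm_e (x : ℝ) : ‖e x‖ = 1 := by
  rw [e_eq, Complex.norm_exp_ofReal_mul_I]

lemma e_re (x : ℝ) : (e x).re = Real.cos (2 * Real.pi * x) := by
  rw [e_eq, Complex.exp_ofReal_mul_I_re]

lemma e_sum {ι : Type*} (S : Finset ι) (f : ι → ℝ) : e (∑ i ∈ S, f i) = ∏ i ∈ S, e (f i) := by
  classical
  induction S using Finset.induction_on with
  | empty => simp [e]
  | insert i S hi ih => rw [Finset.sum_insert hi, Finset.prod_insert hi, e_add, ih]

lemma norm_fhat_le_one (n : ℕ) (A : Fin n → ℕ) (α β : ℝ) : ‖fhat n A α β‖ ≤ 1 := by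
  unfold fhat
  rw [norm_mul, norm_inv, Complex.norm_natCast]
  have : ‖∑ j ∈ Finset.Icc 1 n, e (α * gA A j + β * ((j : ℝ) - (n + 1) / 2))‖ ≤ n := by
    refine (norm_sum_le _ _).trans ?_
    simp [norm_e]
  by_cases hn : (n : ℝ) = 0
  · simp [hn]
  · rw [inv_mul_le_iff₀ (by positivity)]; simpa using this

/-- Sum of `U` values. -/
noncomputable def SU {n : ℕ} (A B : Fin n → ℕ) : ℝ := ∑ i, gA A (B i)
/-- Sum of `V` values. -/
noncomputable def SV {n : ℕ} (B : Fin n → ℕ) : ℝ := ∑ i, ((B i : ℝ) - (n + 1) / 2)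

lemma sum_e (n : ℕ) (hn : n ≠ 0) (A : Fin n → ℕ) (α β : ℝ) :
    ∑ B ∈ allSeq n n, e (α * SU A B + β * SV B) = (n : ℂ) ^ n * fhat n A α β ^ n := by
  have h : (n : ℂ) * fhat n A α β = ∑ j ∈ Finset.Icc 1 n, e (α * gA A j + β * ((j : ℝ) - (n + 1) / 2)) := by
    unfold fhat
    rw [← mul_assoc, mul_inv_cancel₀ (by exact_mod_cast hn), one_mul]
  rw [← mul_pow, h]
  have := Finset.prod_univ_sum (fun _ : Fin n => Finset.Icc 1 n)
    (fun _ j => e (α * gA A j + β * ((j : ℝ) - (n + 1) / 2)))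
  rw [Finset.prod_const, Finset.card_univ, Fintype.card_fin] at this
  rw [this]
  unfold allSeq
  refine Finset.sum_congr rfl fun B _ => ?_
  rw [← e_sum, Finset.sum_add_distrib, SU, SV, Finset.mul_sum, Finset.mul_sum]

lemma sum_coscos (n : ℕ) (hn : n ≠ 0) (A : Fin n → ℕ) (x y δ : ℝ)
    (h1 : ‖fhat n A x y‖ ^ n ≤ δ) (h2 : ‖fhat n A x (-y)‖ ^ n ≤ δ) :
    |∑ B ∈ allSeq n n, Real.cos (2 * Real.pi * (x * SU A B)) * Real.cos (2 * Real.pi * (y * SV B))|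
      ≤ (n : ℝ) ^ n * δ := by
  have hE : ∑ B ∈ allSeq n n, Real.cos (2 * Real.pi * (x * SU A B)) * Real.cos (2 * Real.pi * (y * SV B))
      = (((n : ℂ) ^ n * fhat n A x y ^ n).re + ((n : ℂ) ^ n * fhat n A x (-y) ^ n).re) / 2 := by
    rw [← sum_e n hn, ← sum_e n hn, Complex.re_sum, Complex.re_sum, ← Finset.sum_add_distrib,
      Finset.sum_div]
    refine Finset.sum_congr rfl fun B _ => ?_
    rw [e_re, e_re]
    have e1 : 2 * Real.pi * (x * SU A B + y * SV B) =
      2 * Real.pi * (x * SU A B) + 2 * Real.pi * (y * SV B) := by ring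
    have e2 : 2 * Real.pi * (x * SU A B + -y * SV B) =
      2 * Real.pi * (x * SU A B) - 2 * Real.pi * (y * SV B) := by ring
    rw [e1, e2, Real.cos_add, Real.cos_sub]; ring
  have hb : ∀ z, ‖fhat n A x z‖ ^ n ≤ δ → |((n : ℂ) ^ n * fhat n A x z ^ n).re| ≤ (n : ℝ) ^ n * δ := by
    intro z hz
    refine (Complex.abs_re_le_norm _).trans ?_
    rw [norm_mul, norm_pow, norm_pow, Complex.norm_natCast]
    exact mul_le_mul_of_nonneg_left hz (by positivity)
  have g1 := abs_le.1 (hb y h1)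
  have g2 := abs_le.1 (hb (-y) h2)
  rw [hE, abs_le]
  constructor <;> linarith [g1.1, g1.2, g2.1, g2.2]

lemma sum_Phi_bound (n : ℕ) (hn : n ≠ 0) (A : Fin n → ℕ) (a b δ : ℝ)
    (ha : 0 ≤ a) (ha' : a ≤ 1 / 2) (hb : 0 ≤ b) (hb' : b ≤ 1 / 2)
    (h : ∀ α β : ℝ, |α| ≤ 1 / 2 → |β| ≤ 1 / 2 → (a ≤ |α| ∨ b ≤ |β|) → ‖fhat n A α β‖ ^ n ≤ δ) :
    ∑ B ∈ allSeq n n, Phi (SU A B) * Phi (SV B) ≤ (n : ℝ) ^ n * (a * b + δ) := by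
  have hfac : ∀ x y : ℝ, ∑ B ∈ allSeq n n, ((1 - 2 * x) * Real.cos (2 * Real.pi * (x * SU A B))) *
      ((1 - 2 * y) * Real.cos (2 * Real.pi * (y * SV B))) = ((1 - 2 * x) * (1 - 2 * y)) *
      ∑ B ∈ allSeq n n, Real.cos (2 * Real.pi * (x * SU A B)) * Real.cos (2 * Real.pi * (y * SV B)) := by
    intro x y
    rw [Finset.mul_sum]
    exact Finset.sum_congr rfl fun B _ => by ring
  have hle : ∀ x y K : ℝ, 0 ≤ x → x ≤ 1 / 2 → 0 ≤ y → y ≤ 1 / 2 →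
      |∑ B ∈ allSeq n n, Real.cos (2 * Real.pi * (x * SU A B)) * Real.cos (2 * Real.pi * (y * SV B))| ≤ K →
      |∑ B ∈ allSeq n n, ((1 - 2 * x) * Real.cos (2 * Real.pi * (x * SU A B))) *
      ((1 - 2 * y) * Real.cos (2 * Real.pi * (y * SV B)))| ≤ K := by
    intro x y K hx hx' hy hy' hK
    rw [hfac, abs_mul]
    have : |(1 - 2 * x) * (1 - 2 * y)| ≤ 1 := by
      rw [abs_of_nonneg (mul_nonneg (by linarith) (by linarith))]
      exact mul_le_one₀ (by linarith) (by linarith) (by linarith)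
    exact (mul_le_of_le_one_left (abs_nonneg _) this).trans hK
  have := double_bound (allSeq n n) (fun B x => (1 - 2 * x) * Real.cos (2 * Real.pi * (x * SU A B)))
    (fun B y => (1 - 2 * y) * Real.cos (2 * Real.pi * (y * SV B)))
    (fun B => by fun_prop) (fun B => by fun_prop) a b ((n : ℝ) ^ n) ((n : ℝ) ^ n * δ) ha ha' hb hb'
    (by
      intro x y hx hx' hy hy'
      apply hle x y _ hx hx' hy hy'
      have := sum_coscos n hn A x y 1 (pow_le_one₀ (norm_nonneg _) (norm_fhat_le_one _ _ _ _))
        (pow_le_one₀ (norm_nonneg _) (norm_fhat_le_one _ _ _ _))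
      simpa using this)
    (by
      intro x y hx hx' hy hy' hor
      apply hle x y _ hx hx' hy hy'
      apply sum_coscos n hn A x y δ
      · apply h <;> simpa only [abs_neg, abs_of_nonneg hx, abs_of_nonneg hy]
      · apply h <;> simpa only [abs_neg, abs_of_nonneg hx, abs_of_nonneg hy])
  unfold Phi
  linarith

lemma SV_zero {n : ℕ} {B : Fin n → ℕ} (hB : B ∈ dieFinset n) : SV B = 0 ∧ (∑ i, (B i : ℝ)) = n * (n + 1) / 2 := by
  have h := (Finset.mem_filter.1 hB).2
  have h2 : 2 * ∑ i, B i = n * (n + 1) := by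
    have := (Nat.even_mul_succ_self n).two_dvd
    omega
  have h3 : (2 : ℝ) * ∑ i, (B i : ℝ) = n * (n + 1) := by exact_mod_cast h2
  constructor
  · unfold SV
    rw [Finset.sum_sub_distrib]; simp; linarith
  · linarith

lemma SU_zero {n : ℕ} {A B : Fin n → ℕ} (hB : B ∈ dieFinset n) (ht : ties A B) : SU A B = 0 := by
  have hs := (SV_zero hB).2
  unfold ties at ht
  have c1 : ((Finset.univ : Finset (Fin n × Fin n)).filter fun p => B p.2 < A p.1).card =
      ∑ j, (Finset.univ.filter fun i => B j < A i).card := by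
    simp only [Finset.card_filter]
    rw [Fintype.sum_prod_type_right]
  have c2 : ((Finset.univ : Finset (Fin n × Fin n)).filter fun p => A p.1 < B p.2).card =
      ∑ j, (Finset.univ.filter fun i => A i < B j).card := by
    simp only [Finset.card_filter]
    rw [Fintype.sum_prod_type_right]
  rw [c1, c2] at ht
  have ht' : ∑ j, ((Finset.univ.filter fun i => B j < A i).card : ℝ) =
      ∑ j, ((Finset.univ.filter fun i => A i < B j).card : ℝ) := by exact_mod_cast ht
  have tri : ∀ j, ((Finset.univ.filter fun i => A i < B j).card : ℝ) +
      ((Finset.univ.filter fun i => A i = B j).card : ℝ) +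
      ((Finset.univ.filter fun i => B j < A i).card : ℝ) = n := by
    intro j
    have : (Finset.univ.filter fun i => A i < B j).card +
      (Finset.univ.filter fun i => A i = B j).card +
      (Finset.univ.filter fun i => B j < A i).card = n := by
      simp only [Finset.card_filter]
      rw [← Finset.sum_add_distrib, ← Finset.sum_add_distrib]
      calc _ = ∑ i : Fin n, 1 := by
            refine Finset.sum_congr rfl fun i _ => ?_
            split_ifs <;> omega
        _ = n := by simp
    exact_mod_cast this
  have hg : ∀ j, gA A (B j) = (((Finset.univ.filter fun i => A i < B j).card : ℝ) -
      ((Finset.univ.filter fun i => B j < A i).card : ℝ)) / 2 + (n + 1) / 2 - B j := by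
    intro j
    unfold gA fA
    linarith [tri j]
  unfold SU
  simp only [hg]
  rw [Finset.sum_sub_distrib, Finset.sum_add_distrib, ← Finset.sum_div, Finset.sum_sub_distrib, ht', hs]
  simp; ring

lemma ties_count_bound (n : ℕ) (hn : n ≠ 0) (A : Fin n → ℕ) (a b δ : ℝ)
    (ha : 0 ≤ a) (ha' : a ≤ 1 / 2) (hb : 0 ≤ b) (hb' : b ≤ 1 / 2)
    (h : ∀ α β : ℝ, |α| ≤ 1 / 2 → |β| ≤ 1 / 2 → (a ≤ |α| ∨ b ≤ |β|) → ‖fhat n A α β‖ ^ n ≤ δ) :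
    (((dieFinset n).filter fun B => ties A B).card : ℝ) ≤ 16 * ((n : ℝ) ^ n * (a * b + δ)) := by
  have h1 := sum_Phi_bound n hn A a b δ ha ha' hb hb' h
  have h2 : ∑ B ∈ (dieFinset n).filter (fun B => ties A B), Phi (SU A B) * Phi (SV B) ≤
      ∑ B ∈ allSeq n n, Phi (SU A B) * Phi (SV B) := by
    refine Finset.sum_le_sum_of_subset_of_nonneg ?_ (fun B _ _ => mul_nonneg (Phi_nonneg _) (Phi_nonneg _))
    exact (Finset.filter_subset _ _).trans (Finset.filter_subset _ _)
  have h3 : ∑ B ∈ (dieFinset n).filter (fun B => ties A B), Phi (SU A B) * Phi (SV B) =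
      (((dieFinset n).filter fun B => ties A B).card : ℝ) * (1 / 16) := by
    rw [← nsmul_eq_mul, ← Finset.sum_const]
    refine Finset.sum_congr rfl fun B hB => ?_
    rw [Finset.mem_filter] at hB
    rw [(SV_zero hB.1).1, SU_zero hB.1 hB.2, Phi_zero]; norm_num
  linarith

lemma log_div_tendsto : Filter.Tendsto (fun n : ℕ => Real.log n / n) Filter.atTop (nhds 0) := by
  have h := Real.isLittleO_log_id_atTop.tendsto_div_nhds_zero
  exact h.comp tendsto_natCast_atTop_atTop

/-- for all large n and any n-sided die A satisfying the max-norm bound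
on g_A and the outside-box bound on |f̂|^n, the probability that A ties with a
uniformly random n-sided die B is at most 10^18·(log n)^{5/2}/n. -/
theorem ties_probability_bound :
    ∃ N : ℕ, ∀ n : ℕ, N ≤ n → ∀ A ∈ dieFinset n,
      (∀ j ∈ Finset.Icc 1 n, |gA A j| ≤ 2 * Real.sqrt (n * Real.log n)) →
      (∀ α β : ℝ, |α| ≤ 1 / 2 → |β| ≤ 1 / 2 →
        (10 ^ 7 * Real.log n / n ≤ |α| ∨
          10 ^ 9 * (Real.log n / n) ^ ((3 : ℝ) / 2) ≤ |β|) →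
        ‖fhat n A α β‖ ^ n ≤ (n : ℝ) ^ (-10 : ℤ)) →
      (((dieFinset n).filter fun B => ties A B).card : ℝ) / (dieFinset n).card ≤
        10 ^ 18 * Real.log n ^ ((5 : ℝ) / 2) / n := by
  have ev := log_div_tendsto.eventually (gt_mem_nhds (show (0:ℝ) < 1 / 10 ^ 10 by norm_num))
  obtain ⟨N, hN⟩ := Filter.eventually_atTop.1 ev
  refine ⟨max N 4, fun n hn A _ _ hf => ?_⟩
  have hn4 : 4 ≤ n := le_trans (le_max_right _ _) hn
  have hl := hN n (le_trans (le_max_left _ _) hn)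
  have hnR : (4 : ℝ) ≤ n := by exact_mod_cast hn4
  have hn0 : (0 : ℝ) < n := by linarith
  have hL1 : 1 ≤ Real.log n := by
    rw [Real.le_log_iff_exp_le hn0]
    linarith [Real.exp_one_lt_d9]
  set L := Real.log n with hL
  set t := L / n with ht
  have ht0 : 0 ≤ t := by positivity
  have ht32 : t ^ ((3 : ℝ) / 2) ≤ t := by
    have := Real.rpow_le_rpow_of_exponent_ge (by positivity : 0 < t) (by linarith) (by norm_num : (1:ℝ) ≤ 3 / 2)
    simpa using this
  have hcount := ties_count_bound n (by omega) A (10 ^ 7 * L / n) (10 ^ 9 * t ^ ((3 : ℝ) / 2))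
    ((n : ℝ) ^ (-10 : ℤ)) (by positivity) (by rw [mul_div_assoc, ← ht]; linarith) (by positivity)
    (by linarith) hf
  have hlow := dieFinset_card_lower n hn4
  have hDpos : (0 : ℝ) < (dieFinset n).card := by
    by_contra hcon
    have h0 : ((dieFinset n).card : ℝ) = 0 := le_antisymm (not_lt.1 hcon) (Nat.cast_nonneg _)
    rw [h0, mul_zero] at hlow
    have : (0 : ℝ) < (n : ℝ) ^ n := by positivity
    linarith
  set D : ℝ := ((dieFinset n).card : ℝ)
  -- express everything with powers
  have hab : 10 ^ 7 * L / n * (10 ^ 9 * t ^ ((3 : ℝ) / 2)) = 10 ^ 16 * t ^ ((5 : ℝ) / 2) := by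
    have : t ^ ((5 : ℝ) / 2) = t * t ^ ((3 : ℝ) / 2) := by
      rw [show (5 : ℝ) / 2 = 1 + 3 / 2 by norm_num, Real.rpow_add (by positivity), Real.rpow_one]
    rw [this, ht]; ring
  have ht52 : t ^ ((5 : ℝ) / 2) = L ^ ((5 : ℝ) / 2) / (n : ℝ) ^ ((5 : ℝ) / 2) := by
    rw [ht, Real.div_rpow (by linarith) (by linarith)]
  have hn52 : (n : ℝ) ^ ((5 : ℝ) / 2) = n * (n * Real.sqrt n) := by
    rw [show (5 : ℝ) / 2 = 1 + (1 + 1 / 2) by norm_num, Real.rpow_add hn0, Real.rpow_add hn0, Real.rpow_one,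
      Real.sqrt_eq_rpow]
  have hδ : (n : ℝ) ^ (-10 : ℤ) ≤ t ^ ((5 : ℝ) / 2) := by
    rw [ht52, ← Real.rpow_intCast]
    have h1 : 1 ≤ L ^ ((5 : ℝ) / 2) := Real.one_le_rpow hL1 (by norm_num)
    calc (n : ℝ) ^ (((-10 : ℤ)) : ℝ) ≤ (n : ℝ) ^ (-((5 : ℝ) / 2)) :=
          Real.rpow_le_rpow_of_exponent_le (by linarith) (by norm_num)
      _ = 1 / (n : ℝ) ^ ((5 : ℝ) / 2) := by rw [Real.rpow_neg hn0.le, one_div]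
      _ ≤ _ := by gcongr
  have hq : 0 < (n : ℝ) * Real.sqrt n := by positivity
  rw [div_le_iff₀ hDpos]
  calc _ ≤ _ := hcount
    _ ≤ 16 * ((n : ℝ) ^ n * (10 ^ 16 * t ^ ((5 : ℝ) / 2) + t ^ ((5 : ℝ) / 2))) := by
        rw [hab]; gcongr
    _ ≤ 16 * ((4 * (n * Real.sqrt n) * D) * (10 ^ 16 * t ^ ((5 : ℝ) / 2) + t ^ ((5 : ℝ) / 2))) := by
        gcongr
    _ = 64 * (10 ^ 16 + 1) * L ^ ((5 : ℝ) / 2) / n * D := by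
        rw [ht52, hn52]; field_simp; ring
    _ ≤ _ := by gcongr; norm_num
end
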